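/- Let (X,G) ~ SSBM(n,2,p_n,q_n) with labels in {+1,−1}, and define SNR_n := n(p_n−q_n)²/(2(p_n+q_n)(1−(p_n+q_n)/2)). Assume that as n → ∞: (i) SNR_n → λ for a constant λ > 0, and (ii) n(p_n+q_n)/2·(1−(p_n+q_n)/2) → ∞. Let γ_*(λ) be the largest nonnegative solution of γ = λ(1 − mmse(γ)), and Ψ(γ,λ) = λ/4 + γ²/(4λ) − γ/2 + I(γ). Then lim_{n→∞} MMSE_n = 1 − γ_*(λ)²/λ² and lim_{n→∞} (1/n)·I(X;G) = Ψ(γ_*(λ), λ). In particular lim MMSE_n = 1 for λ ≤ 1 and lim MMSE_n < 1 for λ > 1. -/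

import Mathlib

open Filter MeasureTheory
open scoped Classical

abbrev VPair (n : ℕ) := {e : Fin n × Fin n // e.1 < e.2}

/-- Spin value of a Boolean label. -/
noncomputable def chi (b : Bool) : ℝ := if b then 1 else -1

/-- Joint mass of labels `x ∈ {±1}ⁿ` (i.i.d. uniform) and graph `g` in
`SSBM(n, 2, p, q)`. -/
noncomputable def ssbm2Mass (n : ℕ) (p q : ℝ) (x : Fin n → Bool) (g : VPair n → Bool) : ℝ :=
  ((1 : ℝ) / 2) ^ n *
    ∏ e : VPair n,
      if g e then (if x e.1.1 = x e.1.2 then p else q)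
      else 1 - (if x e.1.1 = x e.1.2 then p else q)

/-- Marginal probability of the graph `g`. -/
noncomputable def graphMarg (n : ℕ) (p q : ℝ) (g : VPair n → Bool) : ℝ :=
  ∑ x : Fin n → Bool, ssbm2Mass n p q x g

/-- Posterior mean `E[X_u X_v | G = g]`. -/
noncomputable def postMean (n : ℕ) (p q : ℝ) (g : VPair n → Bool) (u v : Fin n) : ℝ :=
  (∑ x : Fin n → Bool, ssbm2Mass n p q x g * (chi (x u) * chi (x v))) / graphMarg n p q g

/-- `MMSE_n = (1/(n(n−1))) E ‖XXᵀ − E[XXᵀ|G]‖_F²`. -/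
noncomputable def MMSEn (n : ℕ) (p q : ℝ) : ℝ :=
  (1 / ((n : ℝ) * ((n : ℝ) - 1))) *
    ∑ g : VPair n → Bool, ∑ x : Fin n → Bool,
      ssbm2Mass n p q x g *
        ∑ u : Fin n, ∑ v : Fin n, (chi (x u) * chi (x v) - postMean n p q g u v) ^ 2

/-- Mutual information `I(X; G)` between the labels and the graph. -/
noncomputable def miSBM (n : ℕ) (p q : ℝ) : ℝ :=
  ∑ x : Fin n → Bool, ∑ g : VPair n → Bool,
    ssbm2Mass n p q x g *
      Real.log (ssbm2Mass n p q x g / (((1 : ℝ) / 2) ^ n * graphMarg n p q g))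

/-- Scalar Gaussian channel `Y₀ = √γ X₀ + Z₀`: minimum mean square error
`mmse(γ) = 1 − E tanh²(γ + √γ Z₀)`. -/
noncomputable def gmmse (γ : ℝ) : ℝ :=
  1 - ∫ z, Real.tanh (γ + Real.sqrt γ * z) ^ 2 ∂(ProbabilityTheory.gaussianReal 0 1)

/-- Scalar Gaussian channel mutual information `I(γ) = γ − E log cosh(γ + √γ Z₀)`. -/
noncomputable def gInfo (γ : ℝ) : ℝ :=
  γ - ∫ z, Real.log (Real.cosh (γ + Real.sqrt γ * z)) ∂(ProbabilityTheory.gaussianReal 0 1)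

/-- `Ψ(γ, λ) = λ/4 + γ²/(4λ) − γ/2 + I(γ)`. -/
noncomputable def Psi (γ lam : ℝ) : ℝ := lam / 4 + γ ^ 2 / (4 * lam) - γ / 2 + gInfo γ

/-- The standard Gaussian law. -/
noncomputable abbrev stdGauss : Measure ℝ := ProbabilityTheory.gaussianReal 0 1

lemma integrable_abs_pow_stdGauss (k : ℕ) : Integrable (fun z : ℝ => |z| ^ k) stdGauss := by
  have h := (ProbabilityTheory.memLp_id_gaussianReal (μ := 0) (v := 1) (k : NNReal))
  have := h.integrable_norm_pow'
  simpa using this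

lemma integrable_id_stdGauss : Integrable (fun z : ℝ => z) stdGauss := by
  have h := integrable_abs_pow_stdGauss 1
  refine h.mono (by fun_prop) (ae_of_all _ fun z => by simp)

lemma integrable_sq_stdGauss : Integrable (fun z : ℝ => z ^ 2) stdGauss := by
  simpa using integrable_abs_pow_stdGauss 2

lemma integral_id_stdGauss : ∫ z, z ∂stdGauss = 0 := ProbabilityTheory.integral_id_gaussianReal

lemma integral_sq_stdGauss : ∫ z, z ^ 2 ∂stdGauss = 1 := by
  have h := ProbabilityTheory.variance_fun_id_gaussianReal (μ := 0) (v := 1)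
  rw [ProbabilityTheory.variance_eq_integral (by fun_prop)] at h
  simpa using h

lemma integrable_of_bounded_stdGauss {F : ℝ → ℝ} (hF : Continuous F) {A : ℝ} (hA : ∀ x, |F x| ≤ A) :
    Integrable F stdGauss :=
  Integrable.of_bound hF.aestronglyMeasurable A (ae_of_all _ fun x => by simpa using hA x)

/-- Gaussian convolution: adding two independent centered Gaussians. -/
lemma integral_integral_stdGauss {φ : ℝ → ℝ} (hφ : Continuous φ) {A : ℝ} (hA : ∀ x, |φ x| ≤ A)
    (a : ℝ) {s t : ℝ} (hs : 0 ≤ s) (ht : 0 ≤ t) :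
    ∫ z, ∫ z', φ (a + √s * z + √t * z') ∂stdGauss ∂stdGauss =
      ∫ z, φ (a + √(s + t) * z) ∂stdGauss := by
  have key : ∀ r : ℝ, ∀ hr : 0 ≤ r, stdGauss.map (fun z => √r * z) =
      ProbabilityTheory.gaussianReal 0 r.toNNReal := by
    intro r hr
    rw [ProbabilityTheory.gaussianReal_map_const_mul]
    congr 1
    · simp
    · ext; simp [Real.sq_sqrt hr, hr]
  have hb : ∀ b : ℝ, ∀ r : ℝ, ∀ hr : 0 ≤ r, ∫ z, φ (b + √r * z) ∂stdGauss =
      ∫ y, φ (b + y) ∂(ProbabilityTheory.gaussianReal 0 r.toNNReal) := by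
    intro b r hr
    rw [← key r hr, integral_map (by fun_prop) (by
      exact (Continuous.aestronglyMeasurable (by fun_prop)))]
  rw [hb a (s + t) (by positivity)]
  have hconv : ProbabilityTheory.gaussianReal 0 (s + t).toNNReal =
      (ProbabilityTheory.gaussianReal 0 s.toNNReal).conv (ProbabilityTheory.gaussianReal 0 t.toNNReal) := by
    rw [ProbabilityTheory.gaussianReal_conv_gaussianReal]
    rw [Real.toNNReal_add hs ht, add_zero]
  rw [hconv, integral_conv (Integrable.of_bound (Continuous.aestronglyMeasurable (by fun_prop)) A
    (ae_of_all _ fun x => by simpa using hA _))]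
  simp_rw [hb _ t ht]
  rw [← key s hs, integral_map (by fun_prop)]
  · simp [add_assoc]
  · refine Continuous.aestronglyMeasurable ?_
    refine continuous_of_dominated (bound := fun _ => A) ?_ ?_ ?_ ?_
    · intro x; exact Continuous.aestronglyMeasurable (by fun_prop)
    · intro x; exact ae_of_all _ fun y => by simpa using hA _
    · exact integrable_const _
    · exact ae_of_all _ fun y => by fun_prop

lemma hasDerivAt_gaussianPDFReal (z : ℝ) :
    HasDerivAt (ProbabilityTheory.gaussianPDFReal 0 1)
      (-z * ProbabilityTheory.gaussianPDFReal 0 1 z) z := by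
  rw [ProbabilityTheory.gaussianPDFReal_def]
  have h : HasDerivAt (fun x : ℝ => -(x - 0) ^ 2 / (2 * ((1 : NNReal) : ℝ))) (-z) z := by
    have := (((hasDerivAt_id z).sub_const 0).pow 2).neg.div_const (2 * ((1 : NNReal) : ℝ))
    exact this.congr_deriv (by simp; ring)
  exact ((h.exp).const_mul ((√(2 * Real.pi * ((1 : NNReal) : ℝ)))⁻¹)).congr_deriv (by ring)

lemma integrable_mul_gaussianPDFReal {F : ℝ → ℝ} (h : Integrable F stdGauss) :
    Integrable (fun z => F z * ProbabilityTheory.gaussianPDFReal 0 1 z) := by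
  rw [stdGauss, ProbabilityTheory.gaussianReal_of_var_ne_zero _ one_ne_zero,
    integrable_withDensity_iff (ProbabilityTheory.measurable_gaussianPDF _ _)
      (ae_of_all _ fun _ => ProbabilityTheory.gaussianPDF_lt_top)] at h
  simpa [ProbabilityTheory.toReal_gaussianPDF] using h

/-- Gaussian integration by parts. -/
lemma stein_stdGauss {ψ ψ' : ℝ → ℝ} (h : ∀ x, HasDerivAt ψ (ψ' x) x) (hc : Continuous ψ')
    {A : ℝ} (hA : ∀ x, |ψ x| ≤ A) (hA' : ∀ x, |ψ' x| ≤ A) :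
    ∫ z, ψ z * z ∂stdGauss = ∫ z, ψ' z ∂stdGauss := by
  have hψc : Continuous ψ := continuous_iff_continuousAt.2 fun x => (h x).continuousAt
  have i1 : Integrable (fun z => ψ z * z) stdGauss := by
    refine Integrable.mono (integrable_id_stdGauss.const_mul A) (by fun_prop) (ae_of_all _ fun z => ?_)
    simp only [norm_mul, Real.norm_eq_abs]
    exact mul_le_mul_of_nonneg_right ((hA z).trans (le_abs_self A)) (abs_nonneg _)
  have i2 := integrable_of_bounded_stdGauss hc hA'
  have i3 := integrable_of_bounded_stdGauss hψc hA
  have := integral_mul_deriv_eq_deriv_mul_of_integrable (u := ψ) (u' := ψ')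
    (v := ProbabilityTheory.gaussianPDFReal 0 1)
    (v' := fun z => -z * ProbabilityTheory.gaussianPDFReal 0 1 z)
    (fun x _ => h x) (fun x _ => hasDerivAt_gaussianPDFReal x) (by
      convert (integrable_mul_gaussianPDFReal i1).neg using 1
      ext z; simp; ring) (integrable_mul_gaussianPDFReal i2) (integrable_mul_gaussianPDFReal i3)
  rw [ProbabilityTheory.integral_gaussianReal_eq_integral_smul one_ne_zero,
    ProbabilityTheory.integral_gaussianReal_eq_integral_smul one_ne_zero]
  have e : ∀ x : ℝ, ψ x * (-x * ProbabilityTheory.gaussianPDFReal 0 1 x) =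
      -(ProbabilityTheory.gaussianPDFReal 0 1 x • (ψ x * x)) := by intro x; simp; ring
  simp_rw [e, integral_neg] at this
  rw [neg_inj] at this
  rw [this]
  congr 1; ext x; simp [mul_comm]

/-- Shift of a Gaussian as an exponential change of measure. -/
lemma integral_shift_stdGauss (φ : ℝ → ℝ) (c : ℝ) :
    ∫ z, φ (c + z) ∂stdGauss = ∫ z, φ z * Real.exp (c * z - c ^ 2 / 2) ∂stdGauss := by
  rw [ProbabilityTheory.integral_gaussianReal_eq_integral_smul one_ne_zero,
    ProbabilityTheory.integral_gaussianReal_eq_integral_smul one_ne_zero]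
  rw [← integral_add_left_eq_self (fun z => ProbabilityTheory.gaussianPDFReal 0 1 z •
    (φ z * Real.exp (c * z - c ^ 2 / 2))) c]
  congr 1; ext z
  simp only [ProbabilityTheory.gaussianPDFReal_def, smul_eq_mul]
  rw [show ∀ a b d e : ℝ, a * b * (d * e) = a * (b * e) * d by intros; ring, ← Real.exp_add]
  congr 3
  simp; ring

lemma integral_neg_stdGauss (φ : ℝ → ℝ) : ∫ z, φ (-z) ∂stdGauss = ∫ z, φ z ∂stdGauss := by
  have h := ProbabilityTheory.gaussianReal_map_neg (μ := 0) (v := 1)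
  rw [neg_zero] at h
  conv_rhs => rw [stdGauss, ← h]
  exact (MeasurableEquiv.neg ℝ).measurableEmbedding.integral_map φ |>.symm

lemma integral_exp_mul_stdGauss (t : ℝ) : ∫ z, Real.exp (t * z) ∂stdGauss = Real.exp (t ^ 2 / 2) := by
  have := congrFun (ProbabilityTheory.mgf_id_gaussianReal (μ := 0) (v := 1)) t
  simpa [ProbabilityTheory.mgf] using this

lemma hasDerivAt_integral_stdGauss {φ φ1 φ2 : ℝ → ℝ} (h1 : ∀ x, HasDerivAt φ (φ1 x) x)
    (h2 : ∀ x, HasDerivAt φ1 (φ2 x) x) (hc : Continuous φ2) {A : ℝ}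
    (hA1 : ∀ x, |φ1 x| ≤ A) (hA2 : ∀ x, |φ2 x| ≤ A) (c : ℝ)
    (hig : ∀ γ, Integrable (fun z => φ (c * γ + √γ * z)) stdGauss) {γ : ℝ} (hγ : 0 < γ) :
    HasDerivAt (fun γ => ∫ z, φ (c * γ + √γ * z) ∂stdGauss)
      (∫ z, (c * φ1 (c * γ + √γ * z) + φ2 (c * γ + √γ * z) / 2) ∂stdGauss) γ := by
  have hφc : Continuous φ := continuous_iff_continuousAt.2 fun x => (h1 x).continuousAt
  have hφ1c : Continuous φ1 := continuous_iff_continuousAt.2 fun x => (h2 x).continuousAt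
  have hA0 : 0 ≤ A := (abs_nonneg _).trans (hA1 0)
  have hsq : 0 < √γ := Real.sqrt_pos.2 hγ
  have main := (hasDerivAt_integral_of_dominated_loc_of_deriv_le (μ := stdGauss) (x₀ := γ)
    (F := fun γ z => φ (c * γ + √γ * z)) (s := Set.Ioi (γ / 2))
    (F' := fun γ z => φ1 (c * γ + √γ * z) * (c + 1 / (2 * √γ) * z))
    (bound := fun z => A * (|c| + 1 / (2 * √(γ / 2)) * |z|))
    (Ioi_mem_nhds (by linarith))
    (Eventually.of_forall fun x => Continuous.aestronglyMeasurable (by fun_prop)) (hig γ)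
    (Continuous.aestronglyMeasurable (by fun_prop)) (ae_of_all _ fun z x hx => by
      rw [Real.norm_eq_abs, abs_mul]
      have hx' : γ / 2 < x := hx
      refine mul_le_mul (hA1 _) ?_ (abs_nonneg _) hA0
      refine (abs_add_le _ _).trans ?_
      rw [abs_mul, abs_of_nonneg (show 0 ≤ 1 / (2 * √x) by positivity)]
      have := Real.sqrt_pos.2 (half_pos hγ)
      have := Real.sqrt_le_sqrt hx'.le
      gcongr) (by
      have := integrable_abs_pow_stdGauss 1
      simp only [pow_one] at this
      exact ((integrable_const _).add (this.const_mul _)).const_mul _)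
    (ae_of_all _ fun z x hx => by
      have hx' : γ / 2 < x := hx
      have hx0 : x ≠ 0 := by linarith
      have hd : HasDerivAt (fun x : ℝ => c * x + √x * z) (c + 1 / (2 * √x) * z) x := by
        have := ((hasDerivAt_id x).const_mul c).add ((Real.hasDerivAt_sqrt hx0).mul_const z)
        exact this.congr_deriv (by simp)
      exact (h1 _).comp x hd)).2
  refine main.congr_deriv ?_
  have hst := stein_stdGauss (ψ := fun z => φ1 (c * γ + √γ * z))
    (ψ' := fun z => φ2 (c * γ + √γ * z) * √γ) (A := A * (1 + √γ)) (fun z => by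
      have hd : HasDerivAt (fun z : ℝ => c * γ + √γ * z) (√γ) z := by
        simpa using ((hasDerivAt_id z).const_mul (√γ)).const_add (c * γ)
      exact (h2 _).comp z hd) (by fun_prop)
    (fun x => (hA1 _).trans (by nlinarith)) (fun x => by
      rw [abs_mul, abs_of_pos hsq]; nlinarith [hA2 (c * γ + √γ * x)])
  have i1 : Integrable (fun z => φ1 (c * γ + √γ * z)) stdGauss :=
    integrable_of_bounded_stdGauss (by fun_prop) (fun _ => hA1 _)
  have i2 : Integrable (fun z => φ2 (c * γ + √γ * z)) stdGauss :=
    integrable_of_bounded_stdGauss (by fun_prop) (fun _ => hA2 _)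
  have i3 : Integrable (fun z => φ1 (c * γ + √γ * z) * z) stdGauss := by
    refine Integrable.mono (integrable_id_stdGauss.const_mul A)
      (Continuous.aestronglyMeasurable (by fun_prop)) (ae_of_all _ fun z => ?_)
    simp only [norm_mul, Real.norm_eq_abs]
    exact mul_le_mul_of_nonneg_right ((hA1 _).trans (le_abs_self A)) (abs_nonneg _)
  symm
  rw [integral_add (i1.const_mul c) (i2.div_const 2)]
  have e : ∀ z : ℝ, φ1 (c * γ + √γ * z) * (c + 1 / (2 * √γ) * z) =
      c * φ1 (c * γ + √γ * z) + 1 / (2 * √γ) * (φ1 (c * γ + √γ * z) * z) := by intro z; ring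
  simp_rw [e]
  rw [integral_add (i1.const_mul c) (i3.const_mul _), integral_const_mul (1 / (2 * √γ)), hst,
    integral_mul_const, integral_div]
  field_simp

lemma abs_tanh_le_one (x : ℝ) : |Real.tanh x| ≤ 1 := (Real.abs_tanh_lt_one x).le

lemma inv_cosh_pos (x : ℝ) : 0 < (Real.cosh x)⁻¹ := inv_pos.2 (Real.cosh_pos x)

lemma inv_cosh_le_one (x : ℝ) : (Real.cosh x)⁻¹ ≤ 1 := inv_le_one_of_one_le₀ (Real.one_le_cosh x)

lemma continuous_inv_cosh : Continuous fun x => (Real.cosh x)⁻¹ :=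
  Real.continuous_cosh.inv₀ fun x => (Real.cosh_pos x).ne'

lemma continuous_tanh_real : Continuous Real.tanh := by
  have : Real.tanh = fun x => Real.sinh x / Real.cosh x := funext Real.tanh_eq_sinh_div_cosh
  rw [this]
  exact Real.continuous_sinh.div Real.continuous_cosh fun x => (Real.cosh_pos x).ne'

lemma hasDerivAt_tanh_real (x : ℝ) : HasDerivAt Real.tanh ((Real.cosh x)⁻¹ ^ 2) x := by
  have : Real.tanh = fun x => Real.sinh x / Real.cosh x := funext Real.tanh_eq_sinh_div_cosh
  rw [this]
  refine ((Real.hasDerivAt_sinh x).div (Real.hasDerivAt_cosh x) (Real.cosh_pos x).ne').congr_deriv ?_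
  have := (Real.cosh_pos x).ne'
  have := Real.cosh_sq_sub_sinh_sq x
  field_simp
  linarith

lemma hasDerivAt_log_cosh (x : ℝ) : HasDerivAt (fun x => Real.log (Real.cosh x)) (Real.tanh x) x := by
  refine ((Real.hasDerivAt_cosh x).log (Real.cosh_pos x).ne').congr_deriv ?_
  rw [Real.tanh_eq_sinh_div_cosh]

lemma hasDerivAt_inv_cosh (x : ℝ) :
    HasDerivAt (fun x => (Real.cosh x)⁻¹) (-(Real.tanh x * (Real.cosh x)⁻¹)) x := by
  refine ((Real.hasDerivAt_cosh x).inv (Real.cosh_pos x).ne').congr_deriv ?_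
  rw [Real.tanh_eq_sinh_div_cosh]
  have := (Real.cosh_pos x).ne'
  field_simp

lemma tanh_sq_eq (x : ℝ) : Real.tanh x ^ 2 = 1 - (Real.cosh x)⁻¹ ^ 2 := by
  rw [Real.tanh_eq_sinh_div_cosh]
  have := (Real.cosh_pos x).ne'
  have := Real.cosh_sq_sub_sinh_sq x
  field_simp
  linarith

lemma hasDerivAt_inv_cosh_two (x : ℝ) :
    HasDerivAt (fun x => -(Real.tanh x * (Real.cosh x)⁻¹))
      ((Real.cosh x)⁻¹ - 2 * (Real.cosh x)⁻¹ ^ 3) x := by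
  refine ((hasDerivAt_tanh_real x).mul (hasDerivAt_inv_cosh x)).neg.congr_deriv ?_
  have := tanh_sq_eq x
  linear_combination (Real.cosh x)⁻¹ * this

lemma abs_log_cosh_le (x : ℝ) : |Real.log (Real.cosh x)| ≤ |x| := by
  rw [abs_of_nonneg (Real.log_nonneg (Real.one_le_cosh x)), ← Real.cosh_abs]
  refine (Real.log_le_log (Real.cosh_pos _) (?_ : _ ≤ Real.exp |x|)).trans (Real.log_exp _).le
  rw [Real.cosh_eq]
  have : Real.exp (-|x|) ≤ Real.exp |x| := Real.exp_le_exp.2 (by linarith [abs_nonneg x])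
  linarith

lemma integrable_exp_mul_stdGauss (t : ℝ) : Integrable (fun z => Real.exp (t * z)) stdGauss :=
  ProbabilityTheory.integrable_exp_mul_gaussianReal t

/-- Observation of the scalar channel under the planted measure, as a tilted centered Gaussian. -/
lemma integral_planted (φ : ℝ → ℝ) {γ : ℝ} (hγ : 0 ≤ γ) :
    ∫ z, φ (γ + √γ * z) ∂stdGauss =
      Real.exp (-γ / 2) * ∫ z, φ (√γ * z) * Real.exp (√γ * z) ∂stdGauss := by
  have h := integral_shift_stdGauss (fun y => φ (√γ * y)) (√γ)
  have e1 : ∀ z, √γ * (√γ + z) = γ + √γ * z := fun z => by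
    rw [mul_add, Real.mul_self_sqrt hγ]
  simp_rw [e1] at h
  rw [h, ← integral_const_mul]
  congr 1; ext z
  rw [Real.sq_sqrt hγ, sub_eq_add_neg, Real.exp_add, show -(γ / 2) = -γ / 2 by ring]
  ring

lemma integrable_mul_exp_stdGauss {φ : ℝ → ℝ} (hφ : Continuous φ) {A : ℝ} (hA : ∀ x, |φ x| ≤ A)
    (t : ℝ) : Integrable (fun z => φ (t * z) * Real.exp (t * z)) stdGauss :=
  (integrable_exp_mul_stdGauss t).bdd_mul (c := A)
    (Continuous.aestronglyMeasurable (by fun_prop)) (ae_of_all _ fun x => by simpa using hA _)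

lemma integral_planted_even {φ : ℝ → ℝ} (hφ : Continuous φ) {A : ℝ} (hA : ∀ x, |φ x| ≤ A)
    (he : ∀ x, φ (-x) = φ x) {γ : ℝ} (hγ : 0 ≤ γ) :
    ∫ z, φ (γ + √γ * z) ∂stdGauss =
      Real.exp (-γ / 2) * ∫ z, φ (√γ * z) * Real.cosh (√γ * z) ∂stdGauss := by
  rw [integral_planted φ hγ]
  congr 1
  have h := integral_neg_stdGauss (fun z => φ (√γ * z) * Real.exp (√γ * z))
  have i1 := integrable_mul_exp_stdGauss hφ hA (√γ)
  have i2 := integrable_mul_exp_stdGauss hφ hA (-√γ)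
  have e : ∀ z, φ (√γ * -z) * Real.exp (√γ * -z) = φ (-√γ * z) * Real.exp (-√γ * z) := by
    intro z; simp
  simp_rw [e] at h
  have : ∀ z, φ (√γ * z) * Real.cosh (√γ * z) =
      (φ (√γ * z) * Real.exp (√γ * z) + φ (-√γ * z) * Real.exp (-√γ * z)) / 2 := by
    intro z; rw [Real.cosh_eq, neg_mul, he]; ring
  simp_rw [this]
  rw [integral_div, integral_add i1 i2, h]
  ring

lemma integral_planted_odd {φ : ℝ → ℝ} (hφ : Continuous φ) {A : ℝ} (hA : ∀ x, |φ x| ≤ A)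
    (ho : ∀ x, φ (-x) = -φ x) {γ : ℝ} (hγ : 0 ≤ γ) :
    ∫ z, φ (γ + √γ * z) ∂stdGauss =
      Real.exp (-γ / 2) * ∫ z, φ (√γ * z) * Real.sinh (√γ * z) ∂stdGauss := by
  rw [integral_planted φ hγ]
  congr 1
  have h := integral_neg_stdGauss (fun z => φ (√γ * z) * Real.exp (√γ * z))
  have i1 := integrable_mul_exp_stdGauss hφ hA (√γ)
  have i2 := integrable_mul_exp_stdGauss hφ hA (-√γ)
  have e : ∀ z, φ (√γ * -z) * Real.exp (√γ * -z) = φ (-√γ * z) * Real.exp (-√γ * z) := by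
    intro z; simp
  simp_rw [e] at h
  have : ∀ z, φ (√γ * z) * Real.sinh (√γ * z) =
      (φ (√γ * z) * Real.exp (√γ * z) + φ (-√γ * z) * Real.exp (-√γ * z)) / 2 := by
    intro z; rw [Real.sinh_eq, neg_mul, ho]; ring
  simp_rw [this]
  rw [integral_div, integral_add i1 i2, h]
  ring

lemma abs_tanh_sq_le_one (x : ℝ) : |Real.tanh x ^ 2| ≤ 1 := by
  rw [abs_pow]; exact pow_le_one₀ (abs_nonneg _) (abs_tanh_le_one x)

lemma integral_cosh_stdGauss {γ : ℝ} (hγ : 0 ≤ γ) :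
    ∫ z, Real.cosh (√γ * z) ∂stdGauss = Real.exp (γ / 2) := by
  have i1 := integrable_exp_mul_stdGauss (√γ)
  have i2 := integrable_exp_mul_stdGauss (-√γ)
  have e : ∀ z, Real.cosh (√γ * z) = (Real.exp (√γ * z) + Real.exp (-√γ * z)) / 2 := by
    intro z; rw [Real.cosh_eq, neg_mul]
  simp_rw [e]
  rw [integral_div, integral_add i1 i2, integral_exp_mul_stdGauss, integral_exp_mul_stdGauss, neg_sq,
    Real.sq_sqrt hγ]
  ring

lemma integrable_cosh_stdGauss (t : ℝ) : Integrable (fun z => Real.cosh (t * z)) stdGauss := by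
  have e : ∀ z, Real.cosh (t * z) = (Real.exp (t * z) + Real.exp (-t * z)) / 2 := by
    intro z; rw [Real.cosh_eq, neg_mul]
  simp_rw [e]
  exact ((integrable_exp_mul_stdGauss t).add (integrable_exp_mul_stdGauss (-t))).div_const 2

lemma integrable_inv_cosh_pow (t : ℝ) (k : ℕ) :
    Integrable (fun z => (Real.cosh (t * z))⁻¹ ^ k) stdGauss := by
  refine integrable_of_bounded_stdGauss (A := 1) ?_ fun x => ?_
  · exact (continuous_inv_cosh.comp (continuous_const.mul continuous_id)).pow k
  · rw [abs_of_nonneg (pow_nonneg (inv_cosh_pos _).le _)]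
    exact pow_le_one₀ (inv_cosh_pos _).le (inv_cosh_le_one _)

lemma gmmse_eq {γ : ℝ} (hγ : 0 ≤ γ) :
    gmmse γ = Real.exp (-γ / 2) * ∫ z, (Real.cosh (√γ * z))⁻¹ ∂stdGauss := by
  have h := integral_planted_even (φ := fun x => Real.tanh x ^ 2) (continuous_tanh_real.pow 2)
    abs_tanh_sq_le_one (fun x => by simp) hγ
  have e : ∀ x : ℝ, Real.tanh x ^ 2 * Real.cosh x = Real.cosh x - (Real.cosh x)⁻¹ := by
    intro x
    rw [tanh_sq_eq]
    have := (Real.cosh_pos x).ne'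
    field_simp
  simp_rw [e] at h
  have i := integrable_inv_cosh_pow (√γ) 1
  simp only [pow_one] at i
  rw [integral_sub (integrable_cosh_stdGauss _) i, integral_cosh_stdGauss hγ, mul_sub,
    ← Real.exp_add] at h
  rw [gmmse]
  change 1 - ∫ z, Real.tanh (γ + √γ * z) ^ 2 ∂stdGauss = _
  rw [h, show -γ / 2 + γ / 2 = 0 by ring, Real.exp_zero]
  ring

/-- Nishimori identity of the scalar channel. -/
lemma integral_tanh_planted {γ : ℝ} (hγ : 0 ≤ γ) :
    ∫ z, Real.tanh (γ + √γ * z) ∂stdGauss = 1 - gmmse γ := by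
  have h := integral_planted_even (φ := fun x => Real.tanh x ^ 2) (continuous_tanh_real.pow 2)
    abs_tanh_sq_le_one (fun x => by simp) hγ
  have h' := integral_planted_odd (φ := fun x => Real.tanh x) continuous_tanh_real
    abs_tanh_le_one (fun x => by simp) hγ
  rw [gmmse]
  change _ = 1 - (1 - ∫ z, Real.tanh (γ + √γ * z) ^ 2 ∂stdGauss)
  rw [sub_sub_cancel, h, h']
  congr 2; ext z
  rw [Real.tanh_eq_sinh_div_cosh]
  have := (Real.cosh_pos (√γ * z)).ne'
  field_simp

lemma continuous_gmmse : Continuous gmmse := by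
  unfold gmmse
  refine continuous_const.sub (continuous_of_dominated (bound := fun _ => 1) ?_ ?_ ?_ ?_)
  · intro x
    exact (((continuous_tanh_real.comp (by fun_prop)).pow 2)).aestronglyMeasurable
  · intro x; exact ae_of_all _ fun z => by simpa using abs_tanh_sq_le_one _
  · exact integrable_const _
  · refine ae_of_all _ fun z => ?_
    exact (continuous_tanh_real.comp (by fun_prop)).pow 2

lemma integrable_log_cosh (γ : ℝ) :
    Integrable (fun z => Real.log (Real.cosh (γ + √γ * z))) stdGauss := by
  have hc : Continuous fun x => Real.log (Real.cosh x) :=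
    Real.continuous_cosh.log fun x => (Real.cosh_pos x).ne'
  refine Integrable.mono (g := fun z => |γ| + √γ * |z|) ?_
    (hc.comp (by fun_prop)).aestronglyMeasurable (ae_of_all _ fun z => ?_)
  · have := integrable_abs_pow_stdGauss 1
    simp only [pow_one] at this
    exact (integrable_const _).add (this.const_mul _)
  · rw [Real.norm_eq_abs, Real.norm_eq_abs, abs_of_nonneg (by positivity : 0 ≤ |γ| + √γ * |z|)]
    refine (abs_log_cosh_le _).trans ((abs_add_le _ _).trans ?_)
    rw [abs_mul, abs_of_nonneg (Real.sqrt_nonneg γ)]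

lemma continuous_gInfo : Continuous gInfo := by
  have hc : Continuous fun x => Real.log (Real.cosh x) :=
    Real.continuous_cosh.log fun x => (Real.cosh_pos x).ne'
  unfold gInfo
  refine continuous_id.sub (continuous_iff_continuousAt.2 fun γ => ?_)
  refine continuousAt_of_dominated (bound := fun z => (|γ| + 1) + √(γ + 1) * |z|) ?_ ?_ ?_ ?_
  · exact Eventually.of_forall fun x => (hc.comp (by fun_prop)).aestronglyMeasurable
  · filter_upwards [Metric.ball_mem_nhds γ one_pos] with x hx
    refine ae_of_all _ fun z => ?_
    rw [Metric.mem_ball, Real.dist_eq] at hx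
    refine (abs_log_cosh_le _).trans ((abs_add_le _ _).trans ?_)
    rw [abs_mul, abs_of_nonneg (Real.sqrt_nonneg _)]
    have h1 : |x| ≤ |γ| + 1 := by
      have := abs_sub_abs_le_abs_sub x γ
      linarith
    have h2 : √x ≤ √(γ + 1) := Real.sqrt_le_sqrt (by linarith [(abs_lt.1 hx).2])
    gcongr
  · have := integrable_abs_pow_stdGauss 1
    simp only [pow_one] at this
    exact (integrable_const _).add (this.const_mul _)
  · refine ae_of_all _ fun z => ?_
    exact (hc.comp (by fun_prop)).continuousAt

lemma hasDerivAt_gInfo {γ : ℝ} (hγ : 0 < γ) : HasDerivAt gInfo (gmmse γ / 2) γ := by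
  have h := hasDerivAt_integral_stdGauss hasDerivAt_log_cosh hasDerivAt_tanh_real
    (continuous_inv_cosh.pow 2) (A := 1) abs_tanh_le_one (fun x => by
      rw [abs_pow, abs_of_pos (inv_cosh_pos x)]
      exact pow_le_one₀ (inv_cosh_pos x).le (inv_cosh_le_one x)) 1
    (fun γ => by simpa using integrable_log_cosh γ) hγ
  simp only [one_mul] at h
  refine ((hasDerivAt_id γ).sub h).congr_deriv ?_
  have i1 : Integrable (fun z => Real.tanh (γ + √γ * z)) stdGauss :=
    integrable_of_bounded_stdGauss (continuous_tanh_real.comp (by fun_prop)) (fun _ => abs_tanh_le_one _)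
  have i2 : Integrable (fun z => Real.tanh (γ + √γ * z) ^ 2) stdGauss :=
    integrable_of_bounded_stdGauss ((continuous_tanh_real.comp (by fun_prop)).pow 2)
      (fun _ => abs_tanh_sq_le_one _)
  have e : ∀ z, Real.tanh (γ + √γ * z) + (Real.cosh (γ + √γ * z))⁻¹ ^ 2 / 2 =
      Real.tanh (γ + √γ * z) + (1 / 2 - Real.tanh (γ + √γ * z) ^ 2 / 2) := by
    intro z; rw [tanh_sq_eq]; ring
  simp_rw [e]
  have i3 : Integrable (fun z => 1 / 2 - Real.tanh (γ + √γ * z) ^ 2 / 2) stdGauss :=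
    (integrable_const _).sub (i2.div_const 2)
  rw [integral_add i1 i3,
    integral_sub (integrable_const _) (i2.div_const 2), integral_tanh_planted hγ.le]
  have : ∫ z, Real.tanh (γ + √γ * z) ^ 2 ∂stdGauss = 1 - gmmse γ := by rw [gmmse]; ring
  rw [integral_div (2 : ℝ) (fun z => Real.tanh (γ + √γ * z) ^ 2), this]
  simp only [integral_const, probReal_univ, smul_eq_mul, one_mul]
  ring

lemma gInfo_zero : gInfo 0 = 0 := by simp [gInfo]

lemma gmmse_zero : gmmse 0 = 1 := by simp [gmmse]

lemma gmmse_nonneg (γ : ℝ) : 0 ≤ gmmse γ := by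
  rw [gmmse, sub_nonneg]
  have := integral_mono (μ := stdGauss) (f := fun z => Real.tanh (γ + √γ * z) ^ 2) (g := fun _ => 1)
    (integrable_of_bounded_stdGauss ((continuous_tanh_real.comp (by fun_prop)).pow 2)
      (fun _ => abs_tanh_sq_le_one _)) (integrable_const _)
    (fun z => (le_abs_self _).trans (abs_tanh_sq_le_one _))
  simpa using this

lemma gmmse_le_one (γ : ℝ) : gmmse γ ≤ 1 := by
  rw [gmmse, sub_le_self_iff]
  exact integral_nonneg fun z => sq_nonneg _

lemma log_two_sub_le_gInfo {γ : ℝ} (hγ : 0 ≤ γ) :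
    Real.log 2 - 2 * Real.exp (-γ / 2) ≤ gInfo γ := by
  have hpt : ∀ h : ℝ, Real.log (Real.cosh h) ≤ h - Real.log 2 + 2 * Real.exp (-h) := by
    intro h
    have h1 : Real.cosh h ≤ Real.exp h / 2 * (1 + Real.exp (-h)) ^ 2 := by
      have e : Real.exp h * Real.exp (-h) = 1 := by rw [← Real.exp_add]; simp
      rw [Real.cosh_eq]
      have := Real.exp_pos (-h)
      nlinarith
    refine (Real.log_le_log (Real.cosh_pos _) h1).trans ?_
    have hp := Real.exp_pos (-h)
    rw [Real.log_mul (by positivity) (by positivity), Real.log_div (by positivity) (by positivity),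
      Real.log_exp, Real.log_pow]
    have := Real.log_le_sub_one_of_pos (show 0 < 1 + Real.exp (-h) by positivity)
    push_cast
    linarith
  have e : ∀ z, Real.exp (-(γ + √γ * z)) = Real.exp (-γ) * Real.exp (-√γ * z) := by
    intro z; rw [← Real.exp_add]; congr 1; ring
  have i1 : Integrable (fun z => Real.exp (-(γ + √γ * z))) stdGauss := by
    simp_rw [e]
    exact (integrable_exp_mul_stdGauss _).const_mul _
  have i3 : Integrable (fun z => γ + √γ * z) stdGauss :=
    (integrable_const γ).add (integrable_id_stdGauss.const_mul _)
  have i2 : Integrable (fun z => γ + √γ * z - Real.log 2) stdGauss :=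
    i3.sub (integrable_const _)
  have hig := integral_mono (integrable_log_cosh γ) (i2.add (i1.const_mul 2))
    (fun z => hpt (γ + √γ * z))
  simp only [Pi.add_apply] at hig
  rw [integral_add i2 (i1.const_mul 2), integral_sub i3 (integrable_const _), integral_add (integrable_const γ)
    (integrable_id_stdGauss.const_mul _), integral_const_mul, integral_const_mul,
    integral_id_stdGauss] at hig
  simp_rw [e] at hig
  rw [integral_const_mul, integral_exp_mul_stdGauss, neg_sq, Real.sq_sqrt hγ, ← Real.exp_add] at hig
  rw [show -γ + γ / 2 = -γ / 2 by ring] at hig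
  simp only [integral_const, probReal_univ, smul_eq_mul, one_mul, mul_zero, add_zero] at hig
  rw [gInfo]
  linarith

/-- Overlap `1 - mmse` of the scalar channel. -/
noncomputable def govl (γ : ℝ) : ℝ := 1 - gmmse γ

/-- Derivative of the overlap of the scalar channel. -/
noncomputable def govlDeriv (γ : ℝ) : ℝ :=
  Real.exp (-γ / 2) * ∫ z, (Real.cosh (√γ * z))⁻¹ ^ 3 ∂stdGauss

lemma continuous_govl : Continuous govl := continuous_const.sub continuous_gmmse

lemma govl_zero : govl 0 = 0 := by simp [govl, gmmse_zero]

lemma govl_nonneg (γ : ℝ) : 0 ≤ govl γ := sub_nonneg.2 (gmmse_le_one γ)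

lemma govl_le_one (γ : ℝ) : govl γ ≤ 1 := sub_le_self _ (gmmse_nonneg γ)

lemma hasDerivAt_govl {γ : ℝ} (hγ : 0 < γ) : HasDerivAt govl (govlDeriv γ) γ := by
  have hb : ∀ x, |(Real.cosh x)⁻¹| ≤ 1 := fun x => by
    rw [abs_of_pos (inv_cosh_pos x)]; exact inv_cosh_le_one x
  have hc : Continuous fun x => (Real.cosh x)⁻¹ - 2 * (Real.cosh x)⁻¹ ^ 3 :=
    continuous_inv_cosh.sub (continuous_const.mul (continuous_inv_cosh.pow 3))
  have h := hasDerivAt_integral_stdGauss hasDerivAt_inv_cosh hasDerivAt_inv_cosh_two hc (A := 3)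
    (fun x => by
      rw [abs_neg, abs_mul]
      have := mul_le_mul (abs_tanh_le_one x) (hb x) (abs_nonneg _) zero_le_one
      linarith)
    (fun x => by
      have h0 := inv_cosh_pos x
      have h1 := pow_le_one₀ (n := 3) h0.le (inv_cosh_le_one x)
      have h2 := pow_pos h0 3
      rw [abs_le]
      constructor <;> linarith [inv_cosh_le_one x]) 0
    (fun γ => by simpa using integrable_inv_cosh_pow (√γ) 1) hγ
  simp only [zero_mul, zero_add] at h
  have he : HasDerivAt (fun x : ℝ => Real.exp (-x / 2)) (Real.exp (-γ / 2) * (-1 / 2)) γ :=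
    (((hasDerivAt_id γ).neg.div_const 2).exp)
  have hm := (he.mul h).const_sub 1
  have heq : (fun x => 1 - ((fun x : ℝ => Real.exp (-x / 2)) * fun x =>
      ∫ z, (Real.cosh (√x * z))⁻¹ ∂stdGauss) x) =ᶠ[nhds γ] govl := by
    filter_upwards [Ioi_mem_nhds hγ] with x hx
    rw [govl, gmmse_eq (le_of_lt hx)]
    rfl
  refine (hm.congr_of_eventuallyEq heq.symm).congr_deriv ?_
  have i1 := integrable_inv_cosh_pow (√γ) 1
  simp only [pow_one] at i1
  have i3 := integrable_inv_cosh_pow (√γ) 3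
  rw [integral_div, integral_sub i1 (i3.const_mul 2), integral_const_mul, govlDeriv]
  ring

lemma integral_inv_cosh_anti {a b : ℝ} (hab : a ≤ b) :
    ∫ z, (Real.cosh (√b * z))⁻¹ ^ 3 ∂stdGauss ≤ ∫ z, (Real.cosh (√a * z))⁻¹ ^ 3 ∂stdGauss := by
  refine integral_mono (integrable_inv_cosh_pow _ _) (integrable_inv_cosh_pow _ _) fun z => ?_
  refine pow_le_pow_left₀ (inv_cosh_pos _).le (inv_anti₀ (Real.cosh_pos _) ?_) 3
  rw [Real.cosh_le_cosh, abs_mul, abs_mul, abs_of_nonneg (Real.sqrt_nonneg _),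
    abs_of_nonneg (Real.sqrt_nonneg _)]
  exact mul_le_mul_of_nonneg_right (Real.sqrt_le_sqrt hab) (abs_nonneg _)

lemma integral_inv_cosh_pos (a : ℝ) : 0 < ∫ z, (Real.cosh (√a * z))⁻¹ ^ 3 ∂stdGauss := by
  rw [integral_pos_iff_support_of_nonneg (fun z => pow_nonneg (inv_cosh_pos _).le 3)
    (integrable_inv_cosh_pow _ _)]
  have : Function.support (fun z => (Real.cosh (√a * z))⁻¹ ^ 3) = Set.univ := by
    ext z; simp [(Real.cosh_pos (√a * z)).ne']
  rw [this]; simp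

lemma govlDeriv_pos (γ : ℝ) : 0 < govlDeriv γ :=
  mul_pos (Real.exp_pos _) (integral_inv_cosh_pos γ)

lemma govlDeriv_strictAnti : StrictAnti govlDeriv := by
  intro a b hab
  unfold govlDeriv
  have h1 : Real.exp (-b / 2) < Real.exp (-a / 2) := Real.exp_lt_exp.2 (by linarith)
  have h2 := integral_inv_cosh_anti hab.le
  have := integral_inv_cosh_pos a
  have := Real.exp_pos (-b / 2)
  nlinarith

lemma govlDeriv_zero : govlDeriv 0 = 1 := by simp [govlDeriv]

lemma continuous_govlDeriv : Continuous govlDeriv := by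
  unfold govlDeriv
  refine (by fun_prop : Continuous fun x : ℝ => Real.exp (-x / 2)).mul ?_
  refine continuous_of_dominated (bound := fun _ => 1) ?_ ?_ ?_ ?_
  · intro x
    exact ((continuous_inv_cosh.comp (by fun_prop)).pow 3).aestronglyMeasurable
  · intro x
    refine ae_of_all _ fun z => ?_
    rw [Real.norm_eq_abs, abs_of_nonneg (pow_nonneg (inv_cosh_pos _).le _)]
    exact pow_le_one₀ (inv_cosh_pos _).le (inv_cosh_le_one _)
  · exact integrable_const _
  · exact ae_of_all _ fun z => (continuous_inv_cosh.comp (by fun_prop)).pow 3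

lemma strictConcaveOn_govl : StrictConcaveOn ℝ (Set.Ici 0) govl := by
  refine StrictAntiOn.strictConcaveOn_of_deriv (convex_Ici 0) continuous_govl.continuousOn ?_
  rw [interior_Ici]
  intro a ha b hb hab
  rw [(hasDerivAt_govl ha).deriv, (hasDerivAt_govl hb).deriv]
  exact govlDeriv_strictAnti hab

lemma strictMonoOn_govl : StrictMonoOn govl (Set.Ici 0) := by
  refine strictMonoOn_of_deriv_pos (convex_Ici 0) continuous_govl.continuousOn ?_
  rw [interior_Ici]
  intro a ha
  rw [(hasDerivAt_govl ha).deriv]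
  exact govlDeriv_pos a

lemma exists_govl_eq {γ : ℝ} (hγ : 0 < γ) : ∃ c ∈ Set.Ioo 0 γ, govl γ = govlDeriv c * γ := by
  obtain ⟨c, hc, h⟩ := exists_hasDerivAt_eq_slope govl govlDeriv hγ continuous_govl.continuousOn
    (fun x hx => hasDerivAt_govl hx.1)
  refine ⟨c, hc, ?_⟩
  rw [h, govl_zero, sub_zero, sub_zero, div_mul_cancel₀ _ hγ.ne']

lemma govl_lt_self {γ : ℝ} (hγ : 0 < γ) : govl γ < γ := by
  obtain ⟨c, hc, h⟩ := exists_govl_eq hγ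
  have := govlDeriv_strictAnti hc.1
  rw [govlDeriv_zero] at this
  rw [h]
  nlinarith

/-- The overlap divided by the signal-to-noise ratio is decreasing. -/
lemma mul_govl_lt {a b : ℝ} (ha : 0 < a) (hab : a < b) : a * govl b < b * govl a := by
  have hb : 0 < b := ha.trans hab
  have hu : 0 < 1 - a / b := by rw [sub_pos, div_lt_one hb]; exact hab
  have h := strictConcaveOn_govl.2 (Set.mem_Ici.2 le_rfl) (Set.mem_Ici.2 hb.le) hb.ne hu
    (div_pos ha hb) (by ring)
  simp only [smul_eq_mul, mul_zero, govl_zero, zero_add] at h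
  rw [div_mul_cancel₀ _ hb.ne', div_mul_eq_mul_div, div_lt_iff₀ hb] at h
  linarith

/-- The largest solution of `γ = θ (1 - mmse γ)`. -/
noncomputable def gfix (θ : ℝ) : ℝ := sSup {γ | 0 ≤ γ ∧ γ ≤ θ * govl γ}

lemma bddAbove_gfix {θ : ℝ} (hθ : 0 ≤ θ) : BddAbove {γ | 0 ≤ γ ∧ γ ≤ θ * govl γ} :=
  ⟨θ, fun γ h => h.2.trans (mul_le_of_le_one_right hθ (govl_le_one γ))⟩

lemma le_gfix {θ γ : ℝ} (hθ : 0 ≤ θ) (h0 : 0 ≤ γ) (h : γ ≤ θ * govl γ) : γ ≤ gfix θ :=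
  le_csSup (bddAbove_gfix hθ) ⟨h0, h⟩

lemma gfix_nonneg {θ : ℝ} (hθ : 0 ≤ θ) : 0 ≤ gfix θ :=
  le_gfix hθ le_rfl (by simp [govl_zero])

lemma lt_of_gfix_lt {θ γ : ℝ} (hθ : 0 ≤ θ) (h : gfix θ < γ) : θ * govl γ < γ := by
  by_contra hc
  exact absurd (le_gfix hθ ((gfix_nonneg hθ).trans h.le) (not_lt.1 hc)) (not_le.2 h)

lemma gfix_eq {θ : ℝ} (hθ : 0 ≤ θ) : gfix θ = θ * govl (gfix θ) := by
  have hcl : IsClosed {γ | 0 ≤ γ ∧ γ ≤ θ * govl γ} :=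
    (isClosed_le continuous_const continuous_id).inter
      (isClosed_le continuous_id (continuous_const.mul continuous_govl))
  have hmem := hcl.csSup_mem ⟨0, le_rfl, by simp [govl_zero]⟩ (bddAbove_gfix hθ)
  refine le_antisymm hmem.2 ?_
  refine le_gfix hθ (hmem.1.trans hmem.2) ?_
  refine mul_le_mul_of_nonneg_left ?_ hθ
  exact strictMonoOn_govl.monotoneOn hmem.1 (hmem.1.trans hmem.2) hmem.2

lemma gfix_le {θ : ℝ} (hθ : 0 ≤ θ) : gfix θ ≤ θ := by
  rw [gfix_eq hθ]; exact mul_le_of_le_one_right hθ (govl_le_one _)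

lemma lt_of_lt_gfix {θ γ : ℝ} (hθ : 0 ≤ θ) (h0 : 0 < γ) (h : γ < gfix θ) : γ < θ * govl γ := by
  have h1 := mul_govl_lt h0 h
  have h2 := gfix_eq hθ
  have hg := h0.trans h
  have : γ * gfix θ < θ * govl γ * gfix θ := by
    calc γ * gfix θ = θ * (γ * govl (gfix θ)) := by conv_lhs => rw [h2]
                                                    ring
      _ < θ * (gfix θ * govl γ) := by
        refine mul_lt_mul_of_pos_left h1 ?_
        exact hg.trans_le (gfix_le hθ)
      _ = _ := by ring
  exact lt_of_mul_lt_mul_right this hg.le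

lemma gfix_mono {a b : ℝ} (ha : 0 ≤ a) (hab : a ≤ b) : gfix a ≤ gfix b := by
  refine le_gfix (ha.trans hab) (gfix_nonneg ha) ?_
  conv_lhs => rw [gfix_eq ha]
  exact mul_le_mul_of_nonneg_right hab (govl_nonneg _)

lemma eq_gfix {θ γ : ℝ} (hθ : 0 ≤ θ) (h0 : 0 ≤ γ) (h : γ = θ * govl γ)
    (hl : ∀ x, 0 ≤ x → x = θ * govl x → x ≤ γ) : γ = gfix θ :=
  le_antisymm (le_gfix hθ h0 h.le) (hl _ (gfix_nonneg hθ) (gfix_eq hθ))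

lemma gfix_eq_zero {θ : ℝ} (hθ : 0 ≤ θ) (h1 : θ ≤ 1) : gfix θ = 0 := by
  by_contra hc
  have hp : 0 < gfix θ := lt_of_le_of_ne (gfix_nonneg hθ) (Ne.symm hc)
  have h2 := gfix_eq hθ
  have h3 := govl_lt_self hp
  have := mul_le_of_le_one_left (govl_nonneg (gfix θ)) h1
  linarith

lemma gfix_pos {θ : ℝ} (h1 : 1 < θ) : 0 < gfix θ := by
  have hev : ∀ᶠ x in nhds (0 : ℝ), 1 / θ < govlDeriv x := by
    refine continuous_govlDeriv.continuousAt.eventually_const_lt ?_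
    rw [govlDeriv_zero, div_lt_one (by linarith)]; exact h1
  obtain ⟨γ, hγ, hγ0⟩ := ((hev.filter_mono nhdsWithin_le_nhds).and
    (self_mem_nhdsWithin : ∀ᶠ x in nhdsWithin (0 : ℝ) (Set.Ioi 0), x ∈ Set.Ioi (0 : ℝ))).exists
  have hγ0 : 0 < γ := hγ0
  obtain ⟨c, hc, h⟩ := exists_govl_eq hγ0
  have h2 := govlDeriv_strictAnti hc.2
  have h3 : 1 / θ < govlDeriv c := hγ.trans h2
  rw [div_lt_iff₀ (by linarith)] at h3
  refine hγ0.trans_le (le_gfix (by linarith) hγ0.le ?_)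
  rw [h]
  nlinarith

lemma tendsto_gfix_atTop : Tendsto gfix atTop atTop := by
  refine tendsto_atTop.2 fun M => ?_
  set M' := max M 1
  have hM' : 0 < M' := lt_of_lt_of_le one_pos (le_max_right _ _)
  have hp : 0 < govl M' := by
    have := strictMonoOn_govl (Set.mem_Ici.2 le_rfl) (Set.mem_Ici.2 hM'.le) hM'
    rwa [govl_zero] at this
  filter_upwards [eventually_ge_atTop (M' / govl M'), eventually_ge_atTop 0] with θ h1 h0
  refine (le_max_left M 1).trans (le_gfix h0 hM'.le ?_)
  rwa [div_le_iff₀ hp] at h1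

/-- Left-continuity of the largest fixed point. -/
lemma exists_gfix_gt {θ ε : ℝ} (hθ : 0 < θ) (hε : 0 < ε) :
    ∃ a, 0 < a ∧ a < θ ∧ gfix θ - ε < gfix a := by
  rcases (gfix_nonneg hθ.le).eq_or_lt with h | h
  · exact ⟨θ / 2, by linarith, by linarith, by
      have := gfix_nonneg (half_pos hθ).le; linarith⟩
  set γ := max (gfix θ - ε / 2) (gfix θ / 2)
  have h0 : 0 < γ := lt_of_lt_of_le (half_pos h) (le_max_right _ _)
  have hγ : γ < gfix θ := max_lt (by linarith) (by linarith)
  have h1 := lt_of_lt_gfix hθ.le h0 hγ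
  have hg : 0 < govl γ := by
    have := strictMonoOn_govl (Set.mem_Ici.2 le_rfl) (Set.mem_Ici.2 h0.le) h0
    rwa [govl_zero] at this
  have h2 : γ / govl γ < θ := by rwa [div_lt_iff₀ hg]
  refine ⟨γ / govl γ, div_pos h0 hg, h2, ?_⟩
  have h3 : γ ≤ gfix (γ / govl γ) := le_gfix (div_pos h0 hg).le h0.le (by
    rw [div_mul_cancel₀ _ hg.ne'])
  have h4 : gfix θ - ε / 2 ≤ γ := le_max_left _ _
  linarith

/-- The concave potential whose maximum is the limiting relative entropy. -/
noncomputable def gpot (θ γ : ℝ) : ℝ := -(γ ^ 2 / (4 * θ)) + γ / 2 - gInfo γ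

lemma gpot_eq (θ γ : ℝ) : gpot θ γ = θ / 4 - Psi γ θ := by
  rw [gpot, Psi]; ring

lemma hasDerivAt_gpot {θ γ : ℝ} (hγ : 0 < γ) :
    HasDerivAt (gpot θ) ((govl γ - γ / θ) / 2) γ := by
  have h := ((((hasDerivAt_id γ).pow 2).div_const (4 * θ)).neg.add
    ((hasDerivAt_id γ).div_const 2)).sub (hasDerivAt_gInfo hγ)
  refine h.congr_deriv ?_
  simp [govl]
  ring

lemma continuous_gpot (θ : ℝ) : Continuous (gpot θ) := by
  unfold gpot
  have := continuous_gInfo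
  fun_prop

lemma gpot_le {θ γ : ℝ} (hθ : 0 < θ) (hγ : 0 ≤ γ) : gpot θ γ ≤ gpot θ (gfix θ) := by
  rcases le_total γ (gfix θ) with h | h
  · refine (monotoneOn_of_deriv_nonneg (convex_Icc 0 (gfix θ)) (continuous_gpot θ).continuousOn ?_ ?_)
      ⟨hγ, h⟩ ⟨gfix_nonneg hθ.le, le_rfl⟩ h
    · rw [interior_Icc]
      exact fun x hx => (hasDerivAt_gpot hx.1).differentiableAt.differentiableWithinAt
    · rw [interior_Icc]
      intro x hx
      rw [(hasDerivAt_gpot hx.1).deriv]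
      have := lt_of_lt_gfix hθ.le hx.1 hx.2
      have : x / θ ≤ govl x := by rw [div_le_iff₀ hθ]; linarith
      linarith
  · refine (antitoneOn_of_deriv_nonpos (convex_Ici (gfix θ)) (continuous_gpot θ).continuousOn ?_ ?_)
      (Set.mem_Ici.2 le_rfl) (Set.mem_Ici.2 h) h
    · rw [interior_Ici]
      exact fun x hx => (hasDerivAt_gpot
        ((gfix_nonneg hθ.le).trans_lt hx)).differentiableAt.differentiableWithinAt
    · rw [interior_Ici]
      intro x hx
      rw [(hasDerivAt_gpot ((gfix_nonneg hθ.le).trans_lt hx)).deriv]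
      have := lt_of_gfix_lt hθ.le hx
      have : govl x ≤ x / θ := by rw [le_div_iff₀ hθ]; linarith
      linarith

/-- Limiting relative entropy per vertex. -/
noncomputable def gent (θ : ℝ) : ℝ := gpot θ (gfix θ)

lemma gent_nonneg {θ : ℝ} (hθ : 0 < θ) : 0 ≤ gent θ := by
  have := gpot_le hθ le_rfl
  rwa [gpot, gInfo_zero, zero_pow two_ne_zero, zero_div, zero_div, neg_zero, add_zero, sub_zero] at this

lemma gent_sub_ge {a b : ℝ} (ha : 0 < a) (hb : 0 < b) :
    gfix a ^ 2 / 4 * (1 / a - 1 / b) ≤ gent b - gent a := by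
  have h := gpot_le hb (gfix_nonneg ha.le)
  have : gpot b (gfix a) - gpot a (gfix a) = gfix a ^ 2 / 4 * (1 / a - 1 / b) := by
    rw [gpot, gpot]; field_simp; ring
  rw [gent, gent]
  linarith

lemma gent_le {θ : ℝ} (hθ : 0 < θ) :
    gent θ ≤ θ / 4 - Real.log 2 + 2 * Real.exp (-gfix θ / 2) := by
  have h := log_two_sub_le_gInfo (gfix_nonneg hθ.le)
  rw [gent, gpot]
  have : gfix θ / 2 - gfix θ ^ 2 / (4 * θ) ≤ θ / 4 := by
    rw [← sub_nonneg]
    have e : θ / 4 - (gfix θ / 2 - gfix θ ^ 2 / (4 * θ)) = (θ - gfix θ) ^ 2 / (4 * θ) := by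
      field_simp; ring
    rw [e]; positivity
  linarith

/-- Expectation of `F` under the product of copies of the weight `w` on `Bool`. -/
noncomputable def pE {ι : Type*} [Fintype ι] [DecidableEq ι] (w : Bool → ℝ)
    (F : (ι → Bool) → ℝ) : ℝ :=
  ∑ g : ι → Bool, (∏ i, w (g i)) * F g

/-- A centered two-point channel with weights `w`, values `b`, variance `κ` and bound `ε`. -/
structure Chan (w b : Bool → ℝ) (κ ε : ℝ) : Prop where
  nonneg : ∀ c, 0 ≤ w c
  sum_one : ∑ c, w c = 1
  mean : ∑ c, w c * b c = 0
  var : ∑ c, w c * b c ^ 2 = κ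
  bound : ∀ c, |b c| ≤ ε
  le_half : ε ≤ 1 / 2

/-- The fair coin. -/
noncomputable def half : Bool → ℝ := fun _ => 1 / 2

lemma half_nonneg (c : Bool) : 0 ≤ half c := by unfold half; norm_num

lemma half_sum : ∑ c, half c = 1 := by simp [half]

section Expectation

variable {ι κ : Type*} [Fintype ι] [DecidableEq ι] [Fintype κ] [DecidableEq κ] {w : Bool → ℝ}

lemma pE_prod (w : Bool → ℝ) (f : ι → Bool → ℝ) :
    pE w (fun g => ∏ i, f i (g i)) = ∏ i, ∑ c, w c * f i c := by
  rw [Finset.prod_univ_sum, pE, Fintype.piFinset_univ]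
  exact Finset.sum_congr rfl fun g _ => Finset.prod_mul_distrib.symm

lemma pE_const (hw : ∑ c, w c = 1) (a : ℝ) : pE w (fun _ : ι → Bool => a) = a := by
  have h := pE_prod (ι := ι) w (fun _ _ => 1)
  simp only [mul_one, hw, Finset.prod_const_one] at h
  have h2 : pE w (fun _ : ι → Bool => a) = pE w (fun _ : ι → Bool => 1) * a := by
    rw [pE, pE, Finset.sum_mul]; simp
  rw [h2, h, one_mul]

lemma pE_add (F G : (ι → Bool) → ℝ) : pE w (fun g => F g + G g) = pE w F + pE w G := by
  simp only [pE, mul_add, Finset.sum_add_distrib]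

lemma pE_sub (F G : (ι → Bool) → ℝ) : pE w (fun g => F g - G g) = pE w F - pE w G := by
  simp only [pE, mul_sub, Finset.sum_sub_distrib]

lemma pE_neg (F : (ι → Bool) → ℝ) : pE w (fun g => -F g) = -pE w F := by
  simp only [pE, mul_neg, Finset.sum_neg_distrib]

lemma pE_const_mul (a : ℝ) (F : (ι → Bool) → ℝ) : pE w (fun g => a * F g) = a * pE w F := by
  rw [pE, pE, Finset.mul_sum]
  exact Finset.sum_congr rfl fun g _ => by ring

lemma pE_mul_const (a : ℝ) (F : (ι → Bool) → ℝ) : pE w (fun g => F g * a) = pE w F * a := by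
  rw [pE, pE, Finset.sum_mul]
  exact Finset.sum_congr rfl fun g _ => by ring

lemma pE_div_const (a : ℝ) (F : (ι → Bool) → ℝ) : pE w (fun g => F g / a) = pE w F / a := by
  simp only [div_eq_mul_inv, pE_mul_const]

lemma pE_sum {α : Type*} (s : Finset α) (F : α → (ι → Bool) → ℝ) :
    pE w (fun g => ∑ a ∈ s, F a g) = ∑ a ∈ s, pE w (F a) := by
  simp only [pE, Finset.mul_sum]
  exact Finset.sum_comm

lemma pE_mono (hw : ∀ c, 0 ≤ w c) {F G : (ι → Bool) → ℝ} (h : ∀ g, F g ≤ G g) : pE w F ≤ pE w G :=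
  Finset.sum_le_sum fun g _ => mul_le_mul_of_nonneg_left (h g) (Finset.prod_nonneg fun _ _ => hw _)

lemma pE_nonneg (hw : ∀ c, 0 ≤ w c) {F : (ι → Bool) → ℝ} (h : ∀ g, 0 ≤ F g) : 0 ≤ pE w F :=
  Finset.sum_nonneg fun g _ => mul_nonneg (Finset.prod_nonneg fun _ _ => hw _) (h g)

lemma pE_pos (hw : ∀ c, 0 ≤ w c) (h1 : ∑ c, w c = 1) {F : (ι → Bool) → ℝ} (h : ∀ g, 0 < F g) :
    0 < pE w F := by
  obtain ⟨g0, hg0⟩ := Finite.exists_min F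
  calc 0 < F g0 := h g0
    _ = pE w (fun _ : ι → Bool => F g0) := (pE_const h1 _).symm
    _ ≤ pE w F := pE_mono hw hg0

lemma pE_comm {w' : Bool → ℝ} (F : (ι → Bool) → (κ → Bool) → ℝ) :
    pE w (fun x => pE w' (fun y => F x y)) = pE w' (fun y => pE w (fun x => F x y)) := by
  simp only [pE, Finset.mul_sum]
  rw [Finset.sum_comm]
  exact Finset.sum_congr rfl fun _ _ => Finset.sum_congr rfl fun _ _ => by ring

lemma pE_equiv (e : ι ≃ κ) (F : (κ → Bool) → ℝ) :
    pE w (fun g : ι → Bool => F (g ∘ e.symm)) = pE w F := by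
  rw [pE, pE]
  refine Fintype.sum_equiv (e.arrowCongr (Equiv.refl Bool)) _ _ fun g => ?_
  congr 1
  refine Fintype.prod_equiv e _ _ fun i => ?_
  simp

lemma pE_sumElim (F : (ι ⊕ κ → Bool) → ℝ) :
    pE w F = pE w (fun g : ι → Bool => pE w (fun h : κ → Bool => F (Sum.elim g h))) := by
  simp only [pE, Finset.mul_sum]
  rw [← Fintype.sum_prod_type', Fintype.sum_equiv (Equiv.sumArrowEquivProdArrow ι κ Bool)]
  intro g
  have hg : Sum.elim (fun i => g (Sum.inl i)) (fun i => g (Sum.inr i)) = g := by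
    ext i; cases i <;> rfl
  simp only [Equiv.sumArrowEquivProdArrow, Equiv.coe_fn_mk, Function.comp_def, hg,
    Fintype.prod_sum_type]
  ring

lemma pE_sq_le (hw : ∀ c, 0 ≤ w c) (h1 : ∑ c, w c = 1) (F : (ι → Bool) → ℝ) :
    pE w F ^ 2 ≤ pE w (fun g => F g ^ 2) := by
  have h := pE_nonneg (w := w) hw (fun g => sq_nonneg (F g - pE w F))
  have e : ∀ g, (F g - pE w F) ^ 2 = F g ^ 2 - 2 * pE w F * F g + pE w F ^ 2 := fun g => by ring
  simp only [e, pE_add, pE_sub, pE_const_mul, pE_const h1] at h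
  nlinarith

end Expectation

lemma pE_fin_zero (w : Bool → ℝ) (F : (Fin 0 → Bool) → ℝ) : pE w F = F Fin.elim0 := by
  rw [pE, Fintype.sum_unique]
  simp only [Finset.univ_eq_empty, Finset.prod_empty, one_mul]
  exact congrArg F (Subsingleton.elim _ _)

lemma pE_fin_succ {m : ℕ} (w : Bool → ℝ) (F : (Fin (m + 1) → Bool) → ℝ) :
    pE w F = ∑ c, w c * pE w (fun g : Fin m → Bool => F (Fin.cons c g)) := by
  simp only [pE, Finset.mul_sum]
  rw [← Fintype.sum_prod_type', ← Fintype.sum_equiv (Fin.consEquiv fun _ => Bool)]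
  intro g
  simp only [Fin.consEquiv, Equiv.coe_fn_mk, Fin.prod_univ_succ, Fin.cons_zero, Fin.cons_succ]
  ring

namespace Chan

variable {w b : Bool → ℝ} {κ ε : ℝ}

lemma eps_nonneg (h : Chan w b κ ε) : 0 ≤ ε := (abs_nonneg _).trans (h.bound true)

lemma var_nonneg (h : Chan w b κ ε) : 0 ≤ κ := by
  rw [← h.var]; exact Finset.sum_nonneg fun c _ => mul_nonneg (h.nonneg c) (sq_nonneg _)

lemma var_le (h : Chan w b κ ε) : κ ≤ ε ^ 2 := by
  rw [← h.var, ← one_mul (ε ^ 2), ← h.sum_one, Finset.sum_mul]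
  refine Finset.sum_le_sum fun c _ => mul_le_mul_of_nonneg_left ?_ (h.nonneg c)
  exact sq_le_sq' (neg_le_of_abs_le (h.bound c)) (le_of_abs_le (h.bound c))

lemma scale (h : Chan w b κ ε) {M : ℝ} (hM : |M| ≤ 1) : Chan w (fun c => M * b c) (M ^ 2 * κ) ε where
  nonneg := h.nonneg
  sum_one := h.sum_one
  mean := by
    have := h.mean
    rw [← mul_zero M, ← this, Finset.mul_sum]
    exact Finset.sum_congr rfl fun c _ => by ring
  var := by
    rw [← h.var, Finset.mul_sum]
    exact Finset.sum_congr rfl fun c _ => by ring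
  bound c := by
    rw [abs_mul]
    exact (mul_le_of_le_one_left (abs_nonneg _) hM).trans (h.bound c)
  le_half := h.le_half

end Chan

lemma abs_inv_cosh_pow_sub_le (x y : ℝ) :
    |(Real.cosh x)⁻¹ ^ 3 - (Real.cosh y)⁻¹ ^ 3| ≤ 3 * |x - y| := by
  have h : ∀ x, HasDerivAt (fun x => (Real.cosh x)⁻¹ ^ 3)
      (3 * (Real.cosh x)⁻¹ ^ 2 * (-(Real.tanh x * (Real.cosh x)⁻¹))) x := fun x => by
    exact ((hasDerivAt_inv_cosh x).pow 3).congr_deriv (by simp)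
  have hb := Convex.norm_image_sub_le_of_norm_hasDerivWithin_le (C := 3) (s := Set.univ)
    (fun x _ => (h x).hasDerivWithinAt) (fun x _ => by
      rw [Real.norm_eq_abs, abs_mul, abs_neg, abs_mul (Real.tanh x), abs_of_pos (inv_cosh_pos x),
        abs_of_nonneg (show 0 ≤ 3 * (Real.cosh x)⁻¹ ^ 2 by have := inv_cosh_pos x; positivity)]
      have h0 := inv_cosh_pos x
      have h1 := inv_cosh_le_one x
      have h2 := abs_tanh_le_one x
      have h3 : (Real.cosh x)⁻¹ ^ 2 ≤ 1 := pow_le_one₀ h0.le h1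
      have h4 : |Real.tanh x| * (Real.cosh x)⁻¹ ≤ 1 := mul_le_one₀ h2 h0.le h1
      have h5 : 0 ≤ |Real.tanh x| * (Real.cosh x)⁻¹ := by positivity
      calc 3 * (Real.cosh x)⁻¹ ^ 2 * (|Real.tanh x| * (Real.cosh x)⁻¹) ≤ 3 * 1 * 1 := by
            gcongr
        _ = 3 := by norm_num) convex_univ (Set.mem_univ y) (Set.mem_univ x)
  simpa using hb

lemma integral_abs_stdGauss_le : ∫ z, |z| ∂stdGauss ≤ 1 := by
  have i := integrable_abs_pow_stdGauss 1
  simp only [pow_one] at i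
  have := integral_mono i ((integrable_const (1 : ℝ)).add integrable_sq_stdGauss |>.div_const 2)
    (fun z => by
      simp only [Pi.add_apply]
      nlinarith [sq_nonneg (|z| - 1), sq_abs z])
  refine this.trans ?_
  rw [integral_div]
  simp only [Pi.add_apply]
  rw [integral_add (integrable_const _) integrable_sq_stdGauss, integral_sq_stdGauss]
  simp

/-- Second-order expansion of the Gaussian step. -/
lemma abs_gauss_step (a : ℝ) {δ : ℝ} (hδ : 0 ≤ δ) :
    |Real.exp (-δ / 2) * ∫ z, (Real.cosh (a + √δ * z))⁻¹ ∂stdGauss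
      - (Real.cosh a)⁻¹ * (1 - (Real.cosh a)⁻¹ ^ 2 * δ)| ≤ (δ / 2 + 3 * √δ) * δ := by
  have hb : ∀ x, |(Real.cosh x)⁻¹| ≤ 1 := fun x => by
    rw [abs_of_pos (inv_cosh_pos x)]; exact inv_cosh_le_one x
  have ik : ∀ x : ℝ, ∀ k : ℕ, Integrable (fun z => (Real.cosh (a + √x * z))⁻¹ ^ k) stdGauss := by
    intro x k
    refine integrable_of_bounded_stdGauss (A := 1) ((continuous_inv_cosh.comp (by fun_prop)).pow k)
      fun z => ?_
    rw [abs_pow]; exact pow_le_one₀ (abs_nonneg _) (hb _)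
  set g := fun x => Real.exp (-x / 2) * ∫ z, (Real.cosh (a + √x * z))⁻¹ ∂stdGauss with hg
  have hgc : Continuous g := by
    refine (by fun_prop : Continuous fun x : ℝ => Real.exp (-x / 2)).mul ?_
    refine continuous_of_dominated (bound := fun _ => 1) ?_ ?_ ?_ ?_
    · intro x; exact (continuous_inv_cosh.comp (by fun_prop)).aestronglyMeasurable
    · intro x; exact ae_of_all _ fun z => hb _
    · exact integrable_const _
    · exact ae_of_all _ fun z => continuous_inv_cosh.comp (by fun_prop)
  have hd : ∀ x, 0 < x → HasDerivAt g
      (-(Real.exp (-x / 2) * ∫ z, (Real.cosh (a + √x * z))⁻¹ ^ 3 ∂stdGauss)) x := by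
    intro x hx
    have hc : Continuous fun x => (Real.cosh (a + x))⁻¹ - 2 * (Real.cosh (a + x))⁻¹ ^ 3 :=
      ((continuous_inv_cosh.sub (continuous_const.mul (continuous_inv_cosh.pow 3))).comp
        (by fun_prop : Continuous fun x => a + x))
    have h := hasDerivAt_integral_stdGauss (φ := fun x => (Real.cosh (a + x))⁻¹)
      (φ1 := fun x => -(Real.tanh (a + x) * (Real.cosh (a + x))⁻¹))
      (fun x => (hasDerivAt_inv_cosh (a + x)).comp_const_add a x)
      (fun x => (hasDerivAt_inv_cosh_two (a + x)).comp_const_add a x) hc (A := 3)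
      (fun x => by
        rw [abs_neg, abs_mul]
        have := mul_le_mul (abs_tanh_le_one (a + x)) (hb (a + x)) (abs_nonneg _) zero_le_one
        linarith)
      (fun x => by
        have h0 := inv_cosh_pos (a + x)
        have h1 := pow_le_one₀ (n := 3) h0.le (inv_cosh_le_one (a + x))
        have h2 := pow_pos h0 3
        rw [abs_le]
        constructor <;> linarith [inv_cosh_le_one (a + x)]) 0
      (fun γ => by simpa using ik γ 1) hx
    simp only [zero_mul, zero_add] at h
    have he : HasDerivAt (fun x : ℝ => Real.exp (-x / 2)) (Real.exp (-x / 2) * (-1 / 2)) x :=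
      (((hasDerivAt_id x).neg.div_const 2).exp)
    refine (he.mul h).congr_deriv ?_
    have i1 := ik x 1
    simp only [pow_one] at i1
    rw [integral_div, integral_sub i1 ((ik x 3).const_mul 2), integral_const_mul]
    ring
  rcases hδ.eq_or_lt with rfl | hδ
  · simp
  obtain ⟨c, hc, h⟩ := exists_hasDerivAt_eq_slope g _ hδ hgc.continuousOn (fun x hx => hd x hx.1)
  have hg0 : g 0 = (Real.cosh a)⁻¹ := by simp [hg]
  rw [hg0, sub_zero, eq_div_iff hδ.ne'] at h
  have e : g δ - (Real.cosh a)⁻¹ * (1 - (Real.cosh a)⁻¹ ^ 2 * δ) =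
      ((1 - Real.exp (-c / 2)) * (∫ z, (Real.cosh (a + √c * z))⁻¹ ^ 3 ∂stdGauss) -
        ∫ z, ((Real.cosh (a + √c * z))⁻¹ ^ 3 - (Real.cosh a)⁻¹ ^ 3) ∂stdGauss) * δ := by
    rw [integral_sub (ik c 3) (integrable_const _)]
    simp only [integral_const, probReal_univ, smul_eq_mul, one_mul]
    linear_combination -h
  rw [e, abs_mul, abs_of_pos hδ]
  refine mul_le_mul_of_nonneg_right ((abs_sub _ _).trans (add_le_add ?_ ?_)) hδ.le
  · have h1 := Real.add_one_le_exp (-c / 2)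
    have h2 : Real.exp (-c / 2) ≤ 1 := Real.exp_le_one_iff.2 (by linarith [hc.1])
    have h3 : 0 ≤ ∫ z, (Real.cosh (a + √c * z))⁻¹ ^ 3 ∂stdGauss :=
      integral_nonneg fun z => pow_nonneg (inv_cosh_pos _).le 3
    have h4 : ∫ z, (Real.cosh (a + √c * z))⁻¹ ^ 3 ∂stdGauss ≤ 1 := by
      have := integral_mono (ik c 3) (integrable_const (1 : ℝ))
        (fun z => pow_le_one₀ (inv_cosh_pos _).le (inv_cosh_le_one _))
      simpa using this
    rw [abs_of_nonneg (mul_nonneg (by linarith) h3)]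
    have := hc.2
    nlinarith
  · rw [← Real.norm_eq_abs]
    refine (norm_integral_le_integral_norm _).trans ?_
    have i := integrable_abs_pow_stdGauss 1
    simp only [pow_one] at i
    have hm := integral_mono (((ik c 3).sub (integrable_const ((Real.cosh a)⁻¹ ^ 3))).norm)
      (i.const_mul (3 * √c)) (fun z => by
        have := abs_inv_cosh_pow_sub_le (a + √c * z) a
        rw [add_sub_cancel_left, abs_mul, abs_of_nonneg (Real.sqrt_nonneg c)] at this
        simp only [Pi.sub_apply, Real.norm_eq_abs]
        linarith)
    refine hm.trans ?_
    rw [integral_const_mul]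
    have h1 := integral_abs_stdGauss_le
    have h2 := Real.sqrt_le_sqrt hc.2.le
    have h3 := Real.sqrt_nonneg c
    nlinarith

/-- One step of the exchange argument, in normalized coordinates. -/
lemma abs_lindeberg_step {w y : Bool → ℝ} {δ ε : ℝ} (h : Chan w y δ ε) (a : ℝ) :
    |∑ c, w c * ((1 - y c ^ 2) / (Real.cosh a + y c * Real.sinh a)) -
      Real.exp (-δ / 2) * ∫ z, (Real.cosh (a + √δ * z))⁻¹ ∂stdGauss| ≤ 6 * ε * δ := by
  have hδ := h.var_nonneg
  have hε := h.eps_nonneg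
  have hsq : √δ ≤ ε := by
    rw [Real.sqrt_le_left hε]; exact h.var_le
  have h1 := abs_gauss_step a hδ
  have h2 : |∑ c, w c * ((1 - y c ^ 2) / (Real.cosh a + y c * Real.sinh a)) -
      (Real.cosh a)⁻¹ * (1 - (Real.cosh a)⁻¹ ^ 2 * δ)| ≤ 2 * ε * δ := by
    set s := (Real.cosh a)⁻¹ with hs
    set t := Real.tanh a with ht
    have hts : t ^ 2 = 1 - s ^ 2 := tanh_sq_eq a
    have hsp : 0 < s := inv_cosh_pos a
    have hs1 : s ≤ 1 := inv_cosh_le_one a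
    have ht1 : |t| ≤ 1 := abs_tanh_le_one a
    have hty : ∀ c, 1 / 2 ≤ 1 + t * y c := fun c => by
      have : |t * y c| ≤ 1 / 2 := by
        rw [abs_mul]
        exact (mul_le_of_le_one_left (abs_nonneg _) ht1).trans ((h.bound c).trans h.le_half)
      linarith [(abs_le.1 this).1]
    have e : ∑ c, w c * ((1 - y c ^ 2) / (Real.cosh a + y c * Real.sinh a)) -
        s * (1 - s ^ 2 * δ) = ∑ c, w c * (s * (t * s ^ 2) * y c ^ 3 / (1 + t * y c)) := by
      have e1 : s * (1 - s ^ 2 * δ) =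
          ∑ c, w c * (s * (1 - t * y c - s ^ 2 * y c ^ 2)) := by
        have : ∀ c, w c * (s * (1 - t * y c - s ^ 2 * y c ^ 2)) =
          s * w c - s * t * (w c * y c) - s ^ 3 * (w c * y c ^ 2) := fun c => by ring
        simp only [this, Finset.sum_sub_distrib, ← Finset.mul_sum, h.sum_one, h.mean, h.var]
        ring
      rw [e1, ← Finset.sum_sub_distrib]
      refine Finset.sum_congr rfl fun c _ => ?_
      rw [← mul_sub]
      congr 1
      have hca : Real.cosh a ≠ 0 := (Real.cosh_pos a).ne'
      have e2 : Real.cosh a + y c * Real.sinh a = (1 + t * y c) / s := by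
        rw [ht, hs, Real.tanh_eq_sinh_div_cosh]; field_simp
      have := (lt_of_lt_of_le (by norm_num : (0:ℝ) < 1 / 2) (hty c)).ne'
      rw [e2]
      clear_value s t
      obtain ⟨D, hD⟩ : ∃ D, D = 1 + t * y c := ⟨_, rfl⟩
      rw [← hD] at this ⊢
      field_simp
      rw [hD]
      linear_combination (y c ^ 2) * hts
    rw [e]
    refine (Finset.abs_sum_le_sum_abs _ _).trans ?_
    rw [← h.var, Finset.mul_sum]
    refine Finset.sum_le_sum fun c _ => ?_
    rw [abs_mul, abs_of_nonneg (h.nonneg c),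
      show 2 * ε * (w c * y c ^ 2) = w c * (2 * ε * y c ^ 2) by ring]
    refine mul_le_mul_of_nonneg_left ?_ (h.nonneg c)
    rw [abs_div, abs_of_pos (lt_of_lt_of_le (by norm_num) (hty c)),
      div_le_iff₀ (lt_of_lt_of_le (by norm_num) (hty c)), abs_mul, abs_pow, pow_succ |y c|, sq_abs]
    have h3 : |s * (t * s ^ 2)| ≤ 1 := by
      rw [abs_mul, abs_mul, abs_of_pos hsp, abs_of_pos (pow_pos hsp 2)]
      exact mul_le_one₀ hs1 (by positivity)
        (mul_le_one₀ ht1 (by positivity) (pow_le_one₀ hsp.le hs1))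
    have h4 := h.bound c
    have h5 := hty c
    calc |s * (t * s ^ 2)| * (y c ^ 2 * |y c|) ≤ 1 * (y c ^ 2 * ε) := by gcongr
      _ = 2 * ε * y c ^ 2 * (1 / 2) := by ring
      _ ≤ 2 * ε * y c ^ 2 * (1 + t * y c) := by gcongr
  have h3 : (δ / 2 + 3 * √δ) * δ ≤ 4 * ε * δ := by
    refine mul_le_mul_of_nonneg_right ?_ hδ
    have := h.var_le
    have := h.le_half
    nlinarith
  rw [abs_sub_comm] at h1
  have := abs_sub_le (∑ c, w c * ((1 - y c ^ 2) / (Real.cosh a + y c * Real.sinh a)))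
    ((Real.cosh a)⁻¹ * (1 - (Real.cosh a)⁻¹ ^ 2 * δ))
    (Real.exp (-δ / 2) * ∫ z, (Real.cosh (a + √δ * z))⁻¹ ∂stdGauss)
  linarith

/-- Harmonic mean. -/
noncomputable def hmean (p q : ℝ) : ℝ := 2 * (p * q) / (p + q)

lemma hmean_pos {p q : ℝ} (hp : 0 < p) (hq : 0 < q) : 0 < hmean p q := by
  unfold hmean; positivity

lemma hmean_le {p q : ℝ} (hp : 0 < p) (hq : 0 < q) : hmean p q ≤ √(p * q) := by
  have h := Real.sq_sqrt (mul_pos hp hq).le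
  have h0 := Real.sqrt_pos.2 (mul_pos hp hq)
  rw [hmean, div_le_iff₀ (by positivity)]
  have : 2 * √(p * q) ≤ p + q := by nlinarith [sq_nonneg (p - q)]
  nlinarith

/-- Gaussian heat flow of the harmonic mean. -/
noncomputable def gheat (Γ p q : ℝ) : ℝ :=
  Real.exp (-Γ / 2) * ∫ z, hmean (p * Real.exp (√Γ * z)) (q * Real.exp (-(√Γ * z))) ∂stdGauss

lemma continuous_hmean_exp {p q : ℝ} (hp : 0 < p) (hq : 0 < q) :
    Continuous fun x => hmean (p * Real.exp x) (q * Real.exp (-x)) := by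
  unfold hmean
  refine Continuous.div (by fun_prop) (by fun_prop) fun x => ?_
  have := Real.exp_pos x
  have := Real.exp_pos (-x)
  positivity

lemma abs_hmean_exp_le {p q : ℝ} (hp : 0 < p) (hq : 0 < q) (x : ℝ) :
    |hmean (p * Real.exp x) (q * Real.exp (-x))| ≤ √(p * q) := by
  have h1 := mul_pos hp (Real.exp_pos x)
  have h2 := mul_pos hq (Real.exp_pos (-x))
  rw [abs_of_pos (hmean_pos h1 h2)]
  refine (hmean_le h1 h2).trans (Real.sqrt_le_sqrt ?_)
  have : Real.exp x * Real.exp (-x) = 1 := by rw [← Real.exp_add]; simp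
  refine le_of_eq ?_
  linear_combination p * q * this

lemma integrable_hmean_exp {p q : ℝ} (hp : 0 < p) (hq : 0 < q) (t : ℝ) :
    Integrable (fun z => hmean (p * Real.exp (t * z)) (q * Real.exp (-(t * z)))) stdGauss :=
  integrable_of_bounded_stdGauss ((continuous_hmean_exp hp hq).comp (by fun_prop : Continuous fun z => t * z))
    (fun _ => abs_hmean_exp_le hp hq _)

lemma exists_polar {p q : ℝ} (hp : 0 < p) (hq : 0 < q) :
    ∃ a : ℝ, p = √(p * q) * Real.exp a ∧ q = √(p * q) * Real.exp (-a) := by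
  have h0 := Real.sqrt_pos.2 (mul_pos hp hq)
  refine ⟨Real.log (p / √(p * q)), ?_, ?_⟩
  · rw [Real.exp_log (by positivity)]; field_simp
  · rw [Real.exp_neg, Real.exp_log (by positivity)]
    field_simp
    rw [Real.sq_sqrt (by positivity)]

lemma hmean_polar {r : ℝ} (hr : 0 < r) (a y : ℝ) :
    hmean (r * Real.exp a * (1 + y)) (r * Real.exp (-a) * (1 - y)) =
      r * ((1 - y ^ 2) / (Real.cosh a + y * Real.sinh a)) := by
  have he : Real.exp a * Real.exp (-a) = 1 := by rw [← Real.exp_add]; simp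
  have e1 : 2 * (r * Real.exp a * (1 + y) * (r * Real.exp (-a) * (1 - y))) =
      2 * r * (r * (1 - y ^ 2)) := by
    linear_combination 2 * r ^ 2 * (1 - y ^ 2) * he
  have e2 : r * Real.exp a * (1 + y) + r * Real.exp (-a) * (1 - y) =
      2 * r * (Real.cosh a + y * Real.sinh a) := by
    rw [Real.cosh_eq, Real.sinh_eq]; ring
  rw [hmean, e1, e2, mul_div_mul_left _ _ (by positivity), mul_div_assoc]

lemma abs_hmean_step {w y : Bool → ℝ} {δ ε : ℝ} (h : Chan w y δ ε) {p q : ℝ}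
    (hp : 0 < p) (hq : 0 < q) :
    |∑ c, w c * hmean (p * (1 + y c)) (q * (1 - y c)) - gheat δ p q| ≤ 6 * ε * δ * √(p * q) := by
  obtain ⟨a, ha, ha'⟩ := exists_polar hp hq
  set r := √(p * q)
  have hr : 0 < r := Real.sqrt_pos.2 (mul_pos hp hq)
  have h1 := abs_lindeberg_step h a
  have e1 : ∑ c, w c * hmean (p * (1 + y c)) (q * (1 - y c)) =
      r * ∑ c, w c * ((1 - y c ^ 2) / (Real.cosh a + y c * Real.sinh a)) := by
    rw [Finset.mul_sum]
    refine Finset.sum_congr rfl fun c _ => ?_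
    conv_lhs => rw [ha, ha', hmean_polar hr]
    ring
  have e2 : gheat δ p q = r * (Real.exp (-δ / 2) * ∫ z, (Real.cosh (a + √δ * z))⁻¹ ∂stdGauss) := by
    have e3 : ∀ z, hmean (p * Real.exp (√δ * z)) (q * Real.exp (-(√δ * z))) =
        r * (Real.cosh (a + √δ * z))⁻¹ := fun z => by
      have := hmean_polar hr (a + √δ * z) 0
      simp only [add_zero, sub_zero, mul_one, zero_mul, zero_pow two_ne_zero, one_div, neg_add,
        Real.exp_add] at this
      rw [← this, ← mul_assoc, ← mul_assoc, ← ha, ← ha']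
    simp only [gheat, e3, integral_const_mul]
    ring
  rw [e1, e2, ← mul_sub, abs_mul, abs_of_pos hr, mul_comm]
  exact mul_le_mul_of_nonneg_right h1 hr.le

lemma gheat_zero (p q : ℝ) : gheat 0 p q = hmean p q := by simp [gheat]

lemma gheat_add {s t p q : ℝ} (hs : 0 ≤ s) (ht : 0 ≤ t) (hp : 0 < p) (hq : 0 < q) :
    gheat (s + t) p q = Real.exp (-s / 2) *
      ∫ z, gheat t (p * Real.exp (√s * z)) (q * Real.exp (-(√s * z))) ∂stdGauss := by
  have h := integral_integral_stdGauss (continuous_hmean_exp hp hq) (abs_hmean_exp_le hp hq) 0 hs ht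
  simp only [zero_add] at h
  unfold gheat
  rw [← h, integral_const_mul, ← mul_assoc, ← Real.exp_add]
  congr 1
  · congr 1; ring
  · congr 1; ext z; congr 1; ext z'
    rw [mul_assoc, mul_assoc, ← Real.exp_add, ← Real.exp_add, neg_add]

lemma Chan.one_add_pos {w y : Bool → ℝ} {δ ε : ℝ} (h : Chan w y δ ε) (c : Bool) :
    0 < 1 + y c ∧ 0 < 1 - y c := by
  have h1 := (h.bound c).trans h.le_half
  rw [abs_le] at h1
  constructor <;> linarith

lemma continuous_gheat_exp {t p q : ℝ} (hp : 0 < p) (hq : 0 < q) :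
    Continuous fun x => gheat t (p * Real.exp x) (q * Real.exp (-x)) := by
  unfold gheat
  have e : ∀ x y : ℝ, hmean (p * Real.exp x * Real.exp y) (q * Real.exp (-x) * Real.exp (-y)) =
      hmean (p * Real.exp (x + y)) (q * Real.exp (-(x + y))) := by
    intro x y
    rw [neg_add, Real.exp_add, Real.exp_add, mul_assoc, mul_assoc]
  simp only [e]
  refine continuous_const.mul (continuous_of_dominated (bound := fun _ => √(p * q)) ?_ ?_ ?_ ?_)
  · intro x
    exact ((continuous_hmean_exp hp hq).comp
      (by fun_prop : Continuous fun z => x + √t * z)).aestronglyMeasurable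
  · intro x; exact ae_of_all _ fun z => abs_hmean_exp_le hp hq _
  · exact integrable_const _
  · exact ae_of_all _ fun z => (continuous_hmean_exp hp hq).comp
      (by fun_prop : Continuous fun x => x + √t * z)

lemma abs_gheat_exp_le {t p q : ℝ} (ht : 0 ≤ t) (hp : 0 < p) (hq : 0 < q) (x : ℝ) :
    |gheat t (p * Real.exp x) (q * Real.exp (-x))| ≤ √(p * q) := by
  unfold gheat
  rw [abs_mul, abs_of_pos (Real.exp_pos _)]
  have e : ∀ x y : ℝ, hmean (p * Real.exp x * Real.exp y) (q * Real.exp (-x) * Real.exp (-y)) =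
        hmean (p * Real.exp (x + y)) (q * Real.exp (-(x + y))) := by
      intro x y
      rw [neg_add, Real.exp_add, Real.exp_add, mul_assoc, mul_assoc]
  simp only [e]
  have h1 : |∫ z, hmean (p * Real.exp (x + √t * z)) (q * Real.exp (-(x + √t * z))) ∂stdGauss| ≤
      √(p * q) := by
    have := norm_integral_le_of_norm_le_const (μ := stdGauss) (C := √(p * q))
      (f := fun z => hmean (p * Real.exp (x + √t * z)) (q * Real.exp (-(x + √t * z))))
      (ae_of_all _ fun z => abs_hmean_exp_le hp hq _)
    simpa using this
  exact (mul_le_of_le_one_left (abs_nonneg _) (Real.exp_le_one_iff.2 (by linarith))).trans h1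

/-- Exchange principle: a product channel with many small signals acts as a Gaussian channel. -/
lemma abs_lindeberg {w b : Bool → ℝ} {κ ε : ℝ} (h : Chan w b κ ε) (m : ℕ) :
    ∀ (M : Fin m → ℝ) (_ : ∀ v, |M v| ≤ 1) {p q : ℝ} (_ : 0 < p) (_ : 0 < q),
    |pE w (fun c : Fin m → Bool => hmean (p * ∏ v, (1 + M v * b (c v))) (q * ∏ v, (1 - M v * b (c v))))
      - gheat (∑ v, M v ^ 2 * κ) p q| ≤ 6 * ε * (∑ v, M v ^ 2 * κ) * √(p * q) := by
  have hε := h.eps_nonneg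
  have hκ := h.var_nonneg
  induction m with
  | zero =>
    intro M _ p q hp hq
    simp [pE_fin_zero, gheat_zero]
  | succ m ih =>
    intro M hM p q hp hq
    have hS := h.scale (hM 0)
    set y := fun c => M 0 * b c with hy
    set δ := M 0 ^ 2 * κ with hδ
    set Γ := ∑ v : Fin m, M v.succ ^ 2 * κ with hΓ
    have hΓ0 : 0 ≤ Γ := Finset.sum_nonneg fun v _ => by positivity
    have hδ0 : 0 ≤ δ := by positivity
    have hsum : ∑ v, M v ^ 2 * κ = Γ + δ := by rw [Fin.sum_univ_succ, add_comm]
    rw [pE_fin_succ, hsum]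
    simp only [Fin.prod_univ_succ, Fin.cons_zero, Fin.cons_succ]
    have hpos := hS.one_add_pos
    have step1 : |∑ c, w c * pE w (fun g : Fin m → Bool =>
          hmean (p * ((1 + M 0 * b c) * ∏ v : Fin m, (1 + M v.succ * b (g v))))
            (q * ((1 - M 0 * b c) * ∏ v : Fin m, (1 - M v.succ * b (g v))))) -
        ∑ c, w c * gheat Γ (p * (1 + y c)) (q * (1 - y c))| ≤ 6 * ε * Γ * √(p * q) := by
      rw [← Finset.sum_sub_distrib]
      refine (Finset.abs_sum_le_sum_abs _ _).trans ?_
      have : 6 * ε * Γ * √(p * q) = ∑ c, w c * (6 * ε * Γ * √(p * q)) := by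
        rw [← Finset.sum_mul, h.sum_one, one_mul]
      rw [this]
      refine Finset.sum_le_sum fun c _ => ?_
      rw [← mul_sub, abs_mul, abs_of_nonneg (h.nonneg c)]
      refine mul_le_mul_of_nonneg_left ?_ (h.nonneg c)
      have h1 := ih (fun v => M v.succ) (fun v => hM _) (mul_pos hp (hpos c).1) (mul_pos hq (hpos c).2)
      simp only [mul_assoc p, mul_assoc q] at h1
      refine h1.trans (mul_le_mul_of_nonneg_left (Real.sqrt_le_sqrt ?_) (by positivity))
      have : p * (1 + y c) * (q * (1 - y c)) = p * q - p * q * y c ^ 2 := by ring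
      have h2 : 0 ≤ p * q * y c ^ 2 := by positivity
      have e : p * ((1 + y c) * (q * (1 - y c))) = p * q - p * q * y c ^ 2 := by ring
      rw [e]; linarith
    have step2 : |∑ c, w c * gheat Γ (p * (1 + y c)) (q * (1 - y c)) - gheat (Γ + δ) p q| ≤
        6 * ε * δ * √(p * q) := by
      have e1 : ∑ c, w c * gheat Γ (p * (1 + y c)) (q * (1 - y c)) = Real.exp (-Γ / 2) *
          ∫ z, ∑ c, w c * hmean (p * Real.exp (√Γ * z) * (1 + y c))
            (q * Real.exp (-(√Γ * z)) * (1 - y c)) ∂stdGauss := by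
        rw [integral_finsetSum, Finset.mul_sum]
        · refine Finset.sum_congr rfl fun c _ => ?_
          rw [integral_const_mul, gheat]
          simp only [mul_right_comm]
          ring
        · intro c _
          have := integrable_hmean_exp (mul_pos hp (hpos c).1) (mul_pos hq (hpos c).2) (√Γ)
          simp only [mul_right_comm _ (1 + y c), mul_right_comm _ (1 - y c)] at this
          exact this.const_mul _
      have i1 : Integrable (fun z => ∑ c, w c * hmean (p * Real.exp (√Γ * z) * (1 + y c))
            (q * Real.exp (-(√Γ * z)) * (1 - y c))) stdGauss := by
        refine integrable_finsetSum _ fun c _ => ?_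
        have := integrable_hmean_exp (mul_pos hp (hpos c).1) (mul_pos hq (hpos c).2) (√Γ)
        simp only [mul_right_comm _ (1 + y c), mul_right_comm _ (1 - y c)] at this
        exact this.const_mul _
      have i2 : Integrable (fun z => gheat δ (p * Real.exp (√Γ * z)) (q * Real.exp (-(√Γ * z))))
          stdGauss :=
        integrable_of_bounded_stdGauss ((continuous_gheat_exp hp hq).comp
          (by fun_prop : Continuous fun z => √Γ * z)) (fun _ => abs_gheat_exp_le hδ0 hp hq _)
      rw [e1, gheat_add hΓ0 hδ0 hp hq, ← mul_sub, ← integral_sub i1 i2, abs_mul,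
        abs_of_pos (Real.exp_pos _)]
      refine (mul_le_of_le_one_left (abs_nonneg _) (Real.exp_le_one_iff.2 (by linarith))).trans ?_
      have := norm_integral_le_of_norm_le_const (μ := stdGauss) (C := 6 * ε * δ * √(p * q))
        (f := fun z => ∑ c, w c * hmean (p * Real.exp (√Γ * z) * (1 + y c))
            (q * Real.exp (-(√Γ * z)) * (1 - y c)) -
          gheat δ (p * Real.exp (√Γ * z)) (q * Real.exp (-(√Γ * z))))
        (ae_of_all _ fun z => by
          have hz := abs_hmean_step hS (mul_pos hp (Real.exp_pos (√Γ * z)))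
            (mul_pos hq (Real.exp_pos (-(√Γ * z))))
          have e : p * Real.exp (√Γ * z) * (q * Real.exp (-(√Γ * z))) = p * q := by
            have : Real.exp (√Γ * z) * Real.exp (-(√Γ * z)) = 1 := by rw [← Real.exp_add]; simp
            linear_combination p * q * this
          rwa [e] at hz)
      simpa using this
    have := abs_sub_le (∑ c, w c * pE w (fun g : Fin m → Bool =>
          hmean (p * ((1 + M 0 * b c) * ∏ v : Fin m, (1 + M v.succ * b (g v))))
            (q * ((1 - M 0 * b c) * ∏ v : Fin m, (1 - M v.succ * b (g v))))))
      (∑ c, w c * gheat Γ (p * (1 + y c)) (q * (1 - y c))) (gheat (Γ + δ) p q)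
    linarith

lemma gheat_one {Γ : ℝ} (hΓ : 0 ≤ Γ) : gheat Γ 1 1 = gmmse Γ := by
  rw [gheat, gmmse_eq hΓ]
  congr 2; ext z
  have := hmean_polar one_pos (√Γ * z) 0
  simpa using this

/-- Squared overlap of a single spin observed through `m` product channels. -/
lemma abs_cavity_sub_govl {w b : Bool → ℝ} {κ ε : ℝ} (h : Chan w b κ ε) {m : ℕ} (M : Fin m → ℝ)
    (hM : ∀ v, |M v| ≤ 1) :
    |pE w (fun c : Fin m → Bool => (((∏ v, (1 + M v * b (c v))) - ∏ v, (1 - M v * b (c v))) / 2) ^ 2 /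
      (((∏ v, (1 + M v * b (c v))) + ∏ v, (1 - M v * b (c v))) / 2)) - govl (∑ v, M v ^ 2 * κ)| ≤
      6 * ε * (∑ v, M v ^ 2 * κ) := by
  have hκ := h.var_nonneg
  have h1 := abs_lindeberg h m M hM one_pos one_pos
  rw [gheat_one (Finset.sum_nonneg fun v _ => by positivity)] at h1
  simp only [one_mul, mul_one, Real.sqrt_one] at h1
  have e : ∀ c : Fin m → Bool, (((∏ v, (1 + M v * b (c v))) - ∏ v, (1 - M v * b (c v))) / 2) ^ 2 /
      (((∏ v, (1 + M v * b (c v))) + ∏ v, (1 - M v * b (c v))) / 2) =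
      ((∏ v, (1 + M v * b (c v))) + ∏ v, (1 + -M v * b (c v))) / 2 -
        hmean (∏ v, (1 + M v * b (c v))) (∏ v, (1 - M v * b (c v))) := by
    intro c
    have hp : 0 < ∏ v, (1 + M v * b (c v)) :=
      Finset.prod_pos fun v _ => ((h.scale (hM v)).one_add_pos (c v)).1
    have hq : 0 < ∏ v, (1 - M v * b (c v)) :=
      Finset.prod_pos fun v _ => ((h.scale (hM v)).one_add_pos (c v)).2
    have : ∀ v, 1 + -M v * b (c v) = 1 - M v * b (c v) := fun v => by ring
    simp only [this]
    rw [hmean]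
    field_simp
    ring
  simp only [e, pE_sub, pE_div_const, pE_add]
  have hone : ∀ M : Fin m → ℝ, pE w (fun c : Fin m → Bool => ∏ v, (1 + M v * b (c v))) = 1 := by
    intro M
    rw [pE_prod w (fun v c => 1 + M v * b c)]
    refine Finset.prod_eq_one fun v _ => ?_
    have : ∀ c, w c * (1 + M v * b c) = w c + M v * (w c * b c) := fun c => by ring
    simp only [this, Finset.sum_add_distrib, ← Finset.mul_sum, h.sum_one, h.mean]
    ring
  rw [hone, hone (fun v => -M v), govl]
  rw [show ∀ x y : ℝ, (1 + 1) / 2 - x - (1 - y) = -(x - y) by intros; ring, abs_neg]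
  exact h1

lemma chi_sq (c : Bool) : chi c * chi c = 1 := by cases c <;> simp [chi]

lemma abs_chi (c : Bool) : |chi c| = 1 := by cases c <;> simp [chi]

/-- Likelihood ratio of the labels `x` with respect to the null model. -/
noncomputable def lik (n : ℕ) (b : Bool → ℝ) (x : Fin n → Bool) (g : VPair n → Bool) : ℝ :=
  ∏ e : VPair n, (1 + chi (x e.1.1) * chi (x e.1.2) * b (g e))

/-- Unnormalized posterior average of `φ` given the graph `g` and the revealed labels `y` on `U`. -/
noncomputable def postSum (n : ℕ) (b : Bool → ℝ) (U : Finset (Fin n)) (φ : (Fin n → Bool) → ℝ)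
    (g : VPair n → Bool) (y : Fin n → Bool) : ℝ :=
  pE half fun z : Fin n → Bool => lik n b (U.piecewise y z) g * φ (U.piecewise y z)

/-- Posterior average of `φ` given the graph `g` and the revealed labels `y` on `U`. -/
noncomputable def postAvg (n : ℕ) (b : Bool → ℝ) (U : Finset (Fin n)) (φ : (Fin n → Bool) → ℝ)
    (g : VPair n → Bool) (y : Fin n → Bool) : ℝ :=
  postSum n b U φ g y / postSum n b U (fun _ => 1) g y

/-- Expectation under the planted model. -/
noncomputable def plant (n : ℕ) (w b : Bool → ℝ) (U : Finset (Fin n))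
    (F : (VPair n → Bool) → (Fin n → Bool) → ℝ) : ℝ :=
  pE w fun g => pE half fun y => postSum n b U (fun _ => 1) g y * F g y

/-- Expected squared posterior average. -/
noncomputable def overlap (n : ℕ) (w b : Bool → ℝ) (U : Finset (Fin n)) (φ : (Fin n → Bool) → ℝ) : ℝ :=
  plant n w b U fun g y => postAvg n b U φ g y ^ 2

section ProductExpectation

variable {ι : Type*} [Fintype ι] [DecidableEq ι] {w : Bool → ℝ}

lemma pE_update (hw : ∑ c, w c = 1) (v : ι) (F : (ι → Bool) → ℝ) :
    pE w (fun y => ∑ s, w s * F (Function.update y v s)) = pE w F := by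
  have hprod : ∀ (y : ι → Bool) (s : Bool),
      (∏ i, w (Function.update y v s i)) * w (y v) = (∏ i, w (y i)) * w s := by
    intro y s
    rw [← Finset.mul_prod_erase _ _ (Finset.mem_univ v), ← Finset.mul_prod_erase _ (fun i => w (y i))
      (Finset.mem_univ v)]
    have : ∏ i ∈ Finset.univ.erase v, w (Function.update y v s i) =
        ∏ i ∈ Finset.univ.erase v, w (y i) :=
      Finset.prod_congr rfl fun i hi => by rw [Function.update_of_ne (Finset.ne_of_mem_erase hi)]
    rw [this, Function.update_self]
    ring
  let e : (ι → Bool) × Bool ≃ (ι → Bool) × Bool :=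
    { toFun := fun p => (Function.update p.1 v p.2, p.1 v)
      invFun := fun p => (Function.update p.1 v p.2, p.1 v)
      left_inv := fun p => by simp
      right_inv := fun p => by simp }
  have h := Equiv.sum_comp e (fun p => (∏ i, w (p.1 i)) * w p.2 * F p.1)
  rw [Fintype.sum_prod_type, Fintype.sum_prod_type] at h
  simp only [e, Equiv.coe_fn_mk, hprod] at h
  rw [pE, pE]
  simp only [Finset.mul_sum, ← mul_assoc]
  rw [h]
  refine Finset.sum_congr rfl fun y _ => ?_
  rw [← Finset.sum_mul, ← Finset.mul_sum, hw, mul_one]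

lemma pE_sq_div_le (hw : ∀ c, 0 ≤ w c) {A B : (ι → Bool) → ℝ} (hB : ∀ g, 0 < B g) :
    pE w A ^ 2 / pE w B ≤ pE w (fun g => A g ^ 2 / B g) := by
  have hBn : 0 ≤ pE w B := pE_nonneg hw fun g => (hB g).le
  rcases hBn.eq_or_lt with h0 | h0
  · rw [← h0, div_zero]
    exact pE_nonneg hw fun g => div_nonneg (sq_nonneg _) (hB g).le
  · set t := pE w A / pE w B with ht
    have h : pE w (fun g => 2 * t * A g - t ^ 2 * B g) ≤ pE w (fun g => A g ^ 2 / B g) := by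
      refine pE_mono hw fun g => ?_
      rw [le_div_iff₀ (hB g)]
      nlinarith [sq_nonneg (A g - t * B g)]
    rw [pE_sub, pE_const_mul, pE_const_mul] at h
    refine le_trans (le_of_eq ?_) h
    rw [ht]; field_simp; ring

end ProductExpectation

lemma lik_pos {w b : Bool → ℝ} {κ ε : ℝ} (h : Chan w b κ ε) {n : ℕ} (x : Fin n → Bool)
    (g : VPair n → Bool) : 0 < lik n b x g := by
  refine Finset.prod_pos fun e _ => ?_
  have h1 := (h.bound (g e)).trans h.le_half
  rw [abs_le] at h1
  cases x e.1.1 <;> cases x e.1.2 <;> simp [chi] <;> linarith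

lemma pE_lik {w b : Bool → ℝ} {κ ε : ℝ} (h : Chan w b κ ε) {n : ℕ} (x : Fin n → Bool) :
    pE w (lik n b x) = 1 := by
  unfold lik
  rw [pE_prod w (fun e : VPair n => fun c => 1 + chi (x e.1.1) * chi (x e.1.2) * b c)]
  refine Finset.prod_eq_one fun e _ => ?_
  have : ∀ c, w c * (1 + chi (x e.1.1) * chi (x e.1.2) * b c) =
      w c + chi (x e.1.1) * chi (x e.1.2) * (w c * b c) := fun c => by ring
  simp only [this, Finset.sum_add_distrib, ← Finset.mul_sum, h.sum_one, h.mean]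
  ring

section Posterior

variable {w b : Bool → ℝ} {κ ε : ℝ} {n : ℕ} {U : Finset (Fin n)}

lemma postSum_one_pos (h : Chan w b κ ε) (g : VPair n → Bool) (y : Fin n → Bool) :
    0 < postSum n b U (fun _ => 1) g y :=
  pE_pos half_nonneg half_sum fun z => by simpa using lik_pos h _ g

lemma postSum_mono (h : Chan w b κ ε) {φ ψ : (Fin n → Bool) → ℝ} (hle : ∀ x, φ x ≤ ψ x)
    (g : VPair n → Bool) (y : Fin n → Bool) : postSum n b U φ g y ≤ postSum n b U ψ g y :=
  pE_mono half_nonneg fun _ => mul_le_mul_of_nonneg_left (hle _) (lik_pos h _ g).le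

lemma postSum_const_mul (a : ℝ) (φ : (Fin n → Bool) → ℝ) (g : VPair n → Bool) (y : Fin n → Bool) :
    postSum n b U (fun x => a * φ x) g y = a * postSum n b U φ g y := by
  rw [postSum, postSum, ← pE_const_mul]
  congr 1; ext z; ring

lemma abs_postAvg_le_one (h : Chan w b κ ε) {φ : (Fin n → Bool) → ℝ} (hφ : ∀ x, |φ x| ≤ 1)
    (g : VPair n → Bool) (y : Fin n → Bool) : |postAvg n b U φ g y| ≤ 1 := by
  have hp := postSum_one_pos (U := U) h g y
  rw [postAvg, abs_div, abs_of_pos hp, div_le_one hp]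
  rw [abs_le]
  constructor
  · have := postSum_mono (U := U) h (φ := fun _ => -1 * 1) (ψ := φ)
      (fun x => by have := (abs_le.1 (hφ x)).1; linarith) g y
    rw [postSum_const_mul] at this
    linarith
  · exact postSum_mono h (fun x => (abs_le.1 (hφ x)).2) g y

lemma plant_mono (h : Chan w b κ ε) {F G : (VPair n → Bool) → (Fin n → Bool) → ℝ}
    (hle : ∀ g y, F g y ≤ G g y) : plant n w b U F ≤ plant n w b U G :=
  pE_mono h.nonneg fun g => pE_mono half_nonneg fun y =>
    mul_le_mul_of_nonneg_left (hle g y) (postSum_one_pos h g y).le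

lemma plant_add (F G : (VPair n → Bool) → (Fin n → Bool) → ℝ) :
    plant n w b U (fun g y => F g y + G g y) = plant n w b U F + plant n w b U G := by
  simp only [plant, mul_add, pE_add]

lemma plant_sub (F G : (VPair n → Bool) → (Fin n → Bool) → ℝ) :
    plant n w b U (fun g y => F g y - G g y) = plant n w b U F - plant n w b U G := by
  simp only [plant, mul_sub, pE_sub]

lemma plant_const_mul (a : ℝ) (F : (VPair n → Bool) → (Fin n → Bool) → ℝ) :
    plant n w b U (fun g y => a * F g y) = a * plant n w b U F := by
  simp only [plant, mul_left_comm _ a, pE_const_mul]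

lemma plant_sum {α : Type*} (s : Finset α) (F : α → (VPair n → Bool) → (Fin n → Bool) → ℝ) :
    plant n w b U (fun g y => ∑ a ∈ s, F a g y) = ∑ a ∈ s, plant n w b U (F a) := by
  simp only [plant, Finset.mul_sum, pE_sum]

lemma plant_one (h : Chan w b κ ε) : plant n w b U (fun _ _ => 1) = 1 := by
  simp only [plant, mul_one, postSum]
  rw [pE_comm]
  have : ∀ y : Fin n → Bool, pE w (fun g => pE half fun z : Fin n → Bool =>
      lik n b (U.piecewise y z) g) = 1 := by
    intro y
    rw [pE_comm]
    simp only [show ∀ z : Fin n → Bool, (fun x => lik n b (U.piecewise y z) x) =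
      lik n b (U.piecewise y z) from fun _ => rfl, pE_lik h, pE_const half_sum]
  simp only [this, pE_const half_sum]

lemma plant_const (h : Chan w b κ ε) (a : ℝ) : plant n w b U (fun _ _ => a) = a := by
  have := plant_const_mul (w := w) (b := b) (U := U) a (fun _ _ => 1)
  rw [plant_one h] at this
  simpa using this

lemma plant_nonneg (h : Chan w b κ ε) {F : (VPair n → Bool) → (Fin n → Bool) → ℝ}
    (hF : ∀ g y, 0 ≤ F g y) : 0 ≤ plant n w b U F := by
  have := plant_mono (U := U) h (F := fun _ _ => 0) hF
  rwa [plant_const h] at this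

lemma plant_sq_le (h : Chan w b κ ε) (F : (VPair n → Bool) → (Fin n → Bool) → ℝ) :
    plant n w b U F ^ 2 ≤ plant n w b U (fun g y => F g y ^ 2) := by
  have hn := plant_nonneg (U := U) h (fun g y => sq_nonneg (F g y - plant n w b U F))
  have e : ∀ g y, (F g y - plant n w b U F) ^ 2 =
    F g y ^ 2 - 2 * plant n w b U F * F g y + plant n w b U F ^ 2 := fun g y => by ring
  simp only [e, plant_add, plant_sub, plant_const_mul, plant_const h] at hn
  nlinarith

lemma plant_sqrt_le (h : Chan w b κ ε) {F : (VPair n → Bool) → (Fin n → Bool) → ℝ}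
    (hF : ∀ g y, 0 ≤ F g y) : plant n w b U (fun g y => √(F g y)) ≤ √(plant n w b U F) := by
  refine Real.le_sqrt_of_sq_le ((plant_sq_le h _).trans (le_of_eq ?_))
  simp only [Real.sq_sqrt (hF _ _)]

lemma overlap_nonneg (h : Chan w b κ ε) (φ : (Fin n → Bool) → ℝ) : 0 ≤ overlap n w b U φ :=
  plant_nonneg h fun _ _ => sq_nonneg _

lemma overlap_le_one (h : Chan w b κ ε) {φ : (Fin n → Bool) → ℝ} (hφ : ∀ x, |φ x| ≤ 1) :
    overlap n w b U φ ≤ 1 := by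
  rw [← plant_one (U := U) h]
  refine plant_mono h fun g y => ?_
  rw [← sq_abs]
  exact pow_le_one₀ (abs_nonneg _) (abs_postAvg_le_one h hφ g y)

lemma overlap_eq (h : Chan w b κ ε) (φ : (Fin n → Bool) → ℝ) : overlap n w b U φ =
    pE w fun g => pE half fun y => postSum n b U φ g y ^ 2 / postSum n b U (fun _ => 1) g y := by
  unfold overlap plant postAvg
  congr 1; ext g; congr 1; ext y
  have := (postSum_one_pos (U := U) h g y).ne'
  field_simp

lemma postSum_insert {v : Fin n} (hv : v ∉ U) (φ : (Fin n → Bool) → ℝ) (g : VPair n → Bool)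
    (y : Fin n → Bool) : postSum n b U φ g y =
      ∑ s, half s * postSum n b (insert v U) φ g (Function.update y v s) := by
  unfold postSum
  rw [← pE_update half_sum v]
  have e : ∀ (z : Fin n → Bool) (s : Bool), U.piecewise y (Function.update z v s) =
      (insert v U).piecewise (Function.update y v s) z := by
    intro z s
    ext i
    by_cases hi : i = v
    · subst hi; simp [hv]
    · by_cases hU : i ∈ U <;> simp [hi, hU]
  simp only [e, pE_sum, pE_const_mul]

/-- Posterior covariance of two functions. -/
noncomputable def postCov (n : ℕ) (b : Bool → ℝ) (U : Finset (Fin n)) (φ ψ : (Fin n → Bool) → ℝ)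
    (g : VPair n → Bool) (y : Fin n → Bool) : ℝ :=
  postAvg n b U (fun x => φ x * ψ x) g y - postAvg n b U φ g y * postAvg n b U ψ g y

lemma two_point_cov_le {A B : Bool → ℝ} (hB : ∀ s, 0 < B s) {T Z P R : ℝ}
    (hT : T = ∑ s, half s * (chi s * A s)) (hZ : Z = ∑ s, half s * B s)
    (hP : P = ∑ s, half s * A s) (hR : R = ∑ s, half s * (chi s * B s)) :
    Z * (T / Z - P / Z * (R / Z)) ^ 2 + Z * (P / Z) ^ 2 ≤
      ∑ s, half s * (B s * (A s / B s) ^ 2) := by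
  simp only [Fintype.sum_bool, half, chi] at *
  have h1 := hB true
  have h2 := hB false
  simp only [if_true, Bool.false_eq_true, if_false] at *
  generalize A true = a at *
  generalize A false = c at *
  generalize B true = p at *
  generalize B false = q at *
  have hpq : 0 < p + q := by linarith
  have e : 1 / 2 * (p * (a / p) ^ 2) + 1 / 2 * (q * (c / q) ^ 2) -
      (Z * (T / Z - P / Z * (R / Z)) ^ 2 + Z * (P / Z) ^ 2) =
      (a * q - c * p) ^ 2 * (p - q) ^ 2 / (2 * p * q * (p + q) ^ 3) := by
    rw [show Z = (p + q) / 2 by rw [hZ]; ring, hT, hP, hR]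
    field_simp
    ring
  have : 0 ≤ (a * q - c * p) ^ 2 * (p - q) ^ 2 / (2 * p * q * (p + q) ^ 3) := by positivity
  linarith

/-- Revealing one more label increases the overlap by at least the squared covariance. -/
lemma plant_cov_sq_le (h : Chan w b κ ε) {v : Fin n} (hv : v ∉ U) (φ : (Fin n → Bool) → ℝ) :
    plant n w b U (fun g y => postCov n b U φ (fun x => chi (x v)) g y ^ 2) + overlap n w b U φ ≤
      overlap n w b (insert v U) φ := by
  unfold overlap
  rw [← plant_add]
  unfold plant
  refine pE_mono h.nonneg fun g => ?_
  rw [← pE_update half_sum v (fun y => postSum n b (insert v U) (fun _ => 1) g y *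
    postAvg n b (insert v U) φ g y ^ 2)]
  refine pE_mono half_nonneg fun y => ?_
  have hchi : ∀ (φ : (Fin n → Bool) → ℝ) (s : Bool), postSum n b (insert v U)
      (fun x => φ x * chi (x v)) g (Function.update y v s) =
      chi s * postSum n b (insert v U) φ g (Function.update y v s) := by
    intro φ s
    rw [← postSum_const_mul]
    unfold postSum
    congr 1; ext z
    simp only [Finset.piecewise_insert_self, Function.update_self]
    ring
  have h1 := two_point_cov_le (A := fun s => postSum n b (insert v U) φ g (Function.update y v s))
    (B := fun s => postSum n b (insert v U) (fun _ => 1) g (Function.update y v s))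
    (fun s => postSum_one_pos h g _)
    (T := postSum n b U (fun x => φ x * chi (x v)) g y)
    (Z := postSum n b U (fun _ => 1) g y) (P := postSum n b U φ g y)
    (R := postSum n b U (fun x => chi (x v)) g y)
    (by rw [postSum_insert hv]; simp only [hchi]) (postSum_insert hv _ _ _) (postSum_insert hv _ _ _)
    (by
      rw [postSum_insert hv]
      have := hchi (fun _ => 1)
      simp only [one_mul] at this
      simp only [this])
  rw [← mul_add] at h1
  exact h1

lemma overlap_le_insert (h : Chan w b κ ε) {v : Fin n} (hv : v ∉ U) (φ : (Fin n → Bool) → ℝ) :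
    overlap n w b U φ ≤ overlap n w b (insert v U) φ := by
  have h1 := plant_cov_sq_le h hv φ
  have h2 := plant_nonneg (U := U) h
    (fun g y => sq_nonneg (postCov n b U φ (fun x => chi (x v)) g y))
  linarith

lemma overlap_empty_le (h : Chan w b κ ε) (φ : (Fin n → Bool) → ℝ) (U : Finset (Fin n)) :
    overlap n w b ∅ φ ≤ overlap n w b U φ := by
  induction U using Finset.induction_on with
  | empty => exact le_rfl
  | insert v U hv ih => exact ih.trans (overlap_le_insert h hv φ)

end Posterior

section Exchange

variable {n : ℕ}

/-- Action of a vertex permutation on pairs. -/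
def pairMap (π : Equiv.Perm (Fin n)) (e : VPair n) : VPair n :=
  if h : π e.1.1 < π e.1.2 then ⟨(π e.1.1, π e.1.2), h⟩
  else ⟨(π e.1.2, π e.1.1), lt_of_le_of_ne (not_lt.1 h) fun h' => e.2.ne (π.injective h').symm⟩

lemma pairMap_symm_pairMap (π : Equiv.Perm (Fin n)) (e : VPair n) :
    pairMap π.symm (pairMap π e) = e := by
  obtain ⟨⟨u, v⟩, huv⟩ := e
  by_cases h : π u < π v
  · simp only [pairMap, h, dif_pos, Equiv.symm_apply_apply]
    exact dif_pos huv
  · simp only [pairMap, h, dif_neg, not_false_iff, Equiv.symm_apply_apply]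
    exact dif_neg huv.le.not_gt

/-- Permutation of the pairs induced by a vertex permutation. -/
def pairPerm (π : Equiv.Perm (Fin n)) : Equiv.Perm (VPair n) where
  toFun := pairMap π
  invFun := pairMap π.symm
  left_inv := pairMap_symm_pairMap π
  right_inv e := by simpa using pairMap_symm_pairMap π.symm e

variable {w b : Bool → ℝ} {κ ε : ℝ} {U : Finset (Fin n)}

lemma lik_perm (π : Equiv.Perm (Fin n)) (x : Fin n → Bool) (g : VPair n → Bool) :
    lik n b x (g ∘ (pairPerm π).symm) = lik n b (x ∘ π) g := by
  refine (Fintype.prod_equiv (pairPerm π) _ _ fun e => ?_).symm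
  simp only [Function.comp_apply, Equiv.symm_apply_apply]
  by_cases h : π e.1.1 < π e.1.2
  · simp [pairPerm, pairMap, h]
  · simp [pairPerm, pairMap, h, mul_comm]

lemma postSum_perm {π : Equiv.Perm (Fin n)} (hU : ∀ v, π v ∈ U ↔ v ∈ U)
    (φ : (Fin n → Bool) → ℝ) (g : VPair n → Bool) (y : Fin n → Bool) :
    postSum n b U φ (g ∘ (pairPerm π).symm) y =
      postSum n b U (fun x => φ (x ∘ π.symm)) g (y ∘ π) := by
  unfold postSum
  rw [← pE_equiv π]
  congr 1; ext z
  have e : U.piecewise y (z ∘ π.symm) ∘ π = U.piecewise (y ∘ π) z := by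
    ext v
    by_cases hv : v ∈ U <;> simp [hv, hU]
  have e2 : U.piecewise y (z ∘ π.symm) = U.piecewise (y ∘ π) z ∘ π.symm := by
    rw [← e, Function.comp_assoc, Equiv.self_comp_symm, Function.comp_id]
  rw [lik_perm, e, e2]

lemma plant_perm {π : Equiv.Perm (Fin n)} (hU : ∀ v, π v ∈ U ↔ v ∈ U)
    {F F' : (VPair n → Bool) → (Fin n → Bool) → ℝ}
    (hF : ∀ g y, F (g ∘ (pairPerm π).symm) y = F' g (y ∘ π)) :
    plant n w b U F = plant n w b U F' := by
  unfold plant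
  rw [← pE_equiv (pairPerm π)]
  congr 1; ext g
  rw [← pE_equiv π]
  congr 1; ext y
  have e : (y ∘ π.symm) ∘ π = y := by
    ext v; simp only [Function.comp_apply, Equiv.symm_apply_apply]
  rw [postSum_perm hU, hF, e]

lemma overlap_perm {π : Equiv.Perm (Fin n)} (hU : ∀ v, π v ∈ U ↔ v ∈ U)
    (φ : (Fin n → Bool) → ℝ) :
    overlap n w b U (fun x => φ (x ∘ π)) = overlap n w b U φ := by
  refine (plant_perm (π := π.symm) (fun v => by rw [← hU]; simp) fun g y => ?_).symm
  · simp only [postAvg, postSum_perm (π := π.symm) (U := U) (fun v => by rw [← hU]; simp)]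
    rfl

/-- A permutation moving two vertices to two prescribed ones and fixing a set avoiding all four. -/
lemma exists_perm_pair {u v a c : Fin n} (huv : u ≠ v) (hac : a ≠ c) (hu : u ∉ U) (hv : v ∉ U)
    (ha : a ∉ U) (hc : c ∉ U) :
    ∃ π : Equiv.Perm (Fin n), π a = u ∧ π c = v ∧ ∀ x, π x ∈ U ↔ x ∈ U := by
  refine ⟨Equiv.swap (Equiv.swap a u c) v * Equiv.swap a u, ?_, ?_, ?_⟩
  · simp only [Equiv.Perm.mul_apply, Equiv.swap_apply_left]
    refine Equiv.swap_apply_of_ne_of_ne ?_ huv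
    intro h
    have : Equiv.swap a u a = Equiv.swap a u c := by rw [Equiv.swap_apply_left]; exact h
    exact hac ((Equiv.swap a u).injective this)
  · simp
  · have key : ∀ p q : Fin n, p ∉ U → q ∉ U → ∀ x, Equiv.swap p q x ∈ U ↔ x ∈ U := by
      intro p q hp hq x
      by_cases h1 : x = p
      · subst h1; simp [hp, hq]
      by_cases h2 : x = q
      · subst h2; simp [hp, hq]
      rw [Equiv.swap_apply_of_ne_of_ne h1 h2]
    intro x
    rw [Equiv.Perm.mul_apply, key _ _ (by rwa [key a u ha hu]) hv, key a u ha hu]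

lemma overlap_pair_eq {u v a c : Fin n} (huv : u ≠ v) (hac : a ≠ c) (hu : u ∉ U) (hv : v ∉ U)
    (ha : a ∉ U) (hc : c ∉ U) :
    overlap n w b U (fun x => chi (x u) * chi (x v)) =
      overlap n w b U (fun x => chi (x a) * chi (x c)) := by
  obtain ⟨π, h1, h2, h3⟩ := exists_perm_pair huv hac hu hv ha hc
  rw [← overlap_perm h3 fun x => chi (x a) * chi (x c)]
  simp only [Function.comp_apply, h1, h2]

lemma plant_postCov_eq {u v a c : Fin n} (huv : u ≠ v) (hac : a ≠ c) (hu : u ∉ U) (hv : v ∉ U)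
    (ha : a ∉ U) (hc : c ∉ U) :
    plant n w b U (fun g y => postCov n b U (fun x => chi (x u)) (fun x => chi (x v)) g y ^ 2) =
      plant n w b U
        (fun g y => postCov n b U (fun x => chi (x a)) (fun x => chi (x c)) g y ^ 2) := by
  obtain ⟨π, h1, h2, h3⟩ := exists_perm_pair huv hac hu hv ha hc
  refine plant_perm h3 fun g y => ?_
  have e1 : π.symm u = a := by rw [← h1, Equiv.symm_apply_apply]
  have e2 : π.symm v = c := by rw [← h2, Equiv.symm_apply_apply]
  simp only [postCov, postAvg, postSum_perm h3, Function.comp_apply, e1, e2]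

end Exchange

section Succ

variable {m : ℕ} {w b : Bool → ℝ} {κ ε : ℝ}

/-- The pairs of `m + 1` vertices: those containing vertex `0`, and the others. -/
noncomputable def pairSucc (m : ℕ) : Fin m ⊕ VPair m ≃ VPair (m + 1) :=
  Equiv.ofBijective
    (Sum.elim (fun v => ⟨(0, v.succ), Fin.succ_pos v⟩)
      (fun e => ⟨(e.1.1.succ, e.1.2.succ), Fin.succ_lt_succ_iff.2 e.2⟩)) (by
    constructor
    · rintro (u | ⟨⟨u, v⟩, h⟩) (u' | ⟨⟨u', v'⟩, h'⟩) he
      · simpa using he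
      · simp [Fin.ext_iff] at he
      · simp [Fin.ext_iff] at he
      · simpa using he
    · rintro ⟨⟨u, v⟩, h⟩
      obtain ⟨v, rfl⟩ := Fin.exists_succ_eq.2 (Fin.ne_zero_of_lt h)
      rcases Fin.eq_zero_or_eq_succ u with rfl | ⟨u, rfl⟩
      · exact ⟨Sum.inl v, rfl⟩
      · exact ⟨Sum.inr ⟨(u, v), Fin.succ_lt_succ_iff.1 h⟩, rfl⟩)

/-- Graph on `m + 1` vertices with edges `c` at vertex `0` and `g` elsewhere. -/
noncomputable def graphCons (c : Fin m → Bool) (g : VPair m → Bool) : VPair (m + 1) → Bool :=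
  Sum.elim c g ∘ (pairSucc m).symm

lemma pE_graphCons (F : (VPair (m + 1) → Bool) → ℝ) :
    pE w F = pE w fun c : Fin m → Bool => pE w fun g => F (graphCons c g) := by
  rw [← pE_equiv (pairSucc m), pE_sumElim]
  rfl

lemma lik_graphCons (x0 : Bool) (σ : Fin m → Bool) (c : Fin m → Bool) (g : VPair m → Bool) :
    lik (m + 1) b (Fin.cons x0 σ) (graphCons c g) =
      (∏ v, (1 + chi x0 * chi (σ v) * b (c v))) * lik m b σ g := by
  unfold lik graphCons
  rw [← Equiv.prod_comp (pairSucc m), Fintype.prod_sum_type]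
  simp only [Function.comp_apply, Equiv.symm_apply_apply, Sum.elim_inl, Sum.elim_inr]
  rfl

lemma postSum_graphCons (U : Finset (Fin m)) (Φ : (Fin (m + 1) → Bool) → ℝ) (c : Fin m → Bool)
    (g : VPair m → Bool) (y0 : Bool) (y : Fin m → Bool) :
    postSum (m + 1) b (U.map (Fin.succEmb m)) Φ (graphCons c g) (Fin.cons y0 y) =
      ∑ x0, half x0 * postSum m b U (fun σ =>
        (∏ v, (1 + chi x0 * chi (σ v) * b (c v))) * Φ (Fin.cons x0 σ)) g y := by
  unfold postSum
  rw [pE_fin_succ (m := m)]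
  have e : ∀ (x0 : Bool) (z : Fin m → Bool), (U.map (Fin.succEmb m)).piecewise
      (Fin.cons y0 y : Fin (m + 1) → Bool) (Fin.cons x0 z) = Fin.cons x0 (U.piecewise y z) := by
    intro x0 z
    ext i
    refine Fin.cases ?_ (fun i => ?_) i
    · simp [Finset.piecewise]
    · by_cases hi : i ∈ U <;> simp [Finset.piecewise, hi]
  refine Finset.sum_congr rfl fun x0 _ => ?_
  congr 2; ext z
  rw [e, lik_graphCons]
  ring

/-- The edges at one more vertex can only increase the overlap. -/
lemma overlap_le_succ (h : Chan w b κ ε) (U : Finset (Fin m)) (φ : (Fin m → Bool) → ℝ) :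
    overlap m w b U φ ≤ overlap (m + 1) w b (U.map (Fin.succEmb m)) (fun x => φ (Fin.tail x)) := by
  rw [overlap_eq h, overlap_eq h, pE_graphCons,
    pE_comm (ι := Fin m) (κ := VPair m) (w := w) (w' := w)]
  refine pE_mono h.nonneg fun g => ?_
  have hy : ∀ c : Fin m → Bool, (pE half fun y : Fin (m + 1) → Bool =>
      postSum (m + 1) b (U.map (Fin.succEmb m)) (fun x => φ (Fin.tail x)) (graphCons c g) y ^ 2 /
        postSum (m + 1) b (U.map (Fin.succEmb m)) (fun _ => 1) (graphCons c g) y) =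
      pE half fun y : Fin m → Bool =>
        postSum (m + 1) b (U.map (Fin.succEmb m)) (fun x => φ (Fin.tail x)) (graphCons c g)
          (Fin.cons true y) ^ 2 /
        postSum (m + 1) b (U.map (Fin.succEmb m)) (fun _ => 1) (graphCons c g)
          (Fin.cons true y) := by
    intro c
    rw [pE_fin_succ]
    simp only [postSum_graphCons, ← Finset.sum_mul, half_sum, one_mul]
  simp only [hy]
  rw [pE_comm (ι := Fin m) (κ := Fin m) (w := w) (w' := half)]
  refine pE_mono half_nonneg fun y => ?_
  have hE : ∀ φ : (Fin m → Bool) → ℝ, (pE w fun c : Fin m → Bool =>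
      postSum (m + 1) b (U.map (Fin.succEmb m)) (fun x => φ (Fin.tail x)) (graphCons c g)
        (Fin.cons true y)) = postSum m b U φ g y := by
    intro φ
    simp only [postSum_graphCons, Fin.tail_cons]
    rw [pE_sum]
    simp only [pE_const_mul]
    have : ∀ x0 : Bool, (pE w fun c : Fin m → Bool => postSum m b U (fun σ =>
        (∏ v, (1 + chi x0 * chi (σ v) * b (c v))) * φ σ) g y) = postSum m b U φ g y := by
      intro x0
      unfold postSum
      rw [pE_comm]
      congr 1; ext z
      rw [pE_const_mul, pE_mul_const,
        pE_prod w (fun v c => 1 + chi x0 * chi (U.piecewise y z v) * b c)]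
      have hv : ∀ v, ∑ c, w c * (1 + chi x0 * chi (U.piecewise y z v) * b c) = 1 := by
        intro v
        have : ∀ c, w c * (1 + chi x0 * chi (U.piecewise y z v) * b c) =
          w c + chi x0 * chi (U.piecewise y z v) * (w c * b c) := fun c => by ring
        simp only [this, Finset.sum_add_distrib, ← Finset.mul_sum, h.sum_one, h.mean]
        ring
      simp only [hv, Finset.prod_const_one, one_mul]
    simp only [this, ← Finset.sum_mul, half_sum, one_mul]
  rw [← hE φ, ← hE fun _ => 1]
  exact pE_sq_div_le h.nonneg fun c => postSum_one_pos h _ _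

end Succ

/-- Likelihood factor of the edges `c` at one vertex whose products with the neighbours are `s`. -/
noncomputable def spinProd {m : ℕ} (b : Bool → ℝ) (s : Fin m → ℝ) (c : Fin m → Bool) : ℝ :=
  ∏ v, (1 + s v * b (c v))

section SpinProd

variable {m : ℕ} {w b : Bool → ℝ} {κ ε : ℝ}

lemma pE_mul_mul (F G : (Fin m → Bool) → ℝ) :
    (pE w fun c => pE w fun d => F c * G d) = pE w F * pE w G := by
  simp only [pE_const_mul, pE_mul_const]

lemma spinProd_pos (h : Chan w b κ ε) {s : Fin m → ℝ} (hs : ∀ v, |s v| ≤ 1) (c : Fin m → Bool) :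
    0 < spinProd b s c := by
  refine Finset.prod_pos fun v _ => ?_
  have h1 := (h.bound (c v)).trans h.le_half
  have h2 : |s v * b (c v)| ≤ 1 / 2 := by
    rw [abs_mul]
    nlinarith [hs v, abs_nonneg (s v), abs_nonneg (b (c v))]
  have := (abs_le.1 h2).1
  linarith

lemma pE_spinProd_mul (h : Chan w b κ ε) (s t : Fin m → ℝ) :
    (pE w fun c => spinProd b s c * spinProd b t c) = ∏ v, (1 + κ * (s v * t v)) := by
  simp only [spinProd, ← Finset.prod_mul_distrib]
  rw [pE_prod w (fun v c => (1 + s v * b c) * (1 + t v * b c))]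
  refine Finset.prod_congr rfl fun v _ => ?_
  have : ∀ c, w c * ((1 + s v * b c) * (1 + t v * b c)) =
    w c + (s v + t v) * (w c * b c) + s v * t v * (w c * b c ^ 2) := fun c => by ring
  simp only [this, Finset.sum_add_distrib, ← Finset.mul_sum, h.sum_one, h.mean, h.var]
  ring

lemma pE_spinProd (h : Chan w b κ ε) (s : Fin m → ℝ) : pE w (spinProd b s) = 1 := by
  have := pE_spinProd_mul h s (fun _ => 0)
  have e : spinProd b s = fun c => ∏ v, (1 + s v * b (c v)) := rfl
  rw [e]
  simpa [spinProd] using this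

lemma prod_sq_bounds {κ : ℝ} (hκ : 0 ≤ κ) (hκ' : κ ≤ 1 / 4) {s : Fin m → ℝ} (hs : ∀ v, |s v| ≤ 1) :
    Real.exp (2 * κ * ∑ v, s v - 4 * κ ^ 2 * m) ≤ (∏ v, (1 + κ * s v)) ^ 2 ∧
      (∏ v, (1 + κ * s v)) ^ 2 ≤ Real.exp (2 * κ * ∑ v, s v) := by
  have hb : ∀ v, |κ * s v| ≤ 1 / 4 := fun v => by
    rw [abs_mul, abs_of_nonneg hκ]; nlinarith [hs v, abs_nonneg (s v)]
  have hp : ∀ v, 0 < 1 + κ * s v := fun v => by have := (abs_le.1 (hb v)).1; linarith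
  have e1 : ∀ v, (1 + κ * s v) ≤ Real.exp (κ * s v) := fun v => by
    have := Real.add_one_le_exp (κ * s v); linarith
  have e2 : ∀ v, Real.exp (κ * s v - 2 * κ ^ 2) ≤ 1 + κ * s v := fun v => by
    have hb1 := abs_le.1 (hb v)
    have hinv := Real.one_sub_inv_le_log_of_pos (hp v)
    have h3 : κ * s v - (κ * s v) ^ 2 / (1 + κ * s v) = 1 - (1 + κ * s v)⁻¹ := by
      have := (hp v).ne'
      field_simp; ring
    rw [← Real.le_log_iff_exp_le (hp v)]
    have hsq : s v ^ 2 ≤ 1 := by rw [← sq_abs]; exact pow_le_one₀ (abs_nonneg _) (hs v)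
    have : (κ * s v) ^ 2 / (1 + κ * s v) ≤ 2 * κ ^ 2 := by
      rw [div_le_iff₀ (hp v), mul_pow]
      nlinarith [sq_nonneg κ, (abs_le.1 (hb v)).1]
    linarith
  rw [← Finset.prod_pow]
  have x1 : Real.exp (2 * κ * ∑ v, s v) = ∏ v, Real.exp (κ * s v) ^ 2 := by
    rw [Finset.mul_sum, Real.exp_sum]
    exact Finset.prod_congr rfl fun v _ => by rw [← Real.exp_nat_mul]; congr 1; push_cast; ring
  have x2 : Real.exp (2 * κ * ∑ v, s v - 4 * κ ^ 2 * m) = ∏ v, Real.exp (κ * s v - 2 * κ ^ 2) ^ 2 := by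
    have : 2 * κ * ∑ v, s v - 4 * κ ^ 2 * m = ∑ v, 2 * (κ * s v - 2 * κ ^ 2) := by
      rw [← Finset.mul_sum, Finset.sum_sub_distrib, ← Finset.mul_sum]; simp; ring
    rw [this, Real.exp_sum]
    exact Finset.prod_congr rfl fun v _ => by rw [← Real.exp_nat_mul]; congr 1
  rw [x1, x2]
  exact ⟨Finset.prod_le_prod (fun v _ => by positivity) fun v _ =>
    pow_le_pow_left₀ (Real.exp_pos _).le (e2 v) 2,
    Finset.prod_le_prod (fun v _ => by positivity) fun v _ =>
    pow_le_pow_left₀ (hp v).le (e1 v) 2⟩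

lemma exp_sub_exp_le {x y B : ℝ} (hx : x ≤ B) :
    Real.exp x - Real.exp y ≤ Real.exp B * |x - y| := by
  have h1 : Real.exp x - Real.exp y ≤ Real.exp x * (x - y) := by
    have := Real.add_one_le_exp (y - x)
    have h2 : Real.exp y = Real.exp x * Real.exp (y - x) := by rw [← Real.exp_add]; ring_nf
    rw [h2]; nlinarith [Real.exp_pos x]
  refine h1.trans ?_
  have := Real.exp_le_exp.2 hx
  nlinarith [Real.exp_pos x, le_abs_self (x - y), abs_nonneg (x - y)]

end SpinProd

section Decoupling

variable {m : ℕ} {Ω : Type*} [Fintype Ω] {ν : Ω → ℝ} {σ : Ω → Fin m → ℝ}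

lemma sum_mul_abs_le_sqrt (hν : ∀ ω, 0 ≤ ν ω) (h1 : ∑ ω, ν ω = 1) (X : Ω → ℝ) :
    ∑ ω, ν ω * |X ω| ≤ √(∑ ω, ν ω * X ω ^ 2) := by
  refine Real.le_sqrt_of_sq_le ?_
  set t := ∑ ω, ν ω * |X ω| with ht
  have h : 0 ≤ ∑ ω, ν ω * (|X ω| - t) ^ 2 :=
    Finset.sum_nonneg fun ω _ => mul_nonneg (hν ω) (sq_nonneg _)
  have e : ∀ ω, ν ω * (|X ω| - t) ^ 2 = ν ω * X ω ^ 2 - 2 * t * (ν ω * |X ω|) + ν ω * t ^ 2 :=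
    fun ω => by rw [← sq_abs (X ω)]; ring
  simp only [e, Finset.sum_add_distrib, Finset.sum_sub_distrib, ← Finset.mul_sum,
    ← Finset.sum_mul, h1, ← ht] at h
  nlinarith

/-- Mean of a spin. -/
noncomputable def spinMean (ν : Ω → ℝ) (σ : Ω → Fin m → ℝ) (v : Fin m) : ℝ := ∑ ω, ν ω * σ ω v

/-- Covariance of two spins. -/
noncomputable def spinCov (ν : Ω → ℝ) (σ : Ω → Fin m → ℝ) (u v : Fin m) : ℝ :=
  ∑ ω, ν ω * (σ ω u * σ ω v) - spinMean ν σ u * spinMean ν σ v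

lemma abs_sum_mul_le_one (hν : ∀ ω, 0 ≤ ν ω) (h1 : ∑ ω, ν ω = 1) {X : Ω → ℝ}
    (hX : ∀ ω, |X ω| ≤ 1) : |∑ ω, ν ω * X ω| ≤ 1 := by
  refine (Finset.abs_sum_le_sum_abs _ _).trans ?_
  rw [← h1]
  refine Finset.sum_le_sum fun ω _ => ?_
  rw [abs_mul, abs_of_nonneg (hν ω)]
  exact mul_le_of_le_one_right (hν ω) (hX ω)

lemma abs_spinMean_le (hν : ∀ ω, 0 ≤ ν ω) (h1 : ∑ ω, ν ω = 1) (hσ : ∀ ω v, |σ ω v| ≤ 1)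
    (v : Fin m) : |spinMean ν σ v| ≤ 1 :=
  abs_sum_mul_le_one hν h1 fun ω => hσ ω v

lemma sum_abs_replica_le (hν : ∀ ω, 0 ≤ ν ω) (h1 : ∑ ω, ν ω = 1) (hσ : ∀ ω v, |σ ω v| ≤ 1) :
    ∑ ω, ν ω * ∑ ω', ν ω' * |∑ v, σ ω v * σ ω' v - ∑ v, spinMean ν σ v * spinMean ν σ v| ≤
      √(2 * ∑ u, ∑ v, |spinCov ν σ u v|) := by
  set S3 := ∑ v, spinMean ν σ v * spinMean ν σ v with hS3
  have hM := abs_spinMean_le hν h1 hσ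
  have hpair := sum_mul_abs_le_sqrt (ν := fun p : Ω × Ω => ν p.1 * ν p.2)
    (fun p => mul_nonneg (hν _) (hν _))
    (by rw [Fintype.sum_prod_type]; simp only [← Finset.mul_sum, h1, mul_one])
    (fun p => ∑ v, σ p.1 v * σ p.2 v - S3)
  simp only [Fintype.sum_prod_type, mul_assoc] at hpair
  simp only [← Finset.mul_sum] at hpair
  refine hpair.trans (Real.sqrt_le_sqrt ?_)
  have hlin : ∑ ω, ν ω * ∑ ω', ν ω' * ∑ v, σ ω v * σ ω' v = S3 := by
    simp only [hS3, spinMean, Finset.mul_sum, Finset.sum_mul]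
    rw [Finset.sum_congr rfl fun ω _ => Finset.sum_comm, Finset.sum_comm]
    refine Finset.sum_congr rfl fun v _ => ?_
    rw [Finset.sum_comm]
    exact Finset.sum_congr rfl fun _ _ => Finset.sum_congr rfl fun _ _ => by ring
  have hsq : ∑ ω, ν ω * ∑ ω', ν ω' * (∑ v, σ ω v * σ ω' v) ^ 2 =
      ∑ u, ∑ v, (∑ ω, ν ω * (σ ω u * σ ω v)) ^ 2 := by
    simp only [sq, Finset.mul_sum, Finset.sum_mul]
    rw [Finset.sum_congr rfl fun ω _ => Finset.sum_comm, Finset.sum_comm]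
    refine Finset.sum_congr rfl fun v _ => ?_
    rw [Finset.sum_congr rfl fun ω _ => Finset.sum_comm, Finset.sum_comm]
    refine Finset.sum_congr rfl fun v _ => ?_
    rw [Finset.sum_comm]
    exact Finset.sum_congr rfl fun _ _ => Finset.sum_congr rfl fun _ _ => by ring
  have hS3sq : S3 ^ 2 = ∑ u, ∑ v, (spinMean ν σ u * spinMean ν σ v) ^ 2 := by
    rw [hS3, sq, Finset.sum_mul_sum]
    exact Finset.sum_congr rfl fun _ _ => Finset.sum_congr rfl fun _ _ => by ring
  have e : ∀ ω ω', ν ω' * (∑ v, σ ω v * σ ω' v - S3) ^ 2 =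
      ν ω' * (∑ v, σ ω v * σ ω' v) ^ 2 - 2 * S3 * (ν ω' * ∑ v, σ ω v * σ ω' v) + ν ω' * S3 ^ 2 :=
    fun ω ω' => by ring
  have e2 : ∀ a c d f : ℝ, a * (c - 2 * S3 * d + f) = a * c - 2 * S3 * (a * d) + a * f :=
    fun a c d f => by ring
  simp only [e, Finset.sum_add_distrib, Finset.sum_sub_distrib, ← Finset.mul_sum, ← Finset.sum_mul,
    h1, e2, one_mul, hlin, hsq]
  have hfin : ∑ u, ∑ v, (∑ ω, ν ω * (σ ω u * σ ω v)) ^ 2 - S3 ^ 2 ≤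
      2 * ∑ u, ∑ v, |spinCov ν σ u v| := by
    rw [hS3sq, ← Finset.sum_sub_distrib, Finset.mul_sum]
    refine Finset.sum_le_sum fun u _ => ?_
    rw [← Finset.sum_sub_distrib, Finset.mul_sum]
    refine Finset.sum_le_sum fun v _ => ?_
    have h2 : |∑ ω, ν ω * (σ ω u * σ ω v)| ≤ 1 := abs_sum_mul_le_one hν h1 fun ω => by
      rw [abs_mul]; exact mul_le_one₀ (hσ ω u) (abs_nonneg _) (hσ ω v)
    have h3 : |spinMean ν σ u * spinMean ν σ v| ≤ 1 := by
      rw [abs_mul]; exact mul_le_one₀ (hM u) (abs_nonneg _) (hM v)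
    unfold spinCov
    generalize ∑ ω, ν ω * (σ ω u * σ ω v) = ρ at *
    generalize spinMean ν σ u * spinMean ν σ v = μ at *
    have h4 : |ρ + μ| ≤ 2 := (abs_add_le _ _).trans (by linarith)
    calc ρ ^ 2 - μ ^ 2 = (ρ + μ) * (ρ - μ) := by ring
      _ ≤ |(ρ + μ) * (ρ - μ)| := le_abs_self _
      _ = |ρ + μ| * |ρ - μ| := abs_mul _ _
      _ ≤ 2 * |ρ - μ| := mul_le_mul_of_nonneg_right h4 (abs_nonneg _)
  linarith

/-- Joint likelihood of the edges at two added vertices of labels `s`, `t`. -/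
noncomputable def pairLik (b : Bool → ℝ) (ν : Ω → ℝ) (σ : Ω → Fin m → ℝ) (s t : ℝ)
    (c d : Fin m → Bool) : ℝ :=
  ∑ ω, ν ω * (spinProd b (fun v => s * σ ω v) c * spinProd b (fun v => t * σ ω v) d)

/-- Decoupled version of `pairLik`. -/
noncomputable def pairLikDec (b : Bool → ℝ) (M : Fin m → ℝ) (s t : ℝ) (c d : Fin m → Bool) : ℝ :=
  spinProd b (fun v => s * M v) c * spinProd b (fun v => t * M v) d

variable {w b : Bool → ℝ} {κ ε : ℝ}

lemma pE_sq_pairLik_sub_le (h : Chan w b κ ε) (hν : ∀ ω, 0 ≤ ν ω) (h1 : ∑ ω, ν ω = 1)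
    (hσ : ∀ ω v, |σ ω v| ≤ 1) {s t : ℝ} (hs : s * s = 1) (ht : t * t = 1) :
    (pE w fun c => pE w fun d =>
      (pairLik b ν σ s t c d - pairLikDec b (spinMean ν σ) s t c d) ^ 2) ≤
      Real.exp (2 * κ * m) * (2 * κ * √(2 * ∑ u, ∑ v, |spinCov ν σ u v|) + 8 * κ ^ 2 * m) := by
  have hκ := h.var_nonneg
  have hκ4 : κ ≤ 1 / 4 := h.var_le.trans (by nlinarith [h.le_half, h.eps_nonneg])
  have hM := abs_spinMean_le hν h1 hσ
  have hrep := sum_abs_replica_le hν h1 hσ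
  set V := √(2 * ∑ u, ∑ v, |spinCov ν σ u v|)
  set M := spinMean ν σ
  have e : ∀ c d, (pairLik b ν σ s t c d - pairLikDec b M s t c d) ^ 2 =
      ∑ ω, ν ω * ∑ ω', ν ω' *
        ((spinProd b (fun v => s * σ ω v) c * spinProd b (fun v => s * σ ω' v) c) *
          (spinProd b (fun v => t * σ ω v) d * spinProd b (fun v => t * σ ω' v) d))
      - 2 * ∑ ω, ν ω *
        ((spinProd b (fun v => s * σ ω v) c * spinProd b (fun v => s * M v) c) *
          (spinProd b (fun v => t * σ ω v) d * spinProd b (fun v => t * M v) d))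
      + (spinProd b (fun v => s * M v) c * spinProd b (fun v => s * M v) c) *
          (spinProd b (fun v => t * M v) d * spinProd b (fun v => t * M v) d) := by
    intro c d
    unfold pairLik pairLikDec
    rw [sub_sq]
    congr 1
    · congr 1
      · rw [sq, Finset.sum_mul_sum]
        refine Finset.sum_congr rfl fun ω _ => ?_
        rw [Finset.mul_sum]
        exact Finset.sum_congr rfl fun ω' _ => by ring
      · rw [mul_assoc, Finset.sum_mul]
        congr 1
        exact Finset.sum_congr rfl fun ω' _ => by ring
    · ring
  have es : ∀ x y : ℝ, s * x * (s * y) = x * y := fun x y => by linear_combination x * y * hs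
  have et : ∀ x y : ℝ, t * x * (t * y) = x * y := fun x y => by linear_combination x * y * ht
  simp only [e, pE_add, pE_sub, pE_sum, pE_const_mul, pE_mul_const, pE_spinProd_mul h, es, et]
  simp only [← sq]
  simp only [sq (M _)]
  have hσσ : ∀ ω ω' v, |σ ω v * σ ω' v| ≤ 1 := fun ω ω' v => by
    rw [abs_mul]; exact mul_le_one₀ (hσ _ _) (abs_nonneg _) (hσ _ _)
  have hσM : ∀ ω v, |σ ω v * M v| ≤ 1 := fun ω v => by
    rw [abs_mul]; exact mul_le_one₀ (hσ _ _) (abs_nonneg _) (hM _)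
  have hMM : ∀ v, |M v * M v| ≤ 1 := fun v => by
    rw [abs_mul]; exact mul_le_one₀ (hM _) (abs_nonneg _) (hM _)
  set S3 := ∑ v, M v * M v with hS3
  have hsum_le : ∀ {f : Fin m → ℝ}, (∀ v, |f v| ≤ 1) → 2 * κ * ∑ v, f v ≤ 2 * κ * m := by
    intro f hf
    refine mul_le_mul_of_nonneg_left ?_ (by linarith)
    calc ∑ v, f v ≤ ∑ _v : Fin m, (1 : ℝ) :=
          Finset.sum_le_sum fun v _ => (le_abs_self _).trans (hf v)
      _ = m := by simp
  have T1 : ∑ ω, ν ω * ∑ ω', ν ω' * (∏ v, (1 + κ * (σ ω v * σ ω' v))) ^ 2 ≤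
      Real.exp (2 * κ * S3) + Real.exp (2 * κ * m) * (2 * κ * V) := by
    have a1 : ∀ ω ω', (∏ v, (1 + κ * (σ ω v * σ ω' v))) ^ 2 ≤ Real.exp (2 * κ * S3) +
        Real.exp (2 * κ * m) * (2 * κ) * |∑ v, σ ω v * σ ω' v - S3| := by
      intro ω ω'
      refine (prod_sq_bounds hκ hκ4 (hσσ ω ω')).2.trans ?_
      have := exp_sub_exp_le (y := 2 * κ * S3) (hsum_le (hσσ ω ω'))
      rw [← mul_sub, abs_mul, abs_of_nonneg (by linarith : 0 ≤ 2 * κ)] at this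
      linarith
    calc _ ≤ ∑ ω, ν ω * ∑ ω', ν ω' * (Real.exp (2 * κ * S3) +
        Real.exp (2 * κ * m) * (2 * κ) * |∑ v, σ ω v * σ ω' v - S3|) :=
          Finset.sum_le_sum fun ω _ => mul_le_mul_of_nonneg_left
            (Finset.sum_le_sum fun ω' _ => mul_le_mul_of_nonneg_left (a1 ω ω') (hν ω')) (hν ω)
      _ = Real.exp (2 * κ * S3) + Real.exp (2 * κ * m) * (2 * κ) *
          ∑ ω, ν ω * ∑ ω', ν ω' * |∑ v, σ ω v * σ ω' v - S3| := by
        simp only [mul_add, Finset.sum_add_distrib, ← Finset.sum_mul, h1, one_mul,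
          mul_left_comm (ν _) (Real.exp (2 * κ * m) * (2 * κ)), ← Finset.mul_sum]
      _ ≤ _ := by
        rw [← mul_assoc]
        have := mul_le_mul_of_nonneg_left hrep
          (by positivity : 0 ≤ Real.exp (2 * κ * m) * (2 * κ))
        linarith
  have T3 := (prod_sq_bounds hκ hκ4 hMM).2
  have T2 : Real.exp (2 * κ * S3) * (1 - 4 * κ ^ 2 * m) ≤
      ∑ ω, ν ω * (∏ v, (1 + κ * (σ ω v * M v))) ^ 2 := by
    have a1 : ∀ ω, Real.exp (2 * κ * S3) * (1 - 4 * κ ^ 2 * m + 2 * κ * ∑ v, σ ω v * M v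
        - 2 * κ * S3) ≤ (∏ v, (1 + κ * (σ ω v * M v))) ^ 2 := by
      intro ω
      refine le_trans ?_ (prod_sq_bounds hκ hκ4 (hσM ω)).1
      have := Real.add_one_le_exp (2 * κ * ∑ v, σ ω v * M v - 4 * κ ^ 2 * m - 2 * κ * S3)
      have h2 : Real.exp (2 * κ * ∑ v, σ ω v * M v - 4 * κ ^ 2 * m) = Real.exp (2 * κ * S3) *
          Real.exp (2 * κ * ∑ v, σ ω v * M v - 4 * κ ^ 2 * m - 2 * κ * S3) := by
        rw [← Real.exp_add]; ring_nf
      rw [h2]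
      exact mul_le_mul_of_nonneg_left (by linarith) (Real.exp_pos _).le
    refine le_trans (le_of_eq ?_) (Finset.sum_le_sum fun ω _ =>
      mul_le_mul_of_nonneg_left (a1 ω) (hν ω))
    have hS2 : ∑ ω, ν ω * ∑ v, σ ω v * M v = S3 := by
      simp only [hS3, Finset.mul_sum]
      rw [Finset.sum_comm]
      refine Finset.sum_congr rfl fun v _ => ?_
      simp only [← mul_assoc]
      rw [← Finset.sum_mul]
      rfl
    have e3 : ∀ ω, ν ω * (Real.exp (2 * κ * S3) * (1 - 4 * κ ^ 2 * m + 2 * κ * ∑ v, σ ω v * M v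
        - 2 * κ * S3)) = ν ω * (Real.exp (2 * κ * S3) * (1 - 4 * κ ^ 2 * m - 2 * κ * S3)) +
        Real.exp (2 * κ * S3) * (2 * κ) * (ν ω * ∑ v, σ ω v * M v) := fun ω => by ring
    simp only [e3, Finset.sum_add_distrib, ← Finset.sum_mul, ← Finset.mul_sum, h1, hS2]
    ring
  have hexp : Real.exp (2 * κ * S3) * (8 * κ ^ 2 * m) ≤
      Real.exp (2 * κ * m) * (8 * κ ^ 2 * m) :=
    mul_le_mul_of_nonneg_right (Real.exp_le_exp.2 (hsum_le hMM)) (by positivity)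
  linarith

end Decoupling

/-- Average of `L s t` over two independent signs. -/
noncomputable def signDen (L : ℝ → ℝ → ℝ) : ℝ := (L 1 1 + L 1 (-1) + L (-1) 1 + L (-1) (-1)) / 4

/-- Average of `s * t * L s t` over two independent signs. -/
noncomputable def signNum (L : ℝ → ℝ → ℝ) : ℝ := (L 1 1 - L 1 (-1) - L (-1) 1 + L (-1) (-1)) / 4

lemma abs_signNum_le {L : ℝ → ℝ → ℝ} (hL : ∀ s t, s * s = 1 → t * t = 1 → 0 < L s t) :
    |signNum L| ≤ signDen L ∧ 0 < signDen L := by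
  have h1 := hL 1 1 (by norm_num) (by norm_num)
  have h2 := hL 1 (-1) (by norm_num) (by norm_num)
  have h3 := hL (-1) 1 (by norm_num) (by norm_num)
  have h4 := hL (-1) (-1) (by norm_num) (by norm_num)
  unfold signNum signDen
  refine ⟨abs_le.2 ⟨by linarith, by linarith⟩, by linarith⟩

lemma signNum_sub_le (L L' : ℝ → ℝ → ℝ) :
    2 * |signNum L - signNum L'| + |signDen L - signDen L'| ≤
      3 * signDen (fun s t => |L s t - L' s t|) := by
  unfold signNum signDen
  have key : ∀ x y z u : ℝ, |(x + y + z + u) / 4| ≤ (|x| + |y| + |z| + |u|) / 4 := by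
    intro x y z u
    rw [abs_div, abs_of_pos (by norm_num : (0 : ℝ) < 4)]
    have := abs_add_le (x + y + z) u
    have := abs_add_le (x + y) z
    have := abs_add_le x y
    linarith
  have k1 := key (L 1 1 - L' 1 1) (-(L 1 (-1) - L' 1 (-1))) (-(L (-1) 1 - L' (-1) 1))
    (L (-1) (-1) - L' (-1) (-1))
  have k2 := key (L 1 1 - L' 1 1) (L 1 (-1) - L' 1 (-1)) (L (-1) 1 - L' (-1) 1)
    (L (-1) (-1) - L' (-1) (-1))
  simp only [abs_neg] at k1
  have e1 : (L 1 1 - L 1 (-1) - L (-1) 1 + L (-1) (-1)) / 4 -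
      (L' 1 1 - L' 1 (-1) - L' (-1) 1 + L' (-1) (-1)) / 4 =
    (L 1 1 - L' 1 1 + -(L 1 (-1) - L' 1 (-1)) + -(L (-1) 1 - L' (-1) 1) +
      (L (-1) (-1) - L' (-1) (-1))) / 4 := by ring
  have e2 : (L 1 1 + L 1 (-1) + L (-1) 1 + L (-1) (-1)) / 4 -
      (L' 1 1 + L' 1 (-1) + L' (-1) 1 + L' (-1) (-1)) / 4 =
    (L 1 1 - L' 1 1 + (L 1 (-1) - L' 1 (-1)) + (L (-1) 1 - L' (-1) 1) +
      (L (-1) (-1) - L' (-1) (-1))) / 4 := by ring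
  rw [e1, e2]
  linarith

lemma sq_div_le_add {a b a' b' : ℝ} (hb : 0 < b) (hab : |a| ≤ b) (hb' : 0 < b') :
    a ^ 2 / b ≤ a' ^ 2 / b' + 2 * |a - a'| + |b - b'| := by
  obtain ⟨x, rfl⟩ : ∃ x, a = x * b := ⟨a / b, by field_simp⟩
  have hx : |x| ≤ 1 := by
    rw [abs_mul, abs_of_pos hb] at hab
    by_contra hc
    nlinarith
  have h1 : 2 * x * a' - x ^ 2 * b' ≤ a' ^ 2 / b' := by
    rw [le_div_iff₀ hb']; nlinarith [sq_nonneg (a' - x * b')]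
  have h2 : (x * b) ^ 2 / b = 2 * x * (x * b) - x ^ 2 * b := by field_simp; ring
  have h3 : 2 * x * (x * b - a') ≤ 2 * |x * b - a'| := by
    have := le_abs_self (x * (x * b - a'))
    rw [abs_mul] at this
    nlinarith [abs_nonneg (x * b - a')]
  have h4 : -(x ^ 2 * (b - b')) ≤ |b - b'| := by
    have := neg_abs_le (b - b')
    have hx2 : x ^ 2 ≤ 1 := by rw [← sq_abs]; exact pow_le_one₀ (abs_nonneg _) hx
    nlinarith [abs_nonneg (b - b'), sq_nonneg x]
  rw [h2]
  linarith

section Cavity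

variable {m : ℕ} {Ω : Type*} [Fintype Ω] {ν : Ω → ℝ} {σ : Ω → Fin m → ℝ}
  {w b : Bool → ℝ} {κ ε : ℝ}

lemma abs_unit_mul_le {s x : ℝ} (hs : s * s = 1) (hx : |x| ≤ 1) : |s * x| ≤ 1 := by
  have : |s| = 1 := by
    rcases mul_self_eq_one_iff.1 hs with h | h <;> simp [h]
  rw [abs_mul, this, one_mul]; exact hx

lemma pairLik_pos (h : Chan w b κ ε) (hν : ∀ ω, 0 ≤ ν ω) (h1 : ∑ ω, ν ω = 1)
    (hσ : ∀ ω v, |σ ω v| ≤ 1) {s t : ℝ} (hs : s * s = 1) (ht : t * t = 1) (c d : Fin m → Bool) :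
    0 < pairLik b ν σ s t c d := by
  have hp : ∀ ω, 0 < spinProd b (fun v => s * σ ω v) c * spinProd b (fun v => t * σ ω v) d :=
    fun ω => mul_pos (spinProd_pos h (fun v => abs_unit_mul_le hs (hσ ω v)) c)
      (spinProd_pos h (fun v => abs_unit_mul_le ht (hσ ω v)) d)
  refine lt_of_le_of_ne (Finset.sum_nonneg fun ω _ => mul_nonneg (hν ω) (hp ω).le) fun h0 => ?_
  have h2 := (Finset.sum_eq_zero_iff_of_nonneg fun ω _ => mul_nonneg (hν ω) (hp ω).le).1 h0.symm
  have h3 : ∑ ω, ν ω = 0 := Finset.sum_eq_zero fun ω hω =>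
    (mul_eq_zero.1 (h2 ω hω)).resolve_right (hp ω).ne'
  linarith

lemma pairLikDec_pos (h : Chan w b κ ε) {M : Fin m → ℝ} (hM : ∀ v, |M v| ≤ 1) {s t : ℝ}
    (hs : s * s = 1) (ht : t * t = 1) (c d : Fin m → Bool) : 0 < pairLikDec b M s t c d :=
  mul_pos (spinProd_pos h (fun v => abs_unit_mul_le hs (hM v)) c)
      (spinProd_pos h (fun v => abs_unit_mul_le ht (hM v)) d)

lemma pE_pairLik (h : Chan w b κ ε) (h1 : ∑ ω, ν ω = 1) (s t : ℝ) :
    (pE w fun c => pE w fun d => pairLik b ν σ s t c d) = 1 := by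
  unfold pairLik
  simp only [pE_sum, pE_const_mul, pE_mul_const]
  simp only [show ∀ s : Fin m → ℝ, (pE w fun g => spinProd b s g) = 1 from fun s => pE_spinProd h s,
    mul_one, h1]

/-- Expected squared correlation of the labels of two vertices added to a system with posterior
measure `ν` and spins `σ`. -/
noncomputable def cavity (w b : Bool → ℝ) (ν : Ω → ℝ) (σ : Ω → Fin m → ℝ) : ℝ :=
  ∑ c0, w c0 * pE w fun c : Fin m → Bool => pE w fun d : Fin m → Bool =>
    (signNum (fun s t => pairLik b ν σ s t c d) +
      b c0 * signDen (fun s t => pairLik b ν σ s t c d)) ^ 2 /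
    (signDen (fun s t => pairLik b ν σ s t c d) +
      b c0 * signNum (fun s t => pairLik b ν σ s t c d))

lemma pE_abs_pairLik_sub_le (h : Chan w b κ ε) (hν : ∀ ω, 0 ≤ ν ω) (h1 : ∑ ω, ν ω = 1)
    (hσ : ∀ ω v, |σ ω v| ≤ 1) {s t : ℝ} (hs : s * s = 1) (ht : t * t = 1) :
    (pE w fun c => pE w fun d =>
      |pairLik b ν σ s t c d - pairLikDec b (spinMean ν σ) s t c d|) ≤
      √(Real.exp (2 * κ * m) * (2 * κ * √(2 * ∑ u, ∑ v, |spinCov ν σ u v|) + 8 * κ ^ 2 * m)) := by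
  refine Real.le_sqrt_of_sq_le ?_
  refine le_trans ?_ (pE_sq_pairLik_sub_le h hν h1 hσ hs ht)
  refine (pE_sq_le h.nonneg h.sum_one _).trans (pE_mono h.nonneg fun c => ?_)
  refine (pE_sq_le h.nonneg h.sum_one _).trans (pE_mono h.nonneg fun d => ?_)
  rw [sq_abs]

lemma dec_sq_div (h : Chan w b κ ε) {M : Fin m → ℝ} (hM : ∀ v, |M v| ≤ 1) :
    (pE w fun c => pE w fun d => signNum (fun s t => pairLikDec b M s t c d) ^ 2 /
      signDen (fun s t => pairLikDec b M s t c d)) ≤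
      govl (∑ v, M v ^ 2 * κ) ^ 2 + 12 * ε * κ * m := by
  have hκ := h.var_nonneg
  have hε := h.eps_nonneg
  have hP := abs_cavity_sub_govl h M hM
  set R : (Fin m → Bool) → ℝ := fun c =>
    ((∏ v, (1 + M v * b (c v)) - ∏ v, (1 - M v * b (c v))) / 2) ^ 2 /
      ((∏ v, (1 + M v * b (c v)) + ∏ v, (1 - M v * b (c v))) / 2) with hR
  have f1 : ∀ c, spinProd b (fun v => 1 * M v) c = ∏ v, (1 + M v * b (c v)) := fun c => by
    simp [spinProd]
  have f2 : ∀ c, spinProd b (fun v => -1 * M v) c = ∏ v, (1 - M v * b (c v)) := fun c => by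
    simp [spinProd, sub_eq_add_neg]
  have p1 : ∀ c : Fin m → Bool, 0 < ∏ v, (1 + M v * b (c v)) := fun c => by
    rw [← f1]; exact spinProd_pos h (fun v => by simpa using hM v) c
  have p2 : ∀ c : Fin m → Bool, 0 < ∏ v, (1 - M v * b (c v)) := fun c => by
    rw [← f2]; exact spinProd_pos h (fun v => by simpa using hM v) c
  have e : ∀ c d, signNum (fun s t => pairLikDec b M s t c d) ^ 2 /
      signDen (fun s t => pairLikDec b M s t c d) = R c * R d := by
    intro c d
    simp only [signNum, signDen, pairLikDec, f1, f2, hR]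
    rw [div_mul_div_comm, ← mul_pow]
    congr 1
    · ring
    · ring
  simp only [e, pE_mul_mul, ← sq]
  have R0 : 0 ≤ pE w R := pE_nonneg h.nonneg fun c =>
    div_nonneg (sq_nonneg _) (by have := p1 c; have := p2 c; linarith)
  have R1 : pE w R ≤ 1 := by
    have : pE w (fun c => (spinProd b (fun v => 1 * M v) c + spinProd b (fun v => -1 * M v) c) / 2)
        = 1 := by
      rw [pE_div_const, pE_add, pE_spinProd h, pE_spinProd h]; norm_num
    rw [← this]
    refine pE_mono h.nonneg fun c => ?_
    rw [f1, f2, hR]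
    have := p1 c
    have := p2 c
    simp only
    rw [div_le_iff₀ (by linarith)]
    nlinarith
  have g0 := govl_nonneg (∑ v, M v ^ 2 * κ)
  have g1 := govl_le_one (∑ v, M v ^ 2 * κ)
  have hΓ : ∑ v, M v ^ 2 * κ ≤ κ * m := by
    calc ∑ v, M v ^ 2 * κ ≤ ∑ _v : Fin m, κ := Finset.sum_le_sum fun v _ => by
          have : M v ^ 2 ≤ 1 := by rw [← sq_abs]; exact pow_le_one₀ (abs_nonneg _) (hM v)
          nlinarith
      _ = κ * m := by simp [mul_comm]
  have h6 : pE w R - govl (∑ v, M v ^ 2 * κ) ≤ 6 * ε * (κ * m) :=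
    ((le_abs_self _).trans hP).trans (mul_le_mul_of_nonneg_left hΓ (by linarith))
  have h7 : 0 ≤ 6 * ε * (κ * m) := by positivity
  generalize pE w R = r at *
  generalize govl (∑ v, M v ^ 2 * κ) = g at *
  nlinarith

/-- The cavity functional is controlled by the scalar overlap function. -/
lemma cavity_le (h : Chan w b κ ε) (hν : ∀ ω, 0 ≤ ν ω) (h1 : ∑ ω, ν ω = 1)
    (hσ : ∀ ω v, |σ ω v| ≤ 1) :
    cavity w b ν σ ≤ govl (∑ v, spinMean ν σ v ^ 2 * κ) ^ 2 + 12 * ε * κ * m + 3 * ε +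
      3 * √(Real.exp (2 * κ * m) *
        (2 * κ * √(2 * ∑ u, ∑ v, |spinCov ν σ u v|) + 8 * κ ^ 2 * m)) := by
  have hM := abs_spinMean_le hν h1 hσ
  have hD := fun {s t : ℝ} (hs : s * s = 1) (ht : t * t = 1) =>
    pE_abs_pairLik_sub_le h hν h1 hσ hs ht
  set B2 := √(Real.exp (2 * κ * m) *
    (2 * κ * √(2 * ∑ u, ∑ v, |spinCov ν σ u v|) + 8 * κ ^ 2 * m))
  have hε := h.eps_nonneg
  have hstep : ∀ c0 (c d : Fin m → Bool), (signNum (fun s t => pairLik b ν σ s t c d) +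
      b c0 * signDen (fun s t => pairLik b ν σ s t c d)) ^ 2 /
    (signDen (fun s t => pairLik b ν σ s t c d) +
      b c0 * signNum (fun s t => pairLik b ν σ s t c d)) ≤
      signNum (fun s t => pairLikDec b (spinMean ν σ) s t c d) ^ 2 /
        signDen (fun s t => pairLikDec b (spinMean ν σ) s t c d) +
      3 * ε * signDen (fun s t => pairLik b ν σ s t c d) + 3 * signDen (fun s t =>
        |pairLik b ν σ s t c d - pairLikDec b (spinMean ν σ) s t c d|) := by
    intro c0 c d
    obtain ⟨q1, q2⟩ := abs_signNum_le (L := fun s t => pairLik b ν σ s t c d)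
      fun s t hs ht => pairLik_pos h hν h1 hσ hs ht c d
    obtain ⟨q3, q4⟩ := abs_signNum_le (L := fun s t => pairLikDec b (spinMean ν σ) s t c d)
      fun s t hs ht => pairLikDec_pos h hM hs ht c d
    have q5 := signNum_sub_le (fun s t => pairLik b ν σ s t c d)
      (fun s t => pairLikDec b (spinMean ν σ) s t c d)
    have q6 := sq_div_le_add (a' := signNum (fun s t => pairLikDec b (spinMean ν σ) s t c d)) q2 q1 q4
    generalize signNum (fun s t => pairLik b ν σ s t c d) = A at *
    generalize signDen (fun s t => pairLik b ν σ s t c d) = B at *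
    have hb := abs_le.1 (h.bound c0)
    have hb2 := h.le_half
    have hbA : |b c0 * A| ≤ ε * B := by
      rw [abs_mul]
      exact mul_le_mul (h.bound c0) q1 (abs_nonneg _) hε
    have hbB : |b c0 * B| ≤ ε * B := by
      rw [abs_mul, abs_of_pos q2]
      exact mul_le_mul_of_nonneg_right (h.bound c0) q2.le
    have hBpos : 0 < B + b c0 * A := by
      have := (abs_le.1 hbA).1
      nlinarith
    have hAB : |A + b c0 * B| ≤ B + b c0 * A := by
      have := abs_le.1 q1
      rw [abs_le]
      constructor <;> nlinarith
    have q7 := sq_div_le_add (a' := A) hBpos hAB q2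
    rw [add_sub_cancel_left, add_sub_cancel_left] at q7
    linarith
  have hsum : ∀ c0 : Bool, (pE w fun c : Fin m → Bool => pE w fun d : Fin m → Bool =>
      (signNum (fun s t => pairLik b ν σ s t c d) +
      b c0 * signDen (fun s t => pairLik b ν σ s t c d)) ^ 2 /
    (signDen (fun s t => pairLik b ν σ s t c d) +
      b c0 * signNum (fun s t => pairLik b ν σ s t c d))) ≤
      govl (∑ v, spinMean ν σ v ^ 2 * κ) ^ 2 + 12 * ε * κ * m + 3 * ε + 3 * B2 := by
    intro c0
    refine (pE_mono h.nonneg fun c => pE_mono h.nonneg fun d => hstep c0 c d).trans ?_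
    simp only [pE_add, pE_const_mul]
    have z1 := dec_sq_div h hM
    have z2 : (pE w fun c => pE w fun d => signDen (fun s t => pairLik b ν σ s t c d)) = 1 := by
      simp only [signDen, pE_div_const, pE_add, pE_pairLik h h1]; norm_num
    have z3 : (pE w fun c => pE w fun d => signDen (fun s t =>
        |pairLik b ν σ s t c d - pairLikDec b (spinMean ν σ) s t c d|)) ≤ B2 := by
      simp only [signDen, pE_div_const, pE_add]
      have y1 := hD (s := 1) (t := 1) (by norm_num) (by norm_num)
      have y2 := hD (s := 1) (t := -1) (by norm_num) (by norm_num)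
      have y3 := hD (s := -1) (t := 1) (by norm_num) (by norm_num)
      have y4 := hD (s := -1) (t := -1) (by norm_num) (by norm_num)
      linarith
    rw [z2]
    linarith
  calc cavity w b ν σ ≤ ∑ c0, w c0 *
      (govl (∑ v, spinMean ν σ v ^ 2 * κ) ^ 2 + 12 * ε * κ * m + 3 * ε + 3 * B2) :=
        Finset.sum_le_sum fun c0 _ => mul_le_mul_of_nonneg_left (hsum c0) (h.nonneg c0)
    _ = _ := by rw [← Finset.sum_mul, h.sum_one, one_mul]

end Cavity

section CavityOverlap

variable {m : ℕ} {w b : Bool → ℝ} {κ ε : ℝ}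

/-- Posterior weights given the graph `g` and the labels `y` on `U`. -/
noncomputable def postWeight (m : ℕ) (b : Bool → ℝ) (U : Finset (Fin m)) (g : VPair m → Bool)
    (y z : Fin m → Bool) : ℝ :=
  (∏ i, half (z i)) * lik m b (U.piecewise y z) g / postSum m b U (fun _ => 1) g y

/-- Spins of the labels that agree with `y` on `U` and with `z` elsewhere. -/
noncomputable def pinSpin (U : Finset (Fin m)) (y z : Fin m → Bool) (v : Fin m) : ℝ :=
  chi (U.piecewise y z v)

lemma sum_postWeight_mul (U : Finset (Fin m)) (g : VPair m → Bool) (y : Fin m → Bool)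
    (ψ : (Fin m → Bool) → ℝ) :
    ∑ z, postWeight m b U g y z * ψ (U.piecewise y z) = postAvg m b U ψ g y := by
  unfold postAvg postSum pE postWeight
  rw [Finset.sum_div]
  exact Finset.sum_congr rfl fun z _ => by unfold postSum pE; ring

lemma postWeight_nonneg (h : Chan w b κ ε) (U : Finset (Fin m)) (g : VPair m → Bool)
    (y z : Fin m → Bool) : 0 ≤ postWeight m b U g y z :=
  div_nonneg (mul_nonneg (Finset.prod_nonneg fun _ _ => half_nonneg _) (lik_pos h _ g).le)
    (postSum_one_pos h g y).le

lemma sum_postWeight (h : Chan w b κ ε) (U : Finset (Fin m)) (g : VPair m → Bool)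
    (y : Fin m → Bool) : ∑ z, postWeight m b U g y z = 1 := by
  have := sum_postWeight_mul (b := b) U g y fun _ => 1
  simp only [mul_one] at this
  rw [this, postAvg, div_self (postSum_one_pos h g y).ne']

lemma abs_pinSpin_le (U : Finset (Fin m)) (y z : Fin m → Bool) (v : Fin m) :
    |pinSpin U y z v| ≤ 1 := (abs_chi _).le

lemma spinMean_post (U : Finset (Fin m)) (g : VPair m → Bool) (y : Fin m → Bool) (v : Fin m) :
    spinMean (postWeight m b U g y) (pinSpin U y) v = postAvg m b U (fun x => chi (x v)) g y :=
  sum_postWeight_mul U g y fun x => chi (x v)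

lemma spinCov_post (U : Finset (Fin m)) (g : VPair m → Bool) (y : Fin m → Bool) (u v : Fin m) :
    spinCov (postWeight m b U g y) (pinSpin U y) u v =
      postCov m b U (fun x => chi (x u)) (fun x => chi (x v)) g y := by
  unfold spinCov postCov
  rw [spinMean_post, spinMean_post, ← sum_postWeight_mul U g y fun x => chi (x u) * chi (x v)]
  rfl

lemma pE_rotate {ι₁ ι₂ ι₃ : Type*} [Fintype ι₁] [DecidableEq ι₁] [Fintype ι₂] [DecidableEq ι₂]
    [Fintype ι₃] [DecidableEq ι₃] {w₁ w₂ w₃ : Bool → ℝ}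
    (F : (ι₁ → Bool) → (ι₂ → Bool) → (ι₃ → Bool) → ℝ) :
    (pE w₁ fun x => pE w₂ fun y => pE w₃ fun z => F x y z) =
      pE w₂ fun y => pE w₃ fun z => pE w₁ fun x => F x y z := by
  rw [pE_comm]
  congr 1; ext y
  rw [pE_comm]

lemma postSum_two (h : Chan w b κ ε) (U : Finset (Fin m)) (Φ : Bool → Bool → ℝ) (c0 : Bool)
    (c d : Fin m → Bool) (g : VPair m → Bool) (y0 y1 : Bool) (y : Fin m → Bool) :
    postSum (m + 2) b ((U.map (Fin.succEmb m)).map (Fin.succEmb (m + 1)))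
      (fun x => Φ (x 0) (x 1)) (graphCons (Fin.cons c0 c) (graphCons d g))
      (Fin.cons y0 (Fin.cons y1 y)) = postSum m b U (fun _ => 1) g y *
        ∑ x0, half x0 * ∑ x1, half x1 * ((1 + chi x0 * chi x1 * b c0) * Φ x0 x1 *
          pairLik b (postWeight m b U g y) (pinSpin U y) (chi x0) (chi x1) c d) := by
  rw [postSum_graphCons, Finset.mul_sum]
  refine Finset.sum_congr rfl fun x0 _ => ?_
  rw [postSum_graphCons, mul_left_comm, Finset.mul_sum (a := postSum m b U (fun _ => 1) g y)]
  congr 1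
  refine Finset.sum_congr rfl fun x1 _ => ?_
  rw [mul_left_comm]
  congr 1
  simp only [Fin.prod_univ_succ, Fin.cons_zero, Fin.cons_succ, Fin.cons_one]
  have hz := (postSum_one_pos (U := U) h g y).ne'
  have e : pairLik b (postWeight m b U g y) (pinSpin U y) (chi x0) (chi x1) c d =
      postAvg m b U (fun τ => spinProd b (fun v => chi x0 * chi (τ v)) c *
        spinProd b (fun v => chi x1 * chi (τ v)) d) g y :=
    sum_postWeight_mul U g y fun τ => spinProd b (fun v => chi x0 * chi (τ v)) c *
        spinProd b (fun v => chi x1 * chi (τ v)) d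
  rw [e, postAvg, mul_left_comm, mul_div_cancel₀ _ hz, ← postSum_const_mul]
  congr 1; ext τ
  unfold spinProd
  ring

lemma overlap_add_two (h : Chan w b κ ε) (U : Finset (Fin m)) :
    overlap (m + 2) w b ((U.map (Fin.succEmb m)).map (Fin.succEmb (m + 1)))
      (fun x => chi (x 0) * chi (x 1)) =
    plant m w b U fun g y => cavity w b (postWeight m b U g y) (pinSpin U y) := by
  set Z := postSum m b U (fun _ => 1) with hZ
  have hZp : ∀ g y, 0 < Z g y := fun g y => postSum_one_pos h g y
  have hA : ∀ c0 (c d : Fin m → Bool) g y0 y1 y,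
      postSum (m + 2) b ((U.map (Fin.succEmb m)).map (Fin.succEmb (m + 1)))
        (fun x => chi (x 0) * chi (x 1)) (graphCons (Fin.cons c0 c) (graphCons d g))
        (Fin.cons y0 (Fin.cons y1 y)) ^ 2 /
      postSum (m + 2) b ((U.map (Fin.succEmb m)).map (Fin.succEmb (m + 1)))
        (fun _ => 1) (graphCons (Fin.cons c0 c) (graphCons d g))
        (Fin.cons y0 (Fin.cons y1 y)) = Z g y *
      ((signNum (fun s t => pairLik b (postWeight m b U g y) (pinSpin U y) s t c d) +
        b c0 * signDen (fun s t => pairLik b (postWeight m b U g y) (pinSpin U y) s t c d)) ^ 2 /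
      (signDen (fun s t => pairLik b (postWeight m b U g y) (pinSpin U y) s t c d) +
        b c0 * signNum (fun s t => pairLik b (postWeight m b U g y) (pinSpin U y) s t c d))) := by
    intro c0 c d g y0 y1 y
    rw [postSum_two h U (fun a c => chi a * chi c), postSum_two h U (fun _ _ => 1)]
    have e1 : ∑ x0, half x0 * ∑ x1, half x1 * ((1 + chi x0 * chi x1 * b c0) * (chi x0 * chi x1) *
        pairLik b (postWeight m b U g y) (pinSpin U y) (chi x0) (chi x1) c d) =
        signNum (fun s t => pairLik b (postWeight m b U g y) (pinSpin U y) s t c d) +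
        b c0 * signDen (fun s t => pairLik b (postWeight m b U g y) (pinSpin U y) s t c d) := by
      simp only [Fintype.sum_bool, half, chi, signNum, signDen, if_true, Bool.false_eq_true, if_false]
      ring
    have e2 : ∑ x0, half x0 * ∑ x1, half x1 * ((1 + chi x0 * chi x1 * b c0) * 1 *
        pairLik b (postWeight m b U g y) (pinSpin U y) (chi x0) (chi x1) c d) =
        signDen (fun s t => pairLik b (postWeight m b U g y) (pinSpin U y) s t c d) +
        b c0 * signNum (fun s t => pairLik b (postWeight m b U g y) (pinSpin U y) s t c d) := by
      simp only [Fintype.sum_bool, half, chi, signNum, signDen, if_true, Bool.false_eq_true, if_false]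
      ring
    rw [e1, e2, mul_pow, sq, mul_assoc, mul_div_mul_left _ _ (hZp g y).ne', mul_div_assoc]
  rw [overlap_eq h, pE_graphCons, pE_fin_succ]
  simp only [pE_graphCons (m := m), pE_fin_succ (m := m + 1) half, pE_fin_succ (m := m) half, hA,
    ← Finset.sum_mul, half_sum, one_mul]
  unfold plant cavity
  simp only [Finset.mul_sum, pE_sum]
  refine Finset.sum_congr rfl fun c0 _ => ?_
  simp only [← mul_assoc _ (w c0), mul_comm _ (w c0)]
  simp only [mul_assoc, pE_const_mul]
  congr 1
  simp only [← pE_const_mul]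
  rw [← pE_rotate (w₁ := w) (w₂ := w) (w₃ := half)]
  congr 1; ext c
  rw [← pE_rotate (w₁ := w) (w₂ := w) (w₃ := half)]

end CavityOverlap

lemma govl_le_tangent {μ t : ℝ} (hμ : 0 < μ) (ht : 0 ≤ t) :
    govl t ≤ govl μ + govlDeriv μ * (t - μ) := by
  rcases lt_trichotomy t μ with h | rfl | h
  · obtain ⟨c, hc, e⟩ := exists_hasDerivAt_eq_slope govl govlDeriv h continuous_govl.continuousOn
      (fun x hx => hasDerivAt_govl (ht.trans_lt hx.1))
    have h1 := govlDeriv_strictAnti hc.2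
    rw [eq_div_iff (by linarith)] at e
    nlinarith
  · simp
  · obtain ⟨c, hc, e⟩ := exists_hasDerivAt_eq_slope govl govlDeriv h continuous_govl.continuousOn
      (fun x hx => hasDerivAt_govl (hμ.trans hx.1))
    have h1 := govlDeriv_strictAnti hc.1
    rw [eq_div_iff (by linarith)] at e
    nlinarith

/-- The function `s ↦ govl (√s) ^ 2` lies below its tangents. -/
lemma govl_sq_le_tangent {μ t : ℝ} (hμ : 0 < μ) (ht : 0 ≤ t) :
    govl t ^ 2 ≤ govl μ ^ 2 + govl μ * govlDeriv μ / μ * (t ^ 2 - μ ^ 2) := by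
  have h1 := govl_le_tangent hμ ht
  have h0 := govl_le_tangent hμ le_rfl
  rw [govl_zero] at h0
  have hd := govlDeriv_pos μ
  have hn := govl_nonneg t
  have hq : govlDeriv μ ^ 2 ≤ govl μ * govlDeriv μ / μ := by
    rw [le_div_iff₀ hμ]
    nlinarith
  have e : govl μ * govlDeriv μ / μ * (t ^ 2 - μ ^ 2) =
      2 * govl μ * govlDeriv μ * (t - μ) + govl μ * govlDeriv μ / μ * (t - μ) ^ 2 := by
    field_simp
    ring
  rw [e]
  have h2 : govl t ^ 2 ≤ (govl μ + govlDeriv μ * (t - μ)) ^ 2 := pow_le_pow_left₀ hn h1 2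
  nlinarith [mul_le_mul_of_nonneg_right hq (sq_nonneg (t - μ))]

section Pinning

variable {n : ℕ} {w b : Bool → ℝ} {κ ε : ℝ}

lemma plant_govl_sq_le (h : Chan w b κ ε) {U : Finset (Fin n)} {Γ : (VPair n → Bool) → (Fin n → Bool) → ℝ}
    (hΓ : ∀ g y, 0 ≤ Γ g y) {μ : ℝ} (hμ : 0 < μ) (hle : plant n w b U (fun g y => Γ g y ^ 2) ≤ μ ^ 2) :
    plant n w b U (fun g y => govl (Γ g y) ^ 2) ≤ govl μ ^ 2 := by
  refine (plant_mono h fun g y => govl_sq_le_tangent hμ (hΓ g y)).trans ?_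
  simp only [plant_add, plant_const_mul, plant_const h, plant_sub]
  have : 0 ≤ govl μ * govlDeriv μ / μ :=
    div_nonneg (mul_nonneg (govl_nonneg μ) (govlDeriv_pos μ).le) hμ.le
  nlinarith

lemma sum_cov_le (h : Chan w b κ ε) (φ : (Fin n → Bool) → ℝ) (K : ℕ) (hK : K ≤ n) :
    ∑ k : Fin K, plant n w b (Finset.univ.filter fun v : Fin n => v.1 < k.1)
      (fun g y => postCov n b (Finset.univ.filter fun v : Fin n => v.1 < k.1) φ
        (fun x => chi (x ⟨k.1, k.2.trans_le hK⟩)) g y ^ 2) ≤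
    overlap n w b (Finset.univ.filter fun v : Fin n => v.1 < K) φ := by
  induction K with
  | zero => simpa using overlap_nonneg h φ
  | succ K ih =>
    rw [Fin.sum_univ_castSucc]
    have h1 := ih (by omega)
    have h2 := plant_cov_sq_le h (U := Finset.univ.filter fun v : Fin n => v.1 < K)
      (v := ⟨K, hK⟩) (by simp) φ
    have e : insert ⟨K, hK⟩ (Finset.univ.filter fun v : Fin n => v.1 < K) =
        Finset.univ.filter fun v : Fin n => v.1 < K + 1 := by
      ext v
      simp only [Finset.mem_insert, Finset.mem_filter, Finset.mem_univ, true_and, Fin.ext_iff]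
      omega
    rw [e] at h2
    simp only [Fin.val_castSucc, Fin.val_last]
    linarith

/-- After revealing few labels, the remaining ones are pairwise almost uncorrelated. -/
lemma exists_pinning (h : Chan w b κ ε) (K : ℕ) (hK1 : 1 ≤ K) (hK : K + 2 ≤ n) :
    ∃ U : Finset (Fin n), U.card ≤ K ∧ ∀ u v, u ≠ v → u ∉ U → v ∉ U →
      plant n w b U (fun g y => postCov n b U (fun x => chi (x u)) (fun x => chi (x v)) g y ^ 2) ≤
        1 / K := by
  have hK0 : (0 : ℝ) < K := by exact_mod_cast hK1
  set a : Fin n := ⟨n - 1, by omega⟩ with ha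
  have h1 := sum_cov_le h (fun x => chi (x a)) K (by omega)
  have h2 := h1.trans (overlap_le_one h fun x => (abs_chi _).le)
  have : Nonempty (Fin K) := ⟨⟨0, hK1⟩⟩
  obtain ⟨k, -, hk⟩ := Finset.exists_le_of_sum_le (s := (Finset.univ : Finset (Fin K)))
    (g := fun _ => 1 / (K : ℝ)) Finset.univ_nonempty
    (h2.trans (by simp [hK0.ne']))
  refine ⟨Finset.univ.filter fun v : Fin n => v.1 < k.1, ?_, fun u v huv hu hv => ?_⟩
  · have hs : (Finset.univ.filter fun v : Fin n => v.1 < k.1) ⊆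
        (Finset.univ : Finset (Fin K)).map (Fin.castLEEmb (by omega : K ≤ n)) := by
      intro v hv
      simp only [Finset.mem_filter, Finset.mem_univ, true_and] at hv
      simp only [Finset.mem_map, Finset.mem_univ, true_and]
      exact ⟨⟨v.1, by omega⟩, by ext; simp⟩
    simpa using Finset.card_le_card hs
  · rw [plant_postCov_eq huv (a := a) (c := ⟨k.1, by omega⟩) ?_ hu hv ?_ ?_]
    · exact hk
    · simp only [ha, ne_eq, Fin.mk.injEq]; omega
    · simp only [ha, Finset.mem_filter, Finset.mem_univ, true_and]; omega
    · simp

lemma abs_postCov_le (h : Chan w b κ ε) {U : Finset (Fin n)} (u v : Fin n) (g : VPair n → Bool)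
    (y : Fin n → Bool) :
    |postCov n b U (fun x => chi (x u)) (fun x => chi (x v)) g y| ≤ 2 := by
  have h1 := abs_postAvg_le_one (U := U) h (φ := fun x => chi (x u) * chi (x v))
    (fun x => by rw [abs_mul, abs_chi, abs_chi, one_mul]) g y
  have h2 := abs_postAvg_le_one (U := U) h (φ := fun x => chi (x u)) (fun x => (abs_chi _).le) g y
  have h3 := abs_postAvg_le_one (U := U) h (φ := fun x => chi (x v)) (fun x => (abs_chi _).le) g y
  unfold postCov
  refine (abs_sub _ _).trans ?_
  rw [abs_mul]
  nlinarith [abs_nonneg (postAvg n b U (fun x => chi (x u)) g y),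
    abs_nonneg (postAvg n b U (fun x => chi (x v)) g y)]

/-- Indicator that the pair `u, v` is degenerate for the revealed set `U`. -/
noncomputable def degen (U : Finset (Fin n)) (u v : Fin n) : ℝ :=
  (if u = v then 1 else 0) + (if u ∈ U then 1 else 0) + (if v ∈ U then 1 else 0)

lemma degen_nonneg (U : Finset (Fin n)) (u v : Fin n) : 0 ≤ degen U u v := by
  unfold degen; positivity

lemma one_le_degen {U : Finset (Fin n)} {u v : Fin n} (hd : ¬(u ≠ v ∧ u ∉ U ∧ v ∉ U)) :
    1 ≤ degen U u v := by
  unfold degen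
  by_cases h1 : u = v <;> by_cases h2 : u ∈ U <;> by_cases h3 : v ∈ U <;> simp_all

lemma sum_degen (U : Finset (Fin n)) : ∑ u, ∑ v, degen U u v = n + 2 * n * U.card := by
  simp only [degen, Finset.sum_add_distrib, Finset.sum_ite_eq, Finset.mem_univ, if_true,
    Finset.sum_const, Finset.card_univ, Fintype.card_fin, nsmul_eq_mul, ← Finset.mul_sum,
    Finset.sum_boole, Finset.filter_mem_eq_inter, Finset.univ_inter, mul_one]
  ring

lemma plant_abs_postCov_le (h : Chan w b κ ε) {U : Finset (Fin n)} {δ : ℝ}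
    (hU : ∀ u v, u ≠ v → u ∉ U → v ∉ U →
      plant n w b U (fun g y => postCov n b U (fun x => chi (x u)) (fun x => chi (x v)) g y ^ 2) ≤ δ)
    (u v : Fin n) :
    plant n w b U (fun g y => |postCov n b U (fun x => chi (x u)) (fun x => chi (x v)) g y|) ≤
      √δ + 2 * degen U u v := by
  by_cases hd : u ≠ v ∧ u ∉ U ∧ v ∉ U
  · have h1 := plant_sqrt_le (U := U) h
      (fun g y => sq_nonneg (postCov n b U (fun x => chi (x u)) (fun x => chi (x v)) g y))
    simp only [Real.sqrt_sq_eq_abs] at h1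
    have := Real.sqrt_le_sqrt (hU u v hd.1 hd.2.1 hd.2.2)
    have := degen_nonneg U u v
    linarith
  · have h1 := plant_mono (U := U) h (fun g y => abs_postCov_le (U := U) h u v g y)
    rw [plant_const h] at h1
    have := one_le_degen hd
    have := Real.sqrt_nonneg δ
    linarith

lemma plant_sq_mul_sq_le (h : Chan w b κ ε) {U : Finset (Fin n)} {δ s : ℝ} (hs : 0 ≤ s)
    (hU : ∀ u v, u ≠ v → u ∉ U → v ∉ U →
      plant n w b U (fun g y => postCov n b U (fun x => chi (x u)) (fun x => chi (x v)) g y ^ 2) ≤ δ)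
    (hov : ∀ u v, u ≠ v → u ∉ U → v ∉ U → overlap n w b U (fun x => chi (x u) * chi (x v)) ≤ s)
    (u v : Fin n) :
    plant n w b U (fun g y => postAvg n b U (fun x => chi (x u)) g y ^ 2 *
      postAvg n b U (fun x => chi (x v)) g y ^ 2) ≤ s + 2 * √δ + degen U u v := by
  have h2 := fun g y => abs_le.1 (abs_postAvg_le_one (U := U) h (φ := fun x => chi (x u))
    (fun x => (abs_chi _).le) g y)
  have h3 := fun g y => abs_le.1 (abs_postAvg_le_one (U := U) h (φ := fun x => chi (x v))
    (fun x => (abs_chi _).le) g y)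
  have h2' : ∀ g y, postAvg n b U (fun x => chi (x u)) g y ^ 2 ≤ 1 := fun g y => by
    nlinarith [h2 g y]
  have h3' : ∀ g y, postAvg n b U (fun x => chi (x v)) g y ^ 2 ≤ 1 := fun g y => by
    nlinarith [h3 g y]
  by_cases hd : u ≠ v ∧ u ∉ U ∧ v ∉ U
  · have h1 := plant_abs_postCov_le h hU u v
    have hd0 : degen U u v = 0 := by simp [degen, hd.1, hd.2.1, hd.2.2]
    have hle : ∀ g y, postAvg n b U (fun x => chi (x u)) g y ^ 2 *
        postAvg n b U (fun x => chi (x v)) g y ^ 2 ≤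
        postAvg n b U (fun x => chi (x u) * chi (x v)) g y ^ 2 +
        2 * |postCov n b U (fun x => chi (x u)) (fun x => chi (x v)) g y| := by
      intro g y
      have h4 := abs_postAvg_le_one (U := U) h (φ := fun x => chi (x u) * chi (x v))
        (fun x => by rw [abs_mul, abs_chi, abs_chi, one_mul]) g y
      have h5 : |postAvg n b U (fun x => chi (x u)) g y * postAvg n b U (fun x => chi (x v)) g y| ≤ 1 := by
        rw [abs_le_one_iff_mul_self_le_one]
        nlinarith [h2' g y, h3' g y, sq_nonneg (postAvg n b U (fun x => chi (x u)) g y),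
          sq_nonneg (postAvg n b U (fun x => chi (x v)) g y)]
      unfold postCov
      generalize postAvg n b U (fun x => chi (x u)) g y = A at *
      generalize postAvg n b U (fun x => chi (x v)) g y = B at *
      generalize postAvg n b U (fun x => chi (x u) * chi (x v)) g y = R at *
      have e : A ^ 2 * B ^ 2 = R ^ 2 - (R - A * B) * (R + A * B) := by ring
      have h6 : |(R - A * B) * (R + A * B)| ≤ |R - A * B| * 2 := by
        rw [abs_mul]
        exact mul_le_mul_of_nonneg_left ((abs_add_le _ _).trans (by linarith)) (abs_nonneg _)
      have := (abs_le.1 h6).1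
      rw [e]
      linarith
    refine (plant_mono h hle).trans ?_
    rw [plant_add, plant_const_mul]
    have := hov u v hd.1 hd.2.1 hd.2.2
    unfold overlap at this
    linarith
  · have h1 := plant_mono (U := U) (F := fun g y => postAvg n b U (fun x => chi (x u)) g y ^ 2 *
      postAvg n b U (fun x => chi (x v)) g y ^ 2) (G := fun _ _ => 1) h (fun g y => by
        have := mul_le_mul (h2' g y) (h3' g y) (sq_nonneg _) zero_le_one
        simpa using this)
    rw [plant_const h] at h1
    have := one_le_degen hd
    have := Real.sqrt_nonneg δ
    linarith

/-- The overlap of two labels is bounded by the scalar channel at an effective signal-to-noise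
ratio involving a pinned overlap that dominates it. -/
theorem exists_overlap_le {m : ℕ} (h : Chan w b κ ε) (hκ : 0 < κ) (K : ℕ) (hK1 : 1 ≤ K)
    (hK : K + 2 ≤ m) :
    ∃ s, overlap (m + 2) w b ∅ (fun x => chi (x 0) * chi (x 1)) ≤ s ∧ 0 ≤ s ∧ s ≤ 1 ∧
      s ≤ govl (κ * m * √(s + 2 * √(1 / K) + (2 * K + 1) / m)) ^ 2 + (12 * ε * κ * m + 3 * ε +
        3 * √(Real.exp (2 * κ * m) * (2 * κ * √(2 * (m ^ 2 * √(1 / K) + (4 * K + 2) * m)) +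
          8 * κ ^ 2 * m))) := by
  obtain ⟨U, hUc, hU⟩ := exists_pinning h K hK1 hK
  have hUc' : (U.card : ℝ) ≤ K := by exact_mod_cast hUc
  have hm : (0 : ℝ) < m := by exact_mod_cast (by omega : 0 < m)
  set s := overlap (m + 2) w b ((U.map (Fin.succEmb m)).map (Fin.succEmb (m + 1)))
    (fun x => chi (x 0) * chi (x 1)) with hs
  have hs0 : 0 ≤ s := overlap_nonneg h _
  have hs1 : s ≤ 1 := overlap_le_one h fun x => by rw [abs_mul, abs_chi, abs_chi, one_mul]
  refine ⟨s, overlap_empty_le h _ _, hs0, hs1, ?_⟩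
  have hov : ∀ u v, u ≠ v → u ∉ U → v ∉ U →
      overlap m w b U (fun x => chi (x u) * chi (x v)) ≤ s := by
    intro u v huv hu hv
    refine (overlap_le_succ h _ _).trans ((overlap_le_succ h _ _).trans (le_of_eq ?_))
    refine overlap_pair_eq (u := u.succ.succ) (v := v.succ.succ) ?_ ?_ ?_ ?_ ?_ ?_
    · simpa using huv
    · simp
    · simpa using hu
    · simpa using hv
    · simp
    · simp only [Finset.mem_map, Fin.coe_succEmb, not_exists, not_and]
      rintro x ⟨z, -, rfl⟩ hx
      exact Fin.succ_ne_zero z (Fin.succ_injective _ (hx.trans (by simp)))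
  have hse := hs.trans (overlap_add_two h U)
  clear_value s
  refine hse.le.trans ?_
  set δ : ℝ := 1 / K
  set V : (VPair m → Bool) → (Fin m → Bool) → ℝ := fun g y => ∑ u, ∑ v,
    |postCov m b U (fun x => chi (x u)) (fun x => chi (x v)) g y| with hV
  set Γ : (VPair m → Bool) → (Fin m → Bool) → ℝ := fun g y =>
    ∑ v, postAvg m b U (fun x => chi (x v)) g y ^ 2 * κ with hΓ
  have hVn : ∀ g y, 0 ≤ V g y := fun g y =>
    Finset.sum_nonneg fun _ _ => Finset.sum_nonneg fun _ _ => abs_nonneg _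
  have hΓn : ∀ g y, 0 ≤ Γ g y := fun g y =>
    Finset.sum_nonneg fun _ _ => mul_nonneg (sq_nonneg _) hκ.le
  set A : ℝ := Real.exp (2 * κ * m)
  have hA : 0 < A := Real.exp_pos _
  have hcav := fun g y => cavity_le h (postWeight_nonneg h U g y) (sum_postWeight h U g y)
    (abs_pinSpin_le U y)
  simp only [spinMean_post, spinCov_post] at hcav
  have hEV : plant m w b U V ≤ m ^ 2 * √δ + (4 * K + 2) * m := by
    simp only [hV, plant_sum]
    refine (Finset.sum_le_sum fun u _ => Finset.sum_le_sum fun v _ =>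
      plant_abs_postCov_le h hU u v).trans ?_
    simp only [Finset.sum_add_distrib, ← Finset.mul_sum, sum_degen, Finset.sum_const,
      Finset.card_univ, Fintype.card_fin, nsmul_eq_mul]
    nlinarith
  have hEΓ : plant m w b U (fun g y => Γ g y ^ 2) ≤
      (κ * m * √(s + 2 * √δ + (2 * K + 1) / m)) ^ 2 := by
    have e : ∀ g y, Γ g y ^ 2 = κ ^ 2 * ∑ u, ∑ v, postAvg m b U (fun x => chi (x u)) g y ^ 2 *
        postAvg m b U (fun x => chi (x v)) g y ^ 2 := by
      intro g y
      simp only [hΓ, ← Finset.sum_mul, ← Finset.mul_sum]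
      ring
    simp only [e, plant_const_mul, plant_sum]
    rw [mul_pow, Real.sq_sqrt (by positivity), mul_pow, mul_assoc]
    refine mul_le_mul_of_nonneg_left ?_ (sq_nonneg κ)
    refine (Finset.sum_le_sum fun u _ => Finset.sum_le_sum fun v _ =>
      plant_sq_mul_sq_le h hs0 hU hov u v).trans ?_
    simp only [Finset.sum_add_distrib, ← Finset.mul_sum, sum_degen, Finset.sum_const,
      Finset.card_univ, Fintype.card_fin, nsmul_eq_mul]
    have : (m : ℝ) ^ 2 * ((2 * K + 1) / m) = (2 * K + 1) * m := by field_simp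
    nlinarith
  have hμ : 0 < κ * m * √(s + 2 * √δ + (2 * K + 1) / m) := by positivity
  refine (plant_mono h hcav).trans ?_
  simp only [plant_add, plant_const_mul, plant_const h]
  have h1 := plant_govl_sq_le h hΓn hμ hEΓ
  have h2 : plant m w b U (fun g y => √(A * (2 * κ * √(2 * V g y) + 8 * κ ^ 2 * m))) ≤
      √(A * (2 * κ * √(2 * (m ^ 2 * √δ + (4 * K + 2) * m)) + 8 * κ ^ 2 * m)) := by
    refine (plant_sqrt_le h fun g y => by positivity).trans (Real.sqrt_le_sqrt ?_)
    simp only [plant_add, plant_const_mul, plant_const h]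
    refine mul_le_mul_of_nonneg_left ?_ hA.le
    refine add_le_add_left (mul_le_mul_of_nonneg_left ?_ (by positivity)) _
    refine (plant_sqrt_le h fun g y => mul_nonneg zero_le_two (hVn g y)).trans
      (Real.sqrt_le_sqrt ?_)
    rw [plant_const_mul]
    linarith
  simp only [hΓ, hV] at h1 h2
  linarith

end Pinning

section FreeEnergy

variable {n : ℕ} {w b : Bool → ℝ} {κ ε : ℝ}

lemma Chan.scale_of_le (h : Chan w b κ ε) {τ : ℝ} (hτ : 0 ≤ τ) (hle : τ * ε ≤ 1 / 2) :
    Chan w (fun c => τ * b c) (τ ^ 2 * κ) (τ * ε) where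
  nonneg := h.nonneg
  sum_one := h.sum_one
  mean := by
    have : ∀ c, w c * (τ * b c) = τ * (w c * b c) := fun c => by ring
    simp only [this, ← Finset.mul_sum, h.mean, mul_zero]
  var := by
    have : ∀ c, w c * (τ * b c) ^ 2 = τ ^ 2 * (w c * b c ^ 2) := fun c => by ring
    simp only [this, ← Finset.mul_sum, h.var]
  bound := fun c => by
    rw [abs_mul, abs_of_nonneg hτ]
    exact mul_le_mul_of_nonneg_left (h.bound c) hτ
  le_half := hle

/-- Unnormalized posterior average of `φ` given the graph `g`. -/
noncomputable def moment (n : ℕ) (b : Bool → ℝ) (φ : (Fin n → Bool) → ℝ) (g : VPair n → Bool) : ℝ :=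
  pE half fun x : Fin n → Bool => lik n b x g * φ x

lemma postSum_empty (φ : (Fin n → Bool) → ℝ) (g : VPair n → Bool) (y : Fin n → Bool) :
    postSum n b ∅ φ g y = moment n b φ g := by
  simp only [postSum, moment, Finset.piecewise_empty]

lemma moment_one_pos (h : Chan w b κ ε) (g : VPair n → Bool) : 0 < moment n b (fun _ => 1) g :=
  pE_pos half_nonneg half_sum fun x => by simpa using lik_pos h x g

lemma overlap_empty (h : Chan w b κ ε) (φ : (Fin n → Bool) → ℝ) :
    overlap n w b ∅ φ = pE w fun g => moment n b φ g ^ 2 / moment n b (fun _ => 1) g := by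
  rw [overlap_eq h]
  simp only [postSum_empty, pE_const half_sum]

/-- Shrinking the perturbation decreases the overlap. -/
lemma overlap_scale_le (h : Chan w b κ ε) {η : ℝ} (hη0 : 0 ≤ η) (hη1 : η ≤ 1)
    (φ : (Fin n → Bool) → ℝ) :
    overlap n w (fun c => η * b c) ∅ φ ≤ overlap n w b ∅ φ := by
  have hη := h.scale (M := η) (by rwa [abs_of_nonneg hη0])
  rw [overlap_empty hη, overlap_empty h]
  set k : Bool → Bool → ℝ := fun c c' => η * (if c = c' then 1 else 0) + (1 - η) * w c' with hk
  have hk0 : ∀ c c', 0 ≤ k c c' := fun c c' => by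
    have := h.nonneg c'
    have : 0 ≤ 1 - η := by linarith
    simp only [hk]
    positivity
  set Kn : (VPair n → Bool) → (VPair n → Bool) → ℝ := fun g g' => ∏ e, k (g e) (g' e) with hKn
  have hK0 : ∀ g g', 0 ≤ Kn g g' := fun g g' => Finset.prod_nonneg fun _ _ => hk0 _ _
  have hlik : ∀ x g, lik n (fun c => η * b c) x g = ∑ g', Kn g g' * lik n b x g' := by
    intro x g
    simp only [lik, hKn, ← Finset.prod_mul_distrib]
    rw [← Fintype.piFinset_univ, ← Finset.prod_univ_sum (fun _ => Finset.univ)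
      (fun e c' => k (g e) c' * (1 + chi (x e.1.1) * chi (x e.1.2) * b c'))]
    refine Finset.prod_congr rfl fun e _ => ?_
    have h1 := h.sum_one
    have h2 := h.mean
    simp only [Fintype.sum_bool] at h1 h2 ⊢
    simp only [hk]
    generalize chi (x e.1.1) * chi (x e.1.2) = s
    cases g e <;> simp <;> linear_combination (-(1 - η)) * h1 - (1 - η) * s * h2
  have hmom : ∀ ψ g, moment n (fun c => η * b c) ψ g = ∑ g', Kn g g' * moment n b ψ g' := by
    intro ψ g
    simp only [moment, hlik, Finset.sum_mul, pE_sum, mul_assoc, pE_const_mul]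
  have hmass : ∀ F : (VPair n → Bool) → ℝ, pE w (fun g => ∑ g', Kn g g' * F g') = pE w F := by
    intro F
    simp only [pE, Finset.mul_sum]
    rw [Finset.sum_comm]
    refine Finset.sum_congr rfl fun g' _ => ?_
    simp only [← mul_assoc, ← Finset.sum_mul]
    congr 1
    simp only [hKn, ← Finset.prod_mul_distrib]
    rw [← Fintype.piFinset_univ, ← Finset.prod_univ_sum (fun _ => Finset.univ)
      (fun e c => w c * k c (g' e))]
    refine Finset.prod_congr rfl fun e _ => ?_
    have h1 := h.sum_one
    simp only [Fintype.sum_bool] at h1 ⊢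
    simp only [hk]
    cases g' e <;> simp
    · linear_combination ((1 - η) * w false) * h1
    · linear_combination ((1 - η) * w true) * h1
  rw [← hmass fun g => moment n b φ g ^ 2 / moment n b (fun _ => 1) g]
  refine pE_mono h.nonneg fun g => ?_
  have hZ := moment_one_pos hη g
  set r := moment n (fun c => η * b c) φ g / moment n (fun c => η * b c) (fun _ => 1) g with hr
  have e : moment n (fun c => η * b c) φ g ^ 2 / moment n (fun c => η * b c) (fun _ => 1) g =
      2 * r * moment n (fun c => η * b c) φ g -
        r ^ 2 * moment n (fun c => η * b c) (fun _ => 1) g := by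
    rw [hr]; field_simp; ring
  rw [e, hmom, hmom, Finset.mul_sum, Finset.mul_sum, ← Finset.sum_sub_distrib]
  refine Finset.sum_le_sum fun g' _ => ?_
  have h1 : 2 * r * moment n b φ g' - r ^ 2 * moment n b (fun _ => 1) g' ≤
      moment n b φ g' ^ 2 / moment n b (fun _ => 1) g' := by
    rw [le_div_iff₀ (moment_one_pos h g')]
    nlinarith [sq_nonneg (moment n b φ g' - r * moment n b (fun _ => 1) g')]
  have := mul_le_mul_of_nonneg_left h1 (hK0 g g')
  linarith

/-- Relative entropy of the planted model with respect to the null model. -/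
noncomputable def free (n : ℕ) (w b : Bool → ℝ) : ℝ :=
  pE w fun g : VPair n → Bool => moment n b (fun _ => 1) g * Real.log (moment n b (fun _ => 1) g)

lemma mul_log_bounds {u v : ℝ} {a : ℝ} (ha : 0 ≤ a) (hu : |u| ≤ 1 / 2) (hv : v * a = u) {δ : ℝ}
    (hδ : |u| ≤ δ) :
    0 ≤ v * Real.log (1 + u) ∧ v * Real.log (1 + u) ≤ (1 + 2 * δ) * (v ^ 2 * a) := by
  have hu' := abs_le.1 hu
  have hp : 0 < 1 + u := by linarith
  have h1 := Real.log_le_sub_one_of_pos hp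
  have h2 := Real.one_sub_inv_le_log_of_pos hp
  have h3 : u - 2 * u ^ 2 ≤ 1 - (1 + u)⁻¹ := by
    rw [← sub_nonneg]
    have : 1 - (1 + u)⁻¹ - (u - 2 * u ^ 2) = u ^ 2 * (1 + 2 * u) / (1 + u) := by
      field_simp; ring
    rw [this]
    exact div_nonneg (mul_nonneg (sq_nonneg _) (by linarith)) hp.le
  have h4 : 1 - (1 + u)⁻¹ = u / (1 + u) := by field_simp; ring
  rcases le_or_gt 0 v with hv0 | hv0
  · have hu0 : 0 ≤ u := by rw [← hv]; positivity
    have : 0 ≤ u / (1 + u) := by positivity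
    refine ⟨mul_nonneg hv0 (by linarith), ?_⟩
    have : 0 ≤ δ * (v * u) := mul_nonneg ((abs_nonneg u).trans hδ) (mul_nonneg hv0 hu0)
    have e : v ^ 2 * a = v * u := by rw [← hv]; ring
    rw [e]
    nlinarith
  · have hu0 : u ≤ 0 := by rw [← hv]; exact mul_nonpos_of_nonpos_of_nonneg hv0.le ha
    rw [abs_of_nonpos hu0] at hδ
    refine ⟨mul_nonneg_of_nonpos_of_nonpos hv0.le (by linarith), ?_⟩
    have e : v ^ 2 * a = v * u := by rw [← hv]; ring
    rw [e]
    have h5 : v * Real.log (1 + u) ≤ v * (u - 2 * u ^ 2) :=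
      mul_le_mul_of_nonpos_left (by linarith) hv0.le
    have h6 : 0 ≤ v * u := mul_nonneg_of_nonpos_of_nonpos hv0.le hu0
    nlinarith

lemma edge_log_bounds (h : Chan w b κ ε) {τ : ℝ} (hτ : 0 ≤ τ) (hle : τ * ε ≤ 1 / 2) {A B : ℝ}
    (hA : 0 < A) (hB : |B| ≤ A) :
    0 ≤ ∑ c, w c * (b c * B * (Real.log (A + τ * b c * B) + 1)) ∧
    ∑ c, w c * (b c * B * (Real.log (A + τ * b c * B) + 1)) ≤
      (1 + 2 * (τ * ε)) * (τ * κ) *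
        ∑ c, w c * ((B + τ * b c * A) ^ 2 / (A + τ * b c * B)) := by
  have hτb : ∀ c, |τ * b c| ≤ τ * ε := fun c => by
    rw [abs_mul, abs_of_nonneg hτ]
    exact mul_le_mul_of_nonneg_left (h.bound c) hτ
  have hBA : |B / A| ≤ 1 := by rw [abs_div, abs_of_pos hA, div_le_one hA]; exact hB
  have hu : ∀ c, |τ * b c * (B / A)| ≤ τ * ε := fun c => by
    rw [abs_mul]
    exact (mul_le_of_le_one_right (abs_nonneg _) hBA).trans (hτb c)
  have hpos : ∀ c, 0 < 1 + τ * b c * (B / A) := fun c => by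
    have := (abs_le.1 ((hu c).trans hle)).1
    linarith
  have hZ : ∀ c, A + τ * b c * B = A * (1 + τ * b c * (B / A)) := fun c => by field_simp
  have hsum : ∑ c, w c * (b c * B * (Real.log (A + τ * b c * B) + 1)) =
      A * ∑ c, w c * (b c * (B / A) * Real.log (1 + τ * b c * (B / A))) := by
    have e : ∀ c, w c * (b c * B * (Real.log (A + τ * b c * B) + 1)) =
        A * (w c * (b c * (B / A) * Real.log (1 + τ * b c * (B / A)))) +
          B * (Real.log A + 1) * (w c * b c) := fun c => by
      rw [hZ c, Real.log_mul hA.ne' (hpos c).ne']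
      field_simp
      ring
    simp only [e, Finset.sum_add_distrib, ← Finset.mul_sum, h.mean]
    ring
  have hb := fun c => mul_log_bounds (u := τ * b c * (B / A)) (v := b c * (B / A)) hτ
    ((hu c).trans hle) (by ring) (hu c)
  rw [hsum]
  refine ⟨mul_nonneg hA.le (Finset.sum_nonneg fun c _ => mul_nonneg (h.nonneg c) (hb c).1), ?_⟩
  have hmean : ∑ c, w c * (2 * (B / A) * (B + τ * b c * A) - (B / A) ^ 2 * (A + τ * b c * B)) =
      B ^ 2 / A := by
    have e : ∀ c, w c * (2 * (B / A) * (B + τ * b c * A) - (B / A) ^ 2 * (A + τ * b c * B)) =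
        B ^ 2 / A * w c + (2 * (B / A) * τ * A - (B / A) ^ 2 * τ * B) * (w c * b c) := fun c => by
      field_simp
      ring
    simp only [e, Finset.sum_add_distrib, ← Finset.mul_sum, h.mean, h.sum_one]
    ring
  have hsed : B ^ 2 / A ≤ ∑ c, w c * ((B + τ * b c * A) ^ 2 / (A + τ * b c * B)) := by
    rw [← hmean]
    refine Finset.sum_le_sum fun c _ => mul_le_mul_of_nonneg_left ?_ (h.nonneg c)
    have hp : 0 < A + τ * b c * B := by rw [hZ]; exact mul_pos hA (hpos c)
    rw [le_div_iff₀ hp]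
    nlinarith [sq_nonneg (B + τ * b c * A - B / A * (A + τ * b c * B))]
  have h1 : A * ∑ c, w c * (b c * (B / A) * Real.log (1 + τ * b c * (B / A))) ≤
      (1 + 2 * (τ * ε)) * (τ * κ) * (B ^ 2 / A) := by
    have : ∑ c, w c * (b c * (B / A) * Real.log (1 + τ * b c * (B / A))) ≤
        ∑ c, (1 + 2 * (τ * ε)) * τ * (B / A) ^ 2 * (w c * b c ^ 2) := by
      refine Finset.sum_le_sum fun c _ => ?_
      have := mul_le_mul_of_nonneg_left (hb c).2 (h.nonneg c)
      linarith
    rw [← Finset.mul_sum, h.var] at this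
    refine (mul_le_mul_of_nonneg_left this hA.le).trans (le_of_eq ?_)
    field_simp
  refine h1.trans (mul_le_mul_of_nonneg_left hsed ?_)
  have := h.eps_nonneg
  have := h.var_nonneg
  positivity

/-- Likelihood ratio with the pair `e` removed. -/
noncomputable def likErase (n : ℕ) (b : Bool → ℝ) (e : VPair n) (x : Fin n → Bool)
    (g : VPair n → Bool) : ℝ :=
  ∏ f ∈ Finset.univ.erase e, (1 + chi (x f.1.1) * chi (x f.1.2) * b (g f))

lemma likErase_update (e : VPair n) (x : Fin n → Bool) (g : VPair n → Bool) (c : Bool) :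
    likErase n b e x (Function.update g e c) = likErase n b e x g :=
  Finset.prod_congr rfl fun f hf => by rw [Function.update_of_ne (Finset.ne_of_mem_erase hf)]

lemma lik_eq_mul_likErase (e : VPair n) (x : Fin n → Bool) (g : VPair n → Bool) :
    lik n b x g = (1 + chi (x e.1.1) * chi (x e.1.2) * b (g e)) * likErase n b e x g :=
  (Finset.mul_prod_erase _ _ (Finset.mem_univ e)).symm

lemma likErase_pos (h : Chan w b κ ε) (e : VPair n) (x : Fin n → Bool) (g : VPair n → Bool) :
    0 < likErase n b e x g := by
  refine Finset.prod_pos fun e _ => ?_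
  have h1 := (h.bound (g e)).trans h.le_half
  rw [abs_le] at h1
  cases x e.1.1 <;> cases x e.1.2 <;> simp [chi] <;> linarith

lemma hasDerivAt_moment_one (τ : ℝ) (g : VPair n → Bool) :
    HasDerivAt (fun τ => moment n (fun c => τ * b c) (fun _ => 1) g)
      (∑ e, b (g e) * pE half fun x : Fin n → Bool =>
        chi (x e.1.1) * chi (x e.1.2) * likErase n (fun c => τ * b c) e x g) τ := by
  simp only [← pE_const_mul, ← pE_sum]
  unfold moment pE
  refine HasDerivAt.fun_sum fun x _ => HasDerivAt.const_mul _ ?_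
  simp only [mul_one]
  unfold lik
  refine (HasDerivAt.fun_finsetProd (u := Finset.univ)
    (f' := fun e : VPair n => chi (x e.1.1) * chi (x e.1.2) * b (g e))
    fun e _ => ?_).congr_deriv ?_
  · exact ((((hasDerivAt_id τ).mul_const (b (g e))).const_mul
      (chi (x e.1.1) * chi (x e.1.2))).const_add 1).congr_deriv (by ring)
  · refine Finset.sum_congr rfl fun e _ => ?_
    simp only [likErase, smul_eq_mul]
    ring

/-- Derivative of the relative entropy in the perturbation strength. -/
noncomputable def freeDeriv (n : ℕ) (w b : Bool → ℝ) (τ : ℝ) : ℝ :=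
  ∑ e : VPair n, pE w fun g => b (g e) * (pE half fun x : Fin n → Bool =>
    chi (x e.1.1) * chi (x e.1.2) * likErase n (fun c => τ * b c) e x g) *
      (Real.log (moment n (fun c => τ * b c) (fun _ => 1) g) + 1)

lemma hasDerivAt_free (h : Chan w b κ ε) {τ : ℝ} (hτ : 0 ≤ τ) (hle : τ * ε ≤ 1 / 2) :
    HasDerivAt (fun τ => free n w fun c => τ * b c) (freeDeriv n w b τ) τ := by
  unfold freeDeriv
  rw [← pE_sum]
  unfold free
  have hZ := fun g => (moment_one_pos (n := n) (h.scale_of_le hτ hle) g).ne'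
  show HasDerivAt (fun τ => ∑ g : VPair n → Bool, (∏ i, w (g i)) *
    (moment n (fun c => τ * b c) (fun _ => 1) g *
      Real.log (moment n (fun c => τ * b c) (fun _ => 1) g))) _ τ
  refine HasDerivAt.fun_sum fun g _ => HasDerivAt.const_mul _ ?_
  have hd := hasDerivAt_moment_one (b := b) τ g
  refine (hd.mul (hd.log (hZ g))).congr_deriv ?_
  beta_reduce
  rw [← Finset.sum_mul]
  have := hZ g
  field_simp

lemma freeDeriv_bounds (h : Chan w b κ ε) {τ : ℝ} (hτ : 0 ≤ τ) (hle : τ * ε ≤ 1 / 2) :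
    0 ≤ freeDeriv n w b τ ∧ freeDeriv n w b τ ≤ (1 + 2 * (τ * ε)) * (τ * κ) *
      ∑ e : VPair n, overlap n w (fun c => τ * b c) ∅ fun x => chi (x e.1.1) * chi (x e.1.2) := by
  have hs := h.scale_of_le hτ hle
  have key : ∀ e : VPair n,
      0 ≤ (pE w fun g => b (g e) * (pE half fun x : Fin n → Bool =>
        chi (x e.1.1) * chi (x e.1.2) * likErase n (fun c => τ * b c) e x g) *
        (Real.log (moment n (fun c => τ * b c) (fun _ => 1) g) + 1)) ∧
      (pE w fun g => b (g e) * (pE half fun x : Fin n → Bool =>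
        chi (x e.1.1) * chi (x e.1.2) * likErase n (fun c => τ * b c) e x g) *
        (Real.log (moment n (fun c => τ * b c) (fun _ => 1) g) + 1)) ≤
      (1 + 2 * (τ * ε)) * (τ * κ) *
        overlap n w (fun c => τ * b c) ∅ fun x => chi (x e.1.1) * chi (x e.1.2) := by
    intro e
    set A : (VPair n → Bool) → ℝ := fun g => pE half fun x : Fin n → Bool =>
      likErase n (fun c => τ * b c) e x g with hA
    set B : (VPair n → Bool) → ℝ := fun g => pE half fun x : Fin n → Bool =>
      chi (x e.1.1) * chi (x e.1.2) * likErase n (fun c => τ * b c) e x g with hB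
    have hAu : ∀ g c, A (Function.update g e c) = A g := fun g c => by
      simp only [hA, likErase_update]
    have hBu : ∀ g c, B (Function.update g e c) = B g := fun g c => by
      simp only [hB, likErase_update]
    have hAp : ∀ g, 0 < A g := fun g => pE_pos half_nonneg half_sum fun x => likErase_pos hs e x g
    have hBA : ∀ g, |B g| ≤ A g := fun g => by
      have : ∀ x : Fin n → Bool, |chi (x e.1.1) * chi (x e.1.2)| ≤ 1 := fun x => by
        rw [abs_mul, abs_chi, abs_chi, one_mul]
      rw [abs_le]
      constructor
      · simp only [hA, hB, ← pE_neg]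
        refine pE_mono half_nonneg fun x => ?_
        nlinarith [likErase_pos hs e x g, (abs_le.1 (this x)).1]
      · refine pE_mono half_nonneg fun x => ?_
        nlinarith [likErase_pos hs e x g, (abs_le.1 (this x)).2]
    have hZ : ∀ g, moment n (fun c => τ * b c) (fun _ => 1) g = A g + τ * b (g e) * B g := by
      intro g
      simp only [hA, hB, moment, ← pE_const_mul, ← pE_add, lik_eq_mul_likErase e]
      congr 1; ext x; ring
    have hN : ∀ g, moment n (fun c => τ * b c) (fun x => chi (x e.1.1) * chi (x e.1.2)) g =
        B g + τ * b (g e) * A g := by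
      intro g
      simp only [hA, hB, moment, ← pE_const_mul, ← pE_add, lik_eq_mul_likErase e]
      congr 1; ext x
      have h1 := chi_sq (x e.1.1)
      have h2 := chi_sq (x e.1.2)
      linear_combination (τ * b (g e) * likErase n (fun c => τ * b c) e x g) *
        (chi (x e.1.2) * chi (x e.1.2) * h1 + h2)
    rw [overlap_empty hs]
    change 0 ≤ (pE w fun g => b (g e) * B g *
      (Real.log (moment n (fun c => τ * b c) (fun _ => 1) g) + 1)) ∧
      (pE w fun g => b (g e) * B g *
        (Real.log (moment n (fun c => τ * b c) (fun _ => 1) g) + 1)) ≤ _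
    simp only [hZ, hN]
    rw [← pE_update h.sum_one e]
    rw [← pE_update h.sum_one e (fun g => (B g + τ * b (g e) * A g) ^ 2 /
      (A g + τ * b (g e) * B g)), ← pE_const_mul]
    simp only [hAu, hBu, Function.update_self]
    have hl := fun g => edge_log_bounds h hτ hle (hAp g) (hBA g)
    exact ⟨pE_nonneg h.nonneg fun g => (hl g).1, pE_mono h.nonneg fun g => (hl g).2⟩
  unfold freeDeriv
  rw [Finset.mul_sum]
  exact ⟨Finset.sum_nonneg fun e _ => (key e).1, Finset.sum_le_sum fun e _ => (key e).2⟩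

lemma card_vpair (n : ℕ) : (Fintype.card (VPair n) : ℝ) = n * (n - 1) / 2 := by
  induction n with
  | zero => simp
  | succ n ih =>
    rw [← Fintype.card_congr (pairSucc n), Fintype.card_sum, Fintype.card_fin]
    push_cast
    rw [ih]
    ring

/-- Overlap of two labels given the graph. -/
noncomputable def pairOverlap (n : ℕ) (w b : Bool → ℝ) : ℝ :=
  overlap (n + 2) w b ∅ fun x => chi (x 0) * chi (x 1)

lemma overlap_eq_pairOverlap {u v : Fin (n + 2)} (huv : u ≠ v) :
    overlap (n + 2) w b ∅ (fun x => chi (x u) * chi (x v)) = pairOverlap n w b :=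
  overlap_pair_eq huv (by simp) (by simp) (by simp) (by simp) (by simp)

lemma pairOverlap_nonneg (h : Chan w b κ ε) : 0 ≤ pairOverlap n w b := overlap_nonneg h _

lemma pairOverlap_le_one (h : Chan w b κ ε) : pairOverlap n w b ≤ 1 :=
  overlap_le_one h fun x => by rw [abs_mul, abs_chi, abs_chi, one_mul]

lemma pairOverlap_mono (h : Chan w b κ ε) {s t : ℝ} (hs : 0 ≤ s) (hst : s ≤ t)
    (ht : t * ε ≤ 1 / 2) :
    pairOverlap n w (fun c => s * b c) ≤ pairOverlap n w (fun c => t * b c) := by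
  rcases hs.eq_or_lt with rfl | hs0
  · have := overlap_scale_le (n := n + 2) (h.scale_of_le hst ht) le_rfl zero_le_one
      (fun x => chi (x 0) * chi (x 1))
    simpa only [zero_mul, pairOverlap] using this
  · have ht0 := hs0.trans_le hst
    have := overlap_scale_le (n := n + 2) (h.scale_of_le ht0.le ht) (η := s / t) (by positivity)
      ((div_le_one ht0).2 hst) (fun x => chi (x 0) * chi (x 1))
    simpa only [pairOverlap, ← mul_assoc, div_mul_cancel₀ _ ht0.ne'] using this

/-- Increments of the relative entropy are controlled by the overlap. -/
lemma free_sub_bounds (h : Chan w b κ ε) {s t : ℝ} (hs : 0 ≤ s) (hst : s ≤ t)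
    (ht : t * ε ≤ 1 / 2) :
    0 ≤ free (n + 2) w (fun c => t * b c) - free (n + 2) w (fun c => s * b c) ∧
    free (n + 2) w (fun c => t * b c) - free (n + 2) w (fun c => s * b c) ≤
      (1 + 2 * (t * ε)) * κ * ((n + 2) * (n + 1) / 2) * pairOverlap n w (fun c => t * b c) *
        ((t ^ 2 - s ^ 2) / 2) := by
  have hε := h.eps_nonneg
  have hκ := h.var_nonneg
  have hle : ∀ τ ∈ Set.Icc s t, τ * ε ≤ 1 / 2 := fun τ hτ =>
    (mul_le_mul_of_nonneg_right hτ.2 hε).trans ht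
  have hder : ∀ τ ∈ Set.Icc s t, HasDerivAt (fun τ => free (n + 2) w fun c => τ * b c)
      (freeDeriv (n + 2) w b τ) τ := fun τ hτ => hasDerivAt_free h (hs.trans hτ.1) (hle τ hτ)
  set C : ℝ := (1 + 2 * (t * ε)) * κ * ((n + 2) * (n + 1) / 2) *
    pairOverlap n w (fun c => t * b c) with hC
  have hbd : ∀ τ ∈ Set.Icc s t, 0 ≤ freeDeriv (n + 2) w b τ ∧ freeDeriv (n + 2) w b τ ≤ C * τ := by
    intro τ hτ
    have hτ0 := hs.trans hτ.1
    have h1 := freeDeriv_bounds (n := n + 2) h hτ0 (hle τ hτ)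
    refine ⟨h1.1, h1.2.trans ?_⟩
    have e : ∑ e : VPair (n + 2), overlap (n + 2) w (fun c => τ * b c) ∅
        (fun x => chi (x e.1.1) * chi (x e.1.2)) =
        (n + 2) * (n + 1) / 2 * pairOverlap n w (fun c => τ * b c) := by
      rw [Finset.sum_congr rfl fun e _ => overlap_eq_pairOverlap e.2.ne, Finset.sum_const,
        Finset.card_univ, nsmul_eq_mul, card_vpair]
      push_cast
      ring
    rw [e]
    have h2 := pairOverlap_mono (n := n) h hτ0 hτ.2 ht
    have h3 := pairOverlap_nonneg (n := n) (h.scale_of_le hτ0 (hle τ hτ))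
    have h4 : (1 + 2 * (τ * ε)) ≤ (1 + 2 * (t * ε)) := by nlinarith [hτ.2]
    have h5 := mul_le_mul h4 h2 h3 (by have := hs.trans hst; positivity)
    have h6 : 0 ≤ τ * κ * ((n + 2) * (n + 1) / 2) := by positivity
    have := mul_le_mul_of_nonneg_left h5 h6
    rw [hC]
    linarith
  constructor
  · have := monotoneOn_of_deriv_nonneg (convex_Icc s t)
      (fun τ hτ => (hder τ hτ).continuousAt.continuousWithinAt)
      (fun τ hτ => (hder τ (interior_subset hτ)).differentiableAt.differentiableWithinAt)
      (fun τ hτ => by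
        rw [(hder τ (interior_subset hτ)).deriv]
        exact (hbd τ (interior_subset hτ)).1)
      (Set.left_mem_Icc.2 hst) (Set.right_mem_Icc.2 hst) hst
    simp only at this
    linarith
  · have hder' : ∀ τ ∈ Set.Icc s t,
        HasDerivAt (fun τ => free (n + 2) w (fun c => τ * b c) - C * (τ ^ 2 / 2))
          (freeDeriv (n + 2) w b τ - C * τ) τ := fun τ hτ =>
      ((hder τ hτ).sub (((hasDerivAt_pow 2 τ).div_const 2).const_mul C)).congr_deriv
        (by push_cast; ring)
    have := antitoneOn_of_deriv_nonpos (convex_Icc s t)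
      (fun τ hτ => (hder' τ hτ).continuousAt.continuousWithinAt)
      (fun τ hτ => (hder' τ (interior_subset hτ)).differentiableAt.differentiableWithinAt)
      (fun τ hτ => by
        rw [(hder' τ (interior_subset hτ)).deriv]
        linarith [(hbd τ (interior_subset hτ)).2])
      (Set.left_mem_Icc.2 hst) (Set.right_mem_Icc.2 hst) hst
    simp only at this
    linarith

lemma free_zero (hw : ∑ c, w c = 1) : free n w (fun _ => 0) = 0 := by
  simp [free, moment, lik, pE_const half_sum, pE_const hw]

end FreeEnergy

section Information

variable {n : ℕ} {w b : Bool → ℝ} {κ ε : ℝ}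

/-- Mutual information between labels and graph. -/
noncomputable def info (n : ℕ) (w b : Bool → ℝ) : ℝ :=
  pE half fun x : Fin n → Bool => pE w fun g : VPair n → Bool =>
    lik n b x g * Real.log (lik n b x g / moment n b (fun _ => 1) g)

lemma abs_mul_log_sub_le {u : ℝ} (hu : |u| ≤ 1 / 2) :
    |(1 + u) * Real.log (1 + u) - u - u ^ 2 / 2| ≤ 4 * |u| ^ 3 := by
  have h := Real.abs_log_sub_add_sum_range_le (x := -u) (by rw [abs_neg]; linarith) 2
  simp only [Finset.sum_range_succ, Finset.sum_range_zero, abs_neg, sub_neg_eq_add] at h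
  have h1 : |u| ^ (2 + 1) / (1 - |u|) ≤ 2 * |u| ^ 3 := by
    rw [div_le_iff₀ (by linarith)]
    have h3 : 0 ≤ |u| ^ 3 := by positivity
    have h4 := mul_nonneg h3 (sub_nonneg.2 hu)
    rw [show 2 + 1 = 3 from rfl]
    linarith
  set r := 0 + (-u) ^ (0 + 1) / ((0 : ℕ) + 1) + (-u) ^ (1 + 1) / ((1 : ℕ) + 1) + Real.log (1 + u) with hr
  have h2 := h.trans h1
  have e : (1 + u) * Real.log (1 + u) - u - u ^ 2 / 2 = -(u ^ 3) / 2 + (1 + u) * r := by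
    rw [hr]; push_cast; ring
  rw [e]
  have h3 : |1 + u| ≤ 3 / 2 := by
    have := abs_le.1 hu
    rw [abs_le]; constructor <;> linarith
  refine (abs_add_le _ _).trans ?_
  rw [abs_div, abs_neg, abs_pow, abs_mul, abs_two]
  have h4 := mul_le_mul h3 h2 (abs_nonneg _) (by norm_num)
  have : 0 ≤ |u| ^ 3 := by positivity
  linarith

lemma pE_likErase (h : Chan w b κ ε) (e : VPair n) (x : Fin n → Bool) :
    pE w (likErase n b e x) = 1 := by
  rw [← pE_lik h x, ← pE_update h.sum_one e (lik n b x)]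
  congr 1; ext g
  have h1 := h.sum_one
  have h2 := h.mean
  simp only [lik_eq_mul_likErase e, likErase_update, Function.update_self]
  simp only [Fintype.sum_bool] at h1 h2 ⊢
  linear_combination (-likErase n b e x g) * h1 -
    likErase n b e x g * (chi (x e.1.1) * chi (x e.1.2)) * h2

lemma abs_pE_lik_log_sub_le (h : Chan w b κ ε) (x : Fin n → Bool) :
    |pE w (fun g => lik n b x g * Real.log (lik n b x g)) - Fintype.card (VPair n) * (κ / 2)| ≤
      Fintype.card (VPair n) * (4 * ε * κ) := by
  have hf : ∀ (e : VPair n) c, |chi (x e.1.1) * chi (x e.1.2) * b c| ≤ ε := fun e c => by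
    rw [abs_mul, abs_mul, abs_chi, abs_chi, one_mul, one_mul]; exact h.bound c
  have hlog : ∀ g, lik n b x g * Real.log (lik n b x g) = ∑ e : VPair n, lik n b x g *
      Real.log (1 + chi (x e.1.1) * chi (x e.1.2) * b (g e)) := by
    intro g
    rw [← Finset.mul_sum, ← Real.log_prod]
    · rfl
    · intro e _
      have := (abs_le.1 ((hf e (g e)).trans h.le_half)).1
      linarith
  have hedge : ∀ e : VPair n, pE w (fun g => lik n b x g *
      Real.log (1 + chi (x e.1.1) * chi (x e.1.2) * b (g e))) =
      ∑ c, w c * ((1 + chi (x e.1.1) * chi (x e.1.2) * b c) *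
        Real.log (1 + chi (x e.1.1) * chi (x e.1.2) * b c)) := by
    intro e
    rw [← pE_update h.sum_one e]
    simp only [lik_eq_mul_likErase e, likErase_update, Function.update_self]
    rw [← mul_one (∑ c, w c * ((1 + chi (x e.1.1) * chi (x e.1.2) * b c) *
        Real.log (1 + chi (x e.1.1) * chi (x e.1.2) * b c))), ← pE_likErase h e x, ← pE_const_mul]
    congr 1; ext g
    rw [Finset.sum_mul]
    exact Finset.sum_congr rfl fun c _ => by ring
  simp only [hlog, pE_sum, hedge]
  have hc : ∀ a : ℝ, (Fintype.card (VPair n) : ℝ) * a = ∑ _e : VPair n, a := fun a => by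
    rw [Finset.sum_const, Finset.card_univ, nsmul_eq_mul]
  rw [hc, hc, ← Finset.sum_sub_distrib]
  refine (Finset.abs_sum_le_sum_abs _ _).trans (Finset.sum_le_sum fun e _ => ?_)
  set s := chi (x e.1.1) * chi (x e.1.2) with hs
  have hs2 : s ^ 2 = 1 := by
    have h1 := chi_sq (x e.1.1)
    have h2 := chi_sq (x e.1.2)
    rw [hs]; linear_combination chi (x e.1.2) * chi (x e.1.2) * h1 + h2
  have e1 : ∑ c, w c * ((1 + s * b c) * Real.log (1 + s * b c)) - κ / 2 =
      ∑ c, w c * ((1 + s * b c) * Real.log (1 + s * b c) - s * b c - (s * b c) ^ 2 / 2) := by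
    have e2 : ∀ c, w c * ((1 + s * b c) * Real.log (1 + s * b c) - s * b c - (s * b c) ^ 2 / 2) =
        w c * ((1 + s * b c) * Real.log (1 + s * b c)) - s * (w c * b c) -
          1 / 2 * (w c * b c ^ 2) := fun c => by
      rw [mul_pow, hs2]; ring
    simp only [e2, Finset.sum_sub_distrib, ← Finset.mul_sum, h.mean, h.var]
    ring
  rw [e1]
  have e3 : 4 * ε * κ = ∑ c, w c * (4 * ε * b c ^ 2) := by
    have : ∀ c, w c * (4 * ε * b c ^ 2) = 4 * ε * (w c * b c ^ 2) := fun c => by ring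
    simp only [this, ← Finset.mul_sum, h.var]
  rw [e3]
  refine (Finset.abs_sum_le_sum_abs _ _).trans (Finset.sum_le_sum fun c _ => ?_)
  rw [abs_mul, abs_of_nonneg (h.nonneg c)]
  refine mul_le_mul_of_nonneg_left ?_ (h.nonneg c)
  refine (abs_mul_log_sub_le ((hf e c).trans h.le_half)).trans ?_
  have h1 : |s * b c| ^ 2 = b c ^ 2 := by rw [sq_abs, mul_pow, hs2, one_mul]
  rw [pow_succ, h1]
  nlinarith [hf e c, sq_nonneg (b c)]

lemma info_eq (h : Chan w b κ ε) : info n w b =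
    (pE half fun x : Fin n → Bool => pE w fun g : VPair n → Bool =>
      lik n b x g * Real.log (lik n b x g)) - free n w b := by
  have e : ∀ (x : Fin n → Bool) g, lik n b x g * Real.log (lik n b x g / moment n b (fun _ => 1) g) =
      lik n b x g * Real.log (lik n b x g) -
        lik n b x g * Real.log (moment n b (fun _ => 1) g) := fun x g => by
    rw [Real.log_div (lik_pos h x g).ne' (moment_one_pos h g).ne', mul_sub]
  simp only [info, e, pE_sub]
  congr 1
  rw [pE_comm]
  simp only [pE_mul_const]
  simp only [free, moment, mul_one]

lemma abs_info_add_free_sub_le (h : Chan w b κ ε) :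
    |info n w b + free n w b - Fintype.card (VPair n) * (κ / 2)| ≤
      Fintype.card (VPair n) * (4 * ε * κ) := by
  rw [info_eq h, sub_add_cancel, ← pE_const (ι := Fin n) half_sum
    (Fintype.card (VPair n) * (κ / 2)), ← pE_sub, abs_le]
  have hb := fun x : Fin n → Bool => abs_le.1 (abs_pE_lik_log_sub_le h x)
  constructor
  · rw [← pE_const (ι := Fin n) half_sum (-(Fintype.card (VPair n) * (4 * ε * κ)))]
    exact pE_mono half_nonneg fun x => (hb x).1
  · refine (pE_mono half_nonneg fun x => (hb x).2).trans (le_of_eq ?_)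
    rw [pE_const half_sum]

lemma prod_half (x : Fin n → Bool) : ∏ i, half (x i) = (1 / 2) ^ n := by
  simp [half]

lemma info_le (h : Chan w b κ ε) : info n w b ≤ n * Real.log 2 := by
  have hle : ∀ (x : Fin n → Bool) g, Real.log (lik n b x g / moment n b (fun _ => 1) g) ≤
      n * Real.log 2 := by
    intro x g
    rw [← Real.log_pow]
    refine Real.log_le_log (div_pos (lik_pos h x g) (moment_one_pos h g)) ?_
    rw [div_le_iff₀ (moment_one_pos h g)]
    have : (1 / 2) ^ n * lik n b x g ≤ moment n b (fun _ => 1) g := by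
      unfold moment pE
      refine le_trans (le_of_eq ?_) (Finset.single_le_sum (f := fun x => (∏ i, half (x i)) *
        (lik n b x g * 1)) (fun x _ => ?_) (Finset.mem_univ x))
      · simp only [prod_half, mul_one]
      · simp only [prod_half, mul_one]
        exact mul_nonneg (by positivity) (lik_pos h x g).le
    have e : (2 : ℝ) ^ n * (1 / 2) ^ n = 1 := by rw [← mul_pow]; norm_num
    calc lik n b x g = 2 ^ n * ((1 / 2) ^ n * lik n b x g) := by rw [← mul_assoc, e, one_mul]
      _ ≤ _ := mul_le_mul_of_nonneg_left this (by positivity)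
  have : info n w b ≤ pE half fun x : Fin n → Bool => pE w fun g : VPair n → Bool =>
      lik n b x g * (n * Real.log 2) :=
    pE_mono half_nonneg fun x => pE_mono h.nonneg fun g =>
      mul_le_mul_of_nonneg_left (hle x g) (lik_pos h x g).le
  refine this.trans (le_of_eq ?_)
  simp only [pE_mul_const]
  simp only [pE_lik h, one_mul, pE_const half_sum]

end Information

section BlockModel

/-- Null edge distribution of the block model. -/
noncomputable def sbmW (p q : ℝ) : Bool → ℝ := fun c => if c then (p + q) / 2 else 1 - (p + q) / 2

/-- Relative perturbation of the edge distribution of the block model. -/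
noncomputable def sbmB (p q : ℝ) : Bool → ℝ := fun c =>
  if c then (p - q) / (p + q) else (q - p) / (2 * (1 - (p + q) / 2))

variable {n : ℕ} {p q : ℝ}

lemma chan_sbm (h0 : 0 < p + q) (h1 : 0 < 1 - (p + q) / 2) {ε : ℝ} (hε : ε ≤ 1 / 2)
    (hb : ∀ c, |sbmB p q c| ≤ ε) :
    Chan (sbmW p q) (sbmB p q) ((p - q) ^ 2 / (2 * (p + q) * (1 - (p + q) / 2))) ε where
  nonneg := fun c => by cases c <;> simp [sbmW] <;> linarith
  sum_one := by simp [sbmW]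
  mean := by
    simp only [sbmW, sbmB, Fintype.sum_bool, if_true, Bool.false_eq_true, if_false]
    have e : ∀ r a : ℝ, r ≠ 0 → r * (a / (2 * r)) = a / 2 := fun r a hr => by field_simp
    rw [e _ _ h1.ne']
    field_simp
    ring
  var := by
    simp only [sbmW, sbmB, Fintype.sum_bool, if_true, Bool.false_eq_true, if_false]
    generalize hr : 1 - (p + q) / 2 = r at *
    have : p + q = 2 - 2 * r := by linarith
    rw [this] at *
    have : 0 < 1 - r := by linarith
    have : 2 - 2 * r = 2 * (1 - r) := by ring
    rw [this]
    field_simp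
    ring
  bound := hb
  le_half := hε

lemma ssbm2Mass_eq (h0 : 0 < p + q) (h1 : 0 < 1 - (p + q) / 2) (x : Fin n → Bool)
    (g : VPair n → Bool) : ssbm2Mass n p q x g =
      (∏ i, half (x i)) * ((∏ e, sbmW p q (g e)) * lik n (sbmB p q) x g) := by
  rw [prod_half, ssbm2Mass, lik, ← Finset.prod_mul_distrib]
  congr 1
  refine Finset.prod_congr rfl fun e _ => ?_
  have hr : ∀ r a : ℝ, r ≠ 0 → r * (a / (2 * r)) = a / 2 := fun r a hr => by field_simp
  have h2 : (p + q) / 2 * ((p - q) / (p + q)) = (p - q) / 2 := by field_simp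
  have h4 := hr _ (q - p) h1.ne'
  generalize x e.1.1 = y
  generalize x e.1.2 = z
  generalize g e = c
  cases c <;> cases y <;> cases z <;> simp [sbmW, sbmB, chi, mul_add, h2, h4] <;> linarith

lemma sum_ssbm2Mass (h0 : 0 < p + q) (h1 : 0 < 1 - (p + q) / 2)
    (F : (VPair n → Bool) → (Fin n → Bool) → ℝ) :
    ∑ g, ∑ x, ssbm2Mass n p q x g * F g x =
      pE (sbmW p q) fun g => pE half fun x => lik n (sbmB p q) x g * F g x := by
  unfold pE
  refine Finset.sum_congr rfl fun g _ => ?_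
  rw [Finset.mul_sum]
  exact Finset.sum_congr rfl fun x _ => by rw [ssbm2Mass_eq h0 h1]; ring

lemma sum_ssbm2Mass_mul (h0 : 0 < p + q) (h1 : 0 < 1 - (p + q) / 2) (φ : (Fin n → Bool) → ℝ)
    (g : VPair n → Bool) : ∑ x, ssbm2Mass n p q x g * φ x =
      (∏ e, sbmW p q (g e)) * moment n (sbmB p q) φ g := by
  unfold moment pE
  rw [Finset.mul_sum]
  exact Finset.sum_congr rfl fun x _ => by rw [ssbm2Mass_eq h0 h1]; ring

lemma graphMarg_eq (h0 : 0 < p + q) (h1 : 0 < 1 - (p + q) / 2) (g : VPair n → Bool) :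
    graphMarg n p q g = (∏ e, sbmW p q (g e)) * moment n (sbmB p q) (fun _ => 1) g := by
  rw [← sum_ssbm2Mass_mul h0 h1, graphMarg]
  simp only [mul_one]

lemma prod_sbmW_pos (h0 : 0 < p + q) (h1 : 0 < 1 - (p + q) / 2) (g : VPair n → Bool) :
    0 < ∏ e, sbmW p q (g e) :=
  Finset.prod_pos fun e _ => by cases g e <;> simp [sbmW] <;> linarith

lemma postMean_eq (h0 : 0 < p + q) (h1 : 0 < 1 - (p + q) / 2) (g : VPair n → Bool) (u v : Fin n) :
    postMean n p q g u v = moment n (sbmB p q) (fun x => chi (x u) * chi (x v)) g /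
      moment n (sbmB p q) (fun _ => 1) g := by
  rw [postMean, graphMarg_eq h0 h1, sum_ssbm2Mass_mul h0 h1,
    mul_div_mul_left _ _ (prod_sbmW_pos h0 h1 g).ne']

lemma miSBM_eq (h0 : 0 < p + q) (h1 : 0 < 1 - (p + q) / 2) :
    miSBM n p q = info n (sbmW p q) (sbmB p q) := by
  unfold miSBM info pE
  refine Finset.sum_congr rfl fun x _ => ?_
  rw [Finset.mul_sum]
  refine Finset.sum_congr rfl fun g _ => ?_
  rw [graphMarg_eq h0 h1, ssbm2Mass_eq h0 h1, prod_half,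
    mul_div_mul_left _ _ (by positivity : ((1 : ℝ) / 2) ^ n ≠ 0),
    mul_div_mul_left _ _ (prod_sbmW_pos h0 h1 g).ne']
  ring

lemma MMSEn_eq {κ ε : ℝ} (h0 : 0 < p + q) (h1 : 0 < 1 - (p + q) / 2)
    (h : Chan (sbmW p q) (sbmB p q) κ ε) :
    MMSEn (n + 2) p q = 1 - pairOverlap n (sbmW p q) (sbmB p q) := by
  have hZ := fun g => moment_one_pos (n := n + 2) h g
  have hterm : ∀ u v : Fin (n + 2), ∑ g, ∑ x, ssbm2Mass (n + 2) p q x g *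
      (chi (x u) * chi (x v) - postMean (n + 2) p q g u v) ^ 2 =
      if u = v then 0 else 1 - pairOverlap n (sbmW p q) (sbmB p q) := by
    intro u v
    split_ifs with huv
    · subst huv
      simp only [postMean_eq h0 h1, chi_sq]
      refine Finset.sum_eq_zero fun g _ => Finset.sum_eq_zero fun x _ => ?_
      rw [div_self (hZ g).ne']
      ring
    · rw [sum_ssbm2Mass h0 h1 fun g x => (chi (x u) * chi (x v) - postMean (n + 2) p q g u v) ^ 2,
        ← overlap_eq_pairOverlap huv, overlap_empty h]
      have hone : pE (sbmW p q) (fun g : VPair (n + 2) → Bool =>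
          moment (n + 2) (sbmB p q) (fun _ => 1) g) = 1 := by
        unfold moment
        rw [pE_comm]
        simp only [mul_one]
        simp only [show ∀ x : Fin (n + 2) → Bool, (fun g => lik (n + 2) (sbmB p q) x g) =
          lik (n + 2) (sbmB p q) x from fun _ => rfl, pE_lik h, pE_const half_sum]
      refine Eq.trans ?_ (congrArg (· - _) hone)
      rw [← pE_sub]
      congr 1; ext g
      have hZg := (hZ g).ne'
      set m := postMean (n + 2) p q g u v with hm
      rw [postMean_eq h0 h1] at hm
      have e : ∀ x : Fin (n + 2) → Bool, lik (n + 2) (sbmB p q) x g * (chi (x u) * chi (x v) - m) ^ 2 =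
          lik (n + 2) (sbmB p q) x g * 1 -
            2 * m * (lik (n + 2) (sbmB p q) x g * (chi (x u) * chi (x v))) +
            m ^ 2 * (lik (n + 2) (sbmB p q) x g * 1) := fun x => by
        have h2 := chi_sq (x u)
        have h3 := chi_sq (x v)
        linear_combination lik (n + 2) (sbmB p q) x g * (chi (x v) * chi (x v) * h2 + h3)
      simp only [e, pE_add, pE_sub, pE_const_mul]
      change moment (n + 2) (sbmB p q) (fun _ => 1) g -
        2 * m * moment (n + 2) (sbmB p q) (fun x => chi (x u) * chi (x v)) g +
        m ^ 2 * moment (n + 2) (sbmB p q) (fun _ => 1) g = _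
      rw [hm]
      generalize moment (n + 2) (sbmB p q) (fun _ => 1) g = Z at hZg ⊢
      generalize moment (n + 2) (sbmB p q) (fun x => chi (x u) * chi (x v)) g = Y
      field_simp
      ring
  have hswap : ∑ g, ∑ x, ssbm2Mass (n + 2) p q x g *
      ∑ u, ∑ v, (chi (x u) * chi (x v) - postMean (n + 2) p q g u v) ^ 2 =
      ∑ u, ∑ v, ∑ g, ∑ x, ssbm2Mass (n + 2) p q x g *
        (chi (x u) * chi (x v) - postMean (n + 2) p q g u v) ^ 2 := by
    simp only [Finset.mul_sum]
    simp only [Finset.sum_comm (s := (Finset.univ : Finset (Fin (n + 2) → Bool)))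
      (t := (Finset.univ : Finset (Fin (n + 2)))),
      Finset.sum_comm (s := (Finset.univ : Finset (VPair (n + 2) → Bool)))
      (t := (Finset.univ : Finset (Fin (n + 2))))]
  have hite : ∀ (u v : Fin (n + 2)) (a : ℝ), (if u = v then 0 else a) =
      a - if u = v then a else 0 := fun u v a => by split_ifs <;> ring
  rw [MMSEn, hswap]
  simp only [hterm, hite, Finset.sum_sub_distrib, Finset.sum_ite_eq, Finset.mem_univ, if_true,
    Finset.sum_const, Finset.card_univ, Fintype.card_fin, nsmul_eq_mul]
  push_cast
  have h3 : (n : ℝ) + 2 - 1 ≠ 0 := by have : (0 : ℝ) ≤ n := n.cast_nonneg; linarith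
  field_simp

end BlockModel

section Limits

/-- Approximate solutions of the overlap inequality lie almost below the largest fixed point. -/
lemma exists_le_of_approx {θ δ : ℝ} (hθ : 0 < θ) (hδ : 0 < δ) :
    ∃ η, 0 < η ∧ ∀ s, 0 ≤ s → s ≤ 1 → s ≤ govl (θ * √(s + η)) ^ 2 + η →
      s ≤ (gfix θ / θ) ^ 2 + δ := by
  by_contra! hc
  choose f hf0 hf1 hf2 hf3 using fun k : ℕ => hc (1 / ((k : ℝ) + 1)) (by positivity)
  obtain ⟨s, hs, φ, hφ, hlim⟩ := (isCompact_Icc (a := (0 : ℝ)) (b := 1)).tendsto_subseq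
    fun k => ⟨hf0 k, hf1 k⟩
  have hη : Tendsto (fun k => 1 / ((φ k : ℝ) + 1)) atTop (nhds 0) :=
    tendsto_one_div_add_atTop_nhds_zero_nat.comp hφ.tendsto_atTop
  have h1 : s ≤ govl (θ * √(s + 0)) ^ 2 + 0 := by
    refine le_of_tendsto_of_tendsto' hlim ?_ fun k => hf2 (φ k)
    exact ((((continuous_govl.tendsto _).comp (((Real.continuous_sqrt.tendsto _).comp
      (hlim.add hη)).const_mul θ)).pow 2).add hη)
  have h2 : (gfix θ / θ) ^ 2 + δ ≤ s := ge_of_tendsto' hlim fun k => (hf3 (φ k)).le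
  rw [add_zero, add_zero] at h1
  have h3 : √s ≤ govl (θ * √s) := (Real.sqrt_le_left (govl_nonneg _)).2 h1
  have h4 := le_gfix hθ.le (by positivity : 0 ≤ θ * √s) (mul_le_mul_of_nonneg_left h3 hθ.le)
  have h5 : √s ≤ gfix θ / θ := by rw [le_div_iff₀ hθ]; linarith
  have h6 := pow_le_pow_left₀ (Real.sqrt_nonneg s) h5 2
  rw [Real.sq_sqrt hs.1] at h6
  linarith

variable {w b : ℕ → Bool → ℝ} {ε : ℕ → ℝ}

lemma tendsto_natCast_div_add_two :
    Tendsto (fun n : ℕ => (n : ℝ) / (n + 2)) atTop (nhds 1) :=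
  tendsto_natCast_div_add_atTop (2 : ℝ)

lemma tendsto_inv_add_two : Tendsto (fun n : ℕ => 1 / ((n : ℝ) + 2)) atTop (nhds 0) := by
  simp only [one_div]
  exact tendsto_inv_atTop_zero.comp
    (tendsto_atTop_add_const_right _ _ tendsto_natCast_atTop_atTop)

lemma eventually_chan_sqrt
    (hC : ∀ᶠ n : ℕ in atTop, Chan (w n) (b n) (1 / ((n : ℝ) + 2)) (ε n))
    (hε : Tendsto ε atTop (nhds 0)) {t : ℕ → ℝ} {θ : ℝ} (ht0 : ∀ᶠ n in atTop, 0 < t n)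
    (ht : Tendsto t atTop (nhds θ)) :
    ∀ᶠ n : ℕ in atTop, Chan (w n) (fun c => √(t n) * b n c) (t n / ((n : ℝ) + 2))
      (√(t n) * ε n) := by
  have h1 : Tendsto (fun n => √(t n) * ε n) atTop (nhds (√θ * 0)) :=
    ((Real.continuous_sqrt.tendsto _).comp ht).mul hε
  rw [mul_zero] at h1
  filter_upwards [hC, ht0, h1.eventually_le_const (by norm_num : (0 : ℝ) < 1 / 2)] with n h h0 h2
  have := h.scale_of_le (Real.sqrt_nonneg (t n)) h2
  rwa [Real.sq_sqrt h0.le, mul_one_div] at this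

/-- The limiting error of the overlap inequality vanishes as the number of pinned vertices
grows. -/
lemma exists_pin_count (θ : ℝ) {η : ℝ} (hη : 0 < η) :
    ∃ K : ℕ, 1 ≤ K ∧ 2 * √(1 / (K : ℝ)) < η ∧
      3 * √(Real.exp (2 * θ) * (2 * θ * √(2 * √(1 / (K : ℝ))))) < η := by
  have h0 : Tendsto (fun K : ℕ => √(1 / (K : ℝ))) atTop (nhds 0) := by
    have := (Real.continuous_sqrt.tendsto _).comp (tendsto_one_div_atTop_nhds_zero_nat (𝕜 := ℝ))
    rwa [Real.sqrt_zero] at this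
  have h1 : Tendsto (fun K : ℕ => 2 * √(1 / (K : ℝ))) atTop (nhds 0) := by
    simpa using h0.const_mul 2
  have h2 : Tendsto (fun K : ℕ => 3 * √(Real.exp (2 * θ) * (2 * θ * √(2 * √(1 / (K : ℝ))))))
      atTop (nhds 0) := by
    have hF : Continuous fun y : ℝ => 3 * √(Real.exp (2 * θ) * (2 * θ * √(2 * y))) := by
      fun_prop
    have := (hF.tendsto 0).comp h0
    simpa [Function.comp_def] using this
  obtain ⟨K, h3, h4, h5⟩ := ((eventually_ge_atTop 1).and
    ((h1.eventually_lt_const hη).and (h2.eventually_lt_const hη))).exists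
  exact ⟨K, h3, h4, h5⟩

lemma eventually_exists_overlap_le
    (hC : ∀ᶠ n : ℕ in atTop, Chan (w n) (b n) (1 / ((n : ℝ) + 2)) (ε n))
    (hε : Tendsto ε atTop (nhds 0)) {t : ℕ → ℝ} {θ : ℝ} (hθ : 0 < θ)
    (ht : Tendsto t atTop (nhds θ)) {η : ℝ} (hη : 0 < η) :
    ∀ᶠ n : ℕ in atTop, ∃ s, pairOverlap n (w n) (fun c => √(t n) * b n c) ≤ s ∧ 0 ≤ s ∧ s ≤ 1 ∧
      s ≤ govl (θ * √(s + η)) ^ 2 + η := by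
  have ht0 := ht.eventually_const_lt hθ
  obtain ⟨K, hK1, hKη, hKη'⟩ := exists_pin_count θ hη
  have hx := tendsto_natCast_div_add_two
  have hy := tendsto_inv_add_two
  have hε' : Tendsto (fun n => √(t n) * ε n) atTop (nhds 0) := by
    have := ((Real.continuous_sqrt.tendsto _).comp ht).mul hε
    rwa [mul_zero] at this
  have hκm : Tendsto (fun n : ℕ => t n / ((n : ℝ) + 2) * n) atTop (nhds θ) := by
    have := ht.mul hx
    rw [mul_one] at this
    exact this.congr fun n => by ring
  have hinv : Tendsto (fun n : ℕ => (2 * (K : ℝ) + 1) / n) atTop (nhds 0) :=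
    tendsto_const_div_atTop_nhds_zero_nat _
  have hshift : Tendsto (fun n : ℕ => |(t n / ((n : ℝ) + 2) * n) ^ 2 - θ ^ 2| +
      (t n / ((n : ℝ) + 2) * n) ^ 2 * (2 * √(1 / (K : ℝ)) + (2 * K + 1) / n)) atTop
      (nhds (θ ^ 2 * (2 * √(1 / (K : ℝ))))) := by
    have h1 := (((hκm.pow 2).sub_const (θ ^ 2)).abs).add
      ((hκm.pow 2).mul (hinv.const_add (2 * √(1 / (K : ℝ)))))
    rwa [sub_self, abs_zero, zero_add, add_zero] at h1
  have herr : Tendsto (fun n : ℕ => 12 * (√(t n) * ε n) * (t n / ((n : ℝ) + 2)) * n +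
      3 * (√(t n) * ε n) + 3 * √(Real.exp (2 * (t n / ((n : ℝ) + 2)) * n) *
        (2 * (t n / ((n : ℝ) + 2)) * √(2 * ((n : ℝ) ^ 2 * √(1 / (K : ℝ)) + (4 * K + 2) * n)) +
          8 * (t n / ((n : ℝ) + 2)) ^ 2 * n))) atTop
      (nhds (3 * √(Real.exp (2 * θ) * (2 * θ * √(2 * √(1 / (K : ℝ))))))) := by
    have hF : Continuous fun v : ℝ × ℝ × ℝ × ℝ => 12 * v.1 * v.2.1 * v.2.2.1 + 3 * v.1 +
        3 * √(Real.exp (2 * (v.2.1 * v.2.2.1)) * (2 * v.2.1 *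
          √(2 * (v.2.2.1 ^ 2 * √(1 / (K : ℝ)) + (4 * K + 2) * (v.2.2.1 * v.2.2.2))) +
          8 * v.2.1 ^ 2 * (v.2.2.1 * v.2.2.2))) := by fun_prop
    have h1 := (hF.tendsto (0, θ, 1, 0)).comp
      (hε'.prodMk_nhds (ht.prodMk_nhds (hx.prodMk_nhds hy)))
    have h2 : ∀ n : ℕ, ((n : ℝ) + 2)⁻¹ *
        √(2 * ((n : ℝ) ^ 2 * √(1 / (K : ℝ)) + (4 * K + 2) * n)) =
        √(2 * (((n : ℝ) / (n + 2)) ^ 2 * √(1 / (K : ℝ)) +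
          (4 * K + 2) * ((n : ℝ) / (n + 2) * (1 / (n + 2))))) := fun n => by
      have h3 : (0 : ℝ) ≤ ((n : ℝ) + 2)⁻¹ := by positivity
      conv_lhs => rw [← Real.sqrt_sq h3]
      rw [← Real.sqrt_mul (sq_nonneg _)]
      congr 1
      field_simp
    simp only [mul_zero, zero_mul, mul_one, one_pow, one_mul, add_zero, zero_add] at h1
    refine h1.congr fun n => ?_
    simp only [Function.comp_apply]
    rw [← h2]
    congr 2
    · ring
    · congr 2
      · congr 1; ring
      · ring
  have hK2 := (eventually_ge_atTop (K + 2))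
  have hlt : θ ^ 2 * (2 * √(1 / (K : ℝ))) < θ ^ 2 * η := mul_lt_mul_of_pos_left hKη (by positivity)
  filter_upwards [eventually_chan_sqrt hC hε ht0 ht, ht0, hK2, hshift.eventually_lt_const hlt,
    herr.eventually_lt_const hKη'] with n h h0 hn hs he
  obtain ⟨s, h1, h2, h3, h4⟩ := exists_overlap_le h (by positivity) K hK1 hn
  refine ⟨s, h1, h2, h3, h4.trans (add_le_add ?_ he.le)⟩
  refine pow_le_pow_left₀ (govl_nonneg _) ?_ 2
  refine strictMonoOn_govl.monotoneOn (Set.mem_Ici.2 (by positivity))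
    (Set.mem_Ici.2 (by positivity)) ?_
  have h5 : 0 ≤ t n / ((n : ℝ) + 2) * n := by positivity
  have h6 : (0 : ℝ) ≤ s + 2 * √(1 / (K : ℝ)) + (2 * K + 1) / n := by positivity
  rw [← Real.sqrt_sq h5, ← Real.sqrt_mul (sq_nonneg _)]
  conv_rhs => rw [← Real.sqrt_sq hθ.le, ← Real.sqrt_mul (sq_nonneg _)]
  refine Real.sqrt_le_sqrt ?_
  have h7 := le_abs_self ((t n / ((n : ℝ) + 2) * n) ^ 2 - θ ^ 2)
  have h8 : ((t n / ((n : ℝ) + 2) * n) ^ 2 - θ ^ 2) * s ≤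
      |(t n / ((n : ℝ) + 2) * n) ^ 2 - θ ^ 2| :=
    (mul_le_mul_of_nonneg_right h7 h2).trans (mul_le_of_le_one_right (abs_nonneg _) h3)
  generalize (t n / ((n : ℝ) + 2) * n) ^ 2 = A at *
  linarith

lemma eventually_pairOverlap_le
    (hC : ∀ᶠ n : ℕ in atTop, Chan (w n) (b n) (1 / ((n : ℝ) + 2)) (ε n))
    (hε : Tendsto ε atTop (nhds 0)) {t : ℕ → ℝ} {θ : ℝ} (hθ : 0 < θ)
    (ht : Tendsto t atTop (nhds θ)) {δ : ℝ} (hδ : 0 < δ) :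
    ∀ᶠ n : ℕ in atTop, pairOverlap n (w n) (fun c => √(t n) * b n c) ≤ (gfix θ / θ) ^ 2 + δ := by
  obtain ⟨η, hη, hle⟩ := exists_le_of_approx hθ hδ
  filter_upwards [eventually_exists_overlap_le hC hε hθ ht hη] with n ⟨s, h1, h2, h3, h4⟩
  exact h1.trans (hle s h2 h3 h4)

end Limits

section FreeLimits

variable {w b : ℕ → Bool → ℝ} {ε : ℕ → ℝ}

/-- Relative entropy per vertex at signal strength `θ`. -/
noncomputable def freeDensity (w b : ℕ → Bool → ℝ) (n : ℕ) (θ : ℝ) : ℝ :=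
  free (n + 2) (w n) (fun c => √θ * b n c) / ((n : ℝ) + 2)

lemma freeDensity_sub_bounds {n : ℕ} (h : Chan (w n) (b n) (1 / ((n : ℝ) + 2)) (ε n))
    {x y : ℝ} (hx : 0 ≤ x) (hxy : x ≤ y) (hy : √y * ε n ≤ 1 / 2) :
    0 ≤ freeDensity w b n y - freeDensity w b n x ∧
    freeDensity w b n y - freeDensity w b n x ≤ (1 + 2 * (√y * ε n)) *
      pairOverlap n (w n) (fun c => √y * b n c) * ((y - x) / 4) := by
  obtain ⟨h1, h2⟩ := free_sub_bounds h (Real.sqrt_nonneg x) (Real.sqrt_le_sqrt hxy) hy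
  have hn : (0 : ℝ) < (n : ℝ) + 2 := by positivity
  rw [freeDensity, freeDensity, ← sub_div]
  refine ⟨div_nonneg h1 hn.le, ?_⟩
  rw [div_le_iff₀ hn]
  refine h2.trans ?_
  rw [Real.sq_sqrt hx, Real.sq_sqrt (hx.trans hxy)]
  have hp := pairOverlap_nonneg (n := n) (h.scale_of_le (Real.sqrt_nonneg y) hy)
  have hε := h.eps_nonneg
  have h3 : (1 + 2 * (√y * ε n)) * (1 / ((n : ℝ) + 2)) * (((n : ℝ) + 2) * (n + 1) / 2) *
      pairOverlap n (w n) (fun c => √y * b n c) * ((y - x) / 2) =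
      (1 + 2 * (√y * ε n)) * pairOverlap n (w n) (fun c => √y * b n c) * ((y - x) / 4) *
        (n + 1) := by
    field_simp
    ring
  rw [h3]
  refine mul_le_mul_of_nonneg_left (by linarith) ?_
  have : 0 ≤ y - x := by linarith
  positivity

lemma freeDensity_sub_le {n : ℕ} (h : Chan (w n) (b n) (1 / ((n : ℝ) + 2)) (ε n))
    {x y : ℝ} (hx : 0 ≤ x) (hxy : x ≤ y) (hy : √y * ε n ≤ 1 / 2) :
    freeDensity w b n y - freeDensity w b n x ≤ (y - x) / 2 := by
  refine (freeDensity_sub_bounds h hx hxy hy).2.trans ?_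
  have hs := h.scale_of_le (Real.sqrt_nonneg y) hy
  have h1 := pairOverlap_nonneg (n := n) hs
  have h2 := pairOverlap_le_one (n := n) hs
  have h3 : (1 + 2 * (√y * ε n)) * pairOverlap n (w n) (fun c => √y * b n c) ≤ 2 * 1 :=
    mul_le_mul (by linarith) h2 h1 (by norm_num)
  have := mul_le_mul_of_nonneg_right h3 (by linarith : 0 ≤ (y - x) / 4)
  linarith

lemma tendsto_sqrt_mul (hε : Tendsto ε atTop (nhds 0)) (y : ℝ) :
    Tendsto (fun n => √y * ε n) atTop (nhds 0) := by
  simpa using hε.const_mul (√y)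

lemma eventually_sqrt_mul_le (hε : Tendsto ε atTop (nhds 0)) (y : ℝ) :
    ∀ᶠ n in atTop, √y * ε n ≤ 1 / 2 :=
  (tendsto_sqrt_mul hε y).eventually_le_const (by norm_num)

lemma eventually_freeDensity_step
    (hC : ∀ᶠ n : ℕ in atTop, Chan (w n) (b n) (1 / ((n : ℝ) + 2)) (ε n))
    (hε : Tendsto ε atTop (nhds 0)) {x y δ : ℝ} (hx : 0 < x) (hxy : x < y) (hδ : 0 < δ) :
    ∀ᶠ n : ℕ in atTop, freeDensity w b n y - freeDensity w b n x ≤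
      (gfix y / y) ^ 2 * ((y - x) / 4) + δ := by
  have hy := hx.trans hxy
  have hlim : Tendsto (fun η : ℝ => (1 + 2 * η) * ((gfix y / y) ^ 2 + η) * ((y - x) / 4))
      (nhds 0) (nhds ((gfix y / y) ^ 2 * ((y - x) / 4))) := by
    have : Continuous fun η : ℝ => (1 + 2 * η) * ((gfix y / y) ^ 2 + η) * ((y - x) / 4) := by
      fun_prop
    simpa using this.tendsto 0
  obtain ⟨η, hη0, hη⟩ := (((hlim.mono_left nhdsWithin_le_nhds).eventually_lt_const
    (lt_add_of_pos_right _ hδ)).and (self_mem_nhdsWithin (s := Set.Ioi (0 : ℝ)))).exists.imp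
    fun η h => And.intro h.2 h.1
  have hη0 : 0 < η := hη0
  filter_upwards [hC, eventually_sqrt_mul_le hε y,
    (tendsto_sqrt_mul hε y).eventually_le_const hη0,
    eventually_pairOverlap_le hC hε hy tendsto_const_nhds hη0] with n h h1 h2 h3
  refine (freeDensity_sub_bounds h hx.le hxy.le h1).2.trans (le_trans ?_ hη.le)
  refine mul_le_mul_of_nonneg_right ?_ (by linarith)
  exact mul_le_mul (by linarith) h3 (pairOverlap_nonneg (h.scale_of_le (Real.sqrt_nonneg y) h1))
    (by positivity)

lemma gfix_sq_mul_le {A x y : ℝ} (hA : 0 < A) (hx : A ≤ x) (hxy : x < y) :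
    (gfix y / y) ^ 2 * ((y - x) / 4) ≤ gent y - gent x +
      (y - x) / (4 * A ^ 2) * (gfix y ^ 2 - gfix x ^ 2) := by
  have hx0 : 0 < x := hA.trans_le hx
  have hy0 := hx0.trans hxy
  have h1 := gent_sub_ge hx0 hy0
  have h2 := gfix_mono hx0.le hxy.le
  have h3 := pow_le_pow_left₀ (gfix_nonneg hx0.le) h2 2
  have h4 : gfix x ^ 2 / 4 * (1 / x - 1 / y) = (y - x) / 4 * (gfix x ^ 2 / (x * y)) := by
    field_simp
  have h5 : (gfix y / y) ^ 2 * ((y - x) / 4) = (y - x) / 4 * (gfix y ^ 2 / y ^ 2) := by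
    rw [div_pow]; ring
  have h6 : (y - x) / (4 * A ^ 2) * (gfix y ^ 2 - gfix x ^ 2) =
      (y - x) / 4 * ((gfix y ^ 2 - gfix x ^ 2) / A ^ 2) := by field_simp
  rw [h4] at h1
  rw [h5, h6]
  have h7 : gfix y ^ 2 / y ^ 2 ≤ gfix y ^ 2 / (x * y) :=
    div_le_div_of_nonneg_left (sq_nonneg _) (by positivity) (by nlinarith)
  have h8 : (gfix y ^ 2 - gfix x ^ 2) / (x * y) ≤ (gfix y ^ 2 - gfix x ^ 2) / A ^ 2 :=
    div_le_div_of_nonneg_left (by linarith) (by positivity) (by nlinarith)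
  rw [sub_div] at h8
  have h9 := mul_le_mul_of_nonneg_left (by linarith :
    gfix y ^ 2 / y ^ 2 ≤ gfix x ^ 2 / (x * y) + (gfix y ^ 2 - gfix x ^ 2) / A ^ 2)
    (by linarith : 0 ≤ (y - x) / 4)
  linarith

lemma eventually_freeDensity_sub_le
    (hC : ∀ᶠ n : ℕ in atTop, Chan (w n) (b n) (1 / ((n : ℝ) + 2)) (ε n))
    (hε : Tendsto ε atTop (nhds 0)) {x y δ : ℝ} (hx : 0 < x) (hxy : x < y) (hδ : 0 < δ) :
    ∀ᶠ n : ℕ in atTop, freeDensity w b n y - freeDensity w b n x ≤ gent y - gent x + δ := by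
  set C := (y - x) / (4 * x ^ 2) * (gfix y ^ 2 - gfix x ^ 2) with hC'
  obtain ⟨N, hN1, hN⟩ : ∃ N : ℕ, 1 ≤ N ∧ C / N ≤ δ / 2 :=
    ((eventually_ge_atTop 1).and ((tendsto_const_div_atTop_nhds_zero_nat C).eventually_le_const
      (half_pos hδ))).exists
  have hN0 : (0 : ℝ) < N := by exact_mod_cast hN1
  set r := (y - x) / N with hr
  have hr0 : 0 < r := div_pos (by linarith) hN0
  have hstep : ∀ i : ℕ, (x + (i + 1 : ℕ) * r) - (x + i * r) = r := fun i => by push_cast; ring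
  have hge : ∀ i : ℕ, x ≤ x + i * r := fun i => by
    have : 0 ≤ (i : ℝ) * r := by positivity
    linarith
  have hall : ∀ᶠ n in atTop, ∀ i ∈ Finset.range N,
      freeDensity w b n (x + (i + 1 : ℕ) * r) - freeDensity w b n (x + i * r) ≤
        (gent (x + (i + 1 : ℕ) * r) - gent (x + i * r)) + r / (4 * x ^ 2) *
          (gfix (x + (i + 1 : ℕ) * r) ^ 2 - gfix (x + i * r) ^ 2) + δ / 2 / N := by
    refine (eventually_all_finset _).2 fun i _ => ?_
    have hlt : x + i * r < x + (i + 1 : ℕ) * r := by linarith [hstep i]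
    filter_upwards [eventually_freeDensity_step hC hε (hx.trans_le (hge i)) hlt
      (by positivity : 0 < δ / 2 / N)] with n h
    have := gfix_sq_mul_le hx (hge i) hlt
    rw [hstep] at this h
    linarith
  filter_upwards [hall] with n h
  have := Finset.sum_le_sum h
  rw [Finset.sum_range_sub (fun i : ℕ => freeDensity w b n (x + i * r)), Finset.sum_add_distrib,
    Finset.sum_add_distrib, Finset.sum_range_sub (fun i : ℕ => gent (x + i * r)),
    ← Finset.mul_sum, Finset.sum_range_sub (fun i : ℕ => gfix (x + i * r) ^ 2),
    Finset.sum_const, Finset.card_range, nsmul_eq_mul, Nat.cast_zero, zero_mul, add_zero,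
    show x + N * r = y by rw [hr, mul_div_cancel₀ _ hN0.ne']; ring,
    mul_div_cancel₀ _ hN0.ne'] at this
  have e : r / (4 * x ^ 2) * (gfix y ^ 2 - gfix x ^ 2) = C / N := by
    rw [hC', hr]; field_simp
  linarith

lemma eventually_freeDensity_le
    (hC : ∀ᶠ n : ℕ in atTop, Chan (w n) (b n) (1 / ((n : ℝ) + 2)) (ε n))
    (hε : Tendsto ε atTop (nhds 0)) {θ δ : ℝ} (hθ : 0 < θ) (hδ : 0 < δ) :
    ∀ᶠ n : ℕ in atTop, freeDensity w b n θ ≤ gent θ + δ := by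
  set x := min (θ / 2) δ with hx
  have hx0 : 0 < x := lt_min (by linarith) hδ
  have hx1 : x ≤ θ / 2 := min_le_left _ _
  have hx2 : x ≤ δ := min_le_right _ _
  filter_upwards [hC, eventually_sqrt_mul_le hε x,
    eventually_freeDensity_sub_le hC hε hx0 (by linarith : x < θ) (half_pos hδ)] with n h h1 h2
  have h3 := freeDensity_sub_le h le_rfl hx0.le h1
  have h4 : freeDensity w b n 0 = 0 := by
    simp [freeDensity, free_zero h.sum_one]
  have := gent_nonneg hx0
  linarith

lemma info_add_freeDensity_le {n : ℕ} {θ : ℝ}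
    (h : Chan (w n) (fun c => √θ * b n c) (θ / ((n : ℝ) + 2)) (√θ * ε n)) (hθ : 0 ≤ θ) :
    |info (n + 2) (w n) (fun c => √θ * b n c) / ((n : ℝ) + 2) + freeDensity w b n θ -
      θ / 4 * (((n : ℝ) + 1) / (n + 2))| ≤ 2 * (√θ * ε n) * θ := by
  have h1 := abs_info_add_free_sub_le (n := n + 2) h
  rw [card_vpair] at h1
  push_cast at h1
  have hn : (0 : ℝ) < (n : ℝ) + 2 := by positivity
  have e : info (n + 2) (w n) (fun c => √θ * b n c) / ((n : ℝ) + 2) + freeDensity w b n θ -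
      θ / 4 * (((n : ℝ) + 1) / (n + 2)) = (info (n + 2) (w n) (fun c => √θ * b n c) +
        free (n + 2) (w n) (fun c => √θ * b n c) -
        ((n : ℝ) + 2) * (n + 2 - 1) / 2 * (θ / ((n : ℝ) + 2) / 2)) / ((n : ℝ) + 2) := by
    rw [freeDensity]
    field_simp
    ring
  rw [e, abs_div, abs_of_pos hn, div_le_iff₀ hn]
  refine h1.trans ?_
  have h2 := h.eps_nonneg
  have e2 : ((n : ℝ) + 2) * (n + 2 - 1) / 2 * (4 * (√θ * ε n) * (θ / ((n : ℝ) + 2))) =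
      2 * (√θ * ε n) * θ * (n + 1) := by
    field_simp
    ring
  rw [e2]
  exact mul_le_mul_of_nonneg_left (by linarith) (by positivity)

lemma tendsto_add_one_div_add_two :
    Tendsto (fun n : ℕ => ((n : ℝ) + 1) / (n + 2)) atTop (nhds 1) := by
  have := tendsto_inv_add_two.const_sub 1
  rw [sub_zero] at this
  refine this.congr fun n => ?_
  have : (n : ℝ) + 2 ≠ 0 := by positivity
  field_simp
  ring

lemma eventually_le_freeDensity_top
    (hC : ∀ᶠ n : ℕ in atTop, Chan (w n) (b n) (1 / ((n : ℝ) + 2)) (ε n))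
    (hε : Tendsto ε atTop (nhds 0)) {θ δ : ℝ} (hθ : 0 < θ) (hδ : 0 < δ) :
    ∀ᶠ n : ℕ in atTop, θ / 4 - Real.log 2 - δ ≤ freeDensity w b n θ := by
  have hlim : Tendsto (fun n : ℕ => θ / 4 * (((n : ℝ) + 1) / (n + 2)) - 2 * (√θ * ε n) * θ)
      atTop (nhds (θ / 4)) := by
    have := (tendsto_add_one_div_add_two.const_mul (θ / 4)).sub
      (((tendsto_sqrt_mul hε θ).const_mul 2).mul_const θ)
    simpa using this
  filter_upwards [eventually_chan_sqrt hC hε (t := fun _ => θ) (Eventually.of_forall fun _ => hθ)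
    tendsto_const_nhds, hlim.eventually_const_le (by linarith : θ / 4 - δ < θ / 4)] with n h h1
  have h2 := (abs_le.1 (info_add_freeDensity_le h hθ.le)).1
  have h3 : info (n + 2) (w n) (fun c => √θ * b n c) / ((n : ℝ) + 2) ≤ Real.log 2 := by
    have := info_le (n := n + 2) h
    push_cast at this
    rwa [div_le_iff₀' (by positivity)]
  linarith

lemma tendsto_freeDensity
    (hC : ∀ᶠ n : ℕ in atTop, Chan (w n) (b n) (1 / ((n : ℝ) + 2)) (ε n))
    (hε : Tendsto ε atTop (nhds 0)) {θ : ℝ} (hθ : 0 < θ) :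
    Tendsto (fun n => freeDensity w b n θ) atTop (nhds (gent θ)) := by
  refine tendsto_order.2 ⟨fun l hl => ?_, fun u hu => ?_⟩
  · set δ := (gent θ - l) / 4 with hδ'
    have hδ : 0 < δ := by rw [hδ']; linarith
    have hexp : Tendsto (fun T => 2 * Real.exp (-gfix T / 2)) atTop (nhds 0) := by
      have h1 : Tendsto (fun T => -gfix T / 2) atTop atBot :=
        (tendsto_neg_atTop_atBot.comp tendsto_gfix_atTop).atBot_div_const (by norm_num)
      simpa using (Real.tendsto_exp_atBot.comp h1).const_mul 2
    obtain ⟨T, hT1, hT2⟩ := ((hexp.eventually_lt_const hδ).and (eventually_gt_atTop θ)).exists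
    have hT0 := hθ.trans hT2
    filter_upwards [eventually_freeDensity_sub_le hC hε hθ hT2 hδ,
      eventually_le_freeDensity_top hC hε hT0 hδ] with n h1 h2
    have := gent_le hT0
    linarith
  · filter_upwards [eventually_freeDensity_le hC hε hθ (half_pos (sub_pos.2 hu))] with n h
    linarith

lemma tendsto_freeDensity_seq
    (hC : ∀ᶠ n : ℕ in atTop, Chan (w n) (b n) (1 / ((n : ℝ) + 2)) (ε n))
    (hε : Tendsto ε atTop (nhds 0)) {t : ℕ → ℝ} {θ : ℝ} (hθ : 0 < θ)
    (ht : Tendsto t atTop (nhds θ)) :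
    Tendsto (fun n => freeDensity w b n (t n)) atTop (nhds (gent θ)) := by
  have h0 : Tendsto (fun n => |t n - θ| / 2) atTop (nhds 0) := by
    simpa using ((ht.sub_const θ).abs).div_const 2
  have hd : Tendsto (fun n => freeDensity w b n (t n) - freeDensity w b n θ) atTop (nhds 0) := by
    refine squeeze_zero_norm' ?_ h0
    filter_upwards [hC, eventually_sqrt_mul_le hε θ, ht.eventually_const_lt hθ,
      ((Real.continuous_sqrt.tendsto _).comp ht |>.mul hε).eventually_le_const
        (by norm_num : √θ * 0 < 1 / 2)] with n h h1 h2 h3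
    rw [Real.norm_eq_abs]
    rcases le_total (t n) θ with hle | hle
    · have h4 := (freeDensity_sub_bounds h h2.le hle h1).1
      have h5 := freeDensity_sub_le h h2.le hle h1
      rw [abs_of_nonpos (by linarith), abs_of_nonpos (by linarith)]
      linarith
    · have h4 := (freeDensity_sub_bounds h hθ.le hle h3).1
      have h5 := freeDensity_sub_le h hθ.le hle h3
      rw [abs_of_nonneg h4, abs_of_nonneg (by linarith)]
      exact h5
  simpa using hd.add (tendsto_freeDensity hC hε hθ)

lemma tendsto_info_div
    (hC : ∀ᶠ n : ℕ in atTop, Chan (w n) (b n) (1 / ((n : ℝ) + 2)) (ε n))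
    (hε : Tendsto ε atTop (nhds 0)) {t : ℕ → ℝ} {θ : ℝ} (hθ : 0 < θ)
    (ht : Tendsto t atTop (nhds θ)) :
    Tendsto (fun n : ℕ => info (n + 2) (w n) (fun c => √(t n) * b n c) / ((n : ℝ) + 2)) atTop
      (nhds (Psi (gfix θ) θ)) := by
  have ht0 := ht.eventually_const_lt hθ
  have h1 : Tendsto (fun n : ℕ => 2 * (√(t n) * ε n) * t n) atTop (nhds 0) := by
    have := ((((Real.continuous_sqrt.tendsto _).comp ht).mul hε).const_mul 2).mul ht
    simpa using this
  have h2 : Tendsto (fun n : ℕ => info (n + 2) (w n) (fun c => √(t n) * b n c) / ((n : ℝ) + 2) +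
      freeDensity w b n (t n) - t n / 4 * (((n : ℝ) + 1) / (n + 2))) atTop (nhds 0) := by
    refine squeeze_zero_norm' ?_ h1
    filter_upwards [eventually_chan_sqrt hC hε ht0 ht, ht0] with n h h0
    exact info_add_freeDensity_le h h0.le
  have h3 := (h2.sub (tendsto_freeDensity_seq hC hε hθ ht)).add
    ((ht.div_const 4).mul tendsto_add_one_div_add_two)
  have e : 0 - gent θ + θ / 4 * 1 = Psi (gfix θ) θ := by
    rw [gent, gpot_eq]; ring
  rw [e] at h3
  exact h3.congr fun n => by ring

lemma tendsto_pairOverlap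
    (hC : ∀ᶠ n : ℕ in atTop, Chan (w n) (b n) (1 / ((n : ℝ) + 2)) (ε n))
    (hε : Tendsto ε atTop (nhds 0)) {t : ℕ → ℝ} {θ : ℝ} (hθ : 0 < θ)
    (ht : Tendsto t atTop (nhds θ)) :
    Tendsto (fun n => pairOverlap n (w n) (fun c => √(t n) * b n c)) atTop
      (nhds ((gfix θ / θ) ^ 2)) := by
  refine tendsto_order.2 ⟨fun l hl => ?_, fun u hu => ?_⟩
  · have hg := gfix_nonneg hθ.le
    obtain ⟨η, hη, hηl⟩ : ∃ η, 0 < η ∧ l < (gfix θ ^ 2 - 2 * η * gfix θ) / θ ^ 2 - η := by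
      have hF : Continuous fun η : ℝ => (gfix θ ^ 2 - 2 * η * gfix θ) / θ ^ 2 - η := by fun_prop
      have h0 : Tendsto (fun η : ℝ => (gfix θ ^ 2 - 2 * η * gfix θ) / θ ^ 2 - η) (nhds 0)
          (nhds ((gfix θ / θ) ^ 2)) := by
        simpa [div_pow] using hF.tendsto 0
      exact (((h0.mono_left nhdsWithin_le_nhds).eventually_const_lt hl).and
        (self_mem_nhdsWithin (s := Set.Ioi (0 : ℝ)))).exists.imp fun η h => And.intro h.2 h.1
    obtain ⟨x, hx0, hxθ, hx⟩ := exists_gfix_gt hθ hη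
    set y := (x + θ) / 2 with hy
    have hxy : x < y := by rw [hy]; linarith
    have hyθ : y < θ := by rw [hy]; linarith
    have hy0 := hx0.trans hxy
    have hgx := gfix_nonneg hx0.le
    have h1 : gfix θ ^ 2 - 2 * η * gfix θ ≤ gfix x ^ 2 := by
      rcases le_total (gfix θ) η with h | h
      · nlinarith [sq_nonneg (gfix x), mul_nonneg hη.le hg]
      · nlinarith
    have h2 : (gfix θ ^ 2 - 2 * η * gfix θ) / θ ^ 2 ≤ gfix x ^ 2 / (x * y) :=
      (div_le_div_of_nonneg_right h1 (by positivity)).trans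
        (div_le_div_of_nonneg_left (sq_nonneg _) (by positivity) (by nlinarith))
    have h3 : (y - x) / 4 * (gfix x ^ 2 / (x * y)) ≤ gent y - gent x := by
      refine le_trans (le_of_eq ?_) (gent_sub_ge hx0 hy0)
      field_simp
    have h4 : (y - x) / 4 * (l + η) < gent y - gent x := lt_of_lt_of_le
      (mul_lt_mul_of_pos_left (by linarith) (by linarith)) h3
    filter_upwards [hC, eventually_sqrt_mul_le hε y, ht.eventually_const_lt hyθ,
      ((tendsto_freeDensity hC hε hy0).sub
        (tendsto_freeDensity hC hε hx0)).eventually_const_lt h4,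
      ((Real.continuous_sqrt.tendsto _).comp ht |>.mul hε).eventually_le_const
        (by norm_num : √θ * 0 < 1 / 2),
      (tendsto_sqrt_mul hε y).eventually_lt_const (by linarith : 0 < η / 2)]
      with n h h5 h6 h7 h8 h9
    have h10 := (freeDensity_sub_bounds h hx0.le hxy.le h5).2
    have h11 := pairOverlap_mono (n := n) h (Real.sqrt_nonneg y) (Real.sqrt_le_sqrt h6.le) h8
    have hs := h.scale_of_le (Real.sqrt_nonneg y) h5
    have h12 := pairOverlap_le_one (n := n) hs
    have h13 := pairOverlap_nonneg (n := n) hs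
    have hεn := h.eps_nonneg
    refine lt_of_lt_of_le ?_ h11
    have h14 : (y - x) / 4 * (l + η) < (y - x) / 4 * ((1 + 2 * (√y * ε n)) *
      pairOverlap n (w n) (fun c => √y * b n c)) := by linarith
    have h15 := lt_of_mul_lt_mul_left h14 (by linarith)
    have h16 : √y * ε n * pairOverlap n (w n) (fun c => √y * b n c) ≤ √y * ε n :=
      mul_le_of_le_one_right (by positivity) h12
    linarith
  · filter_upwards [eventually_pairOverlap_le hC hε hθ ht (half_pos (sub_pos.2 hu))] with n h
    linarith

end FreeLimits

section BlockModelLimit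

lemma sq_sbmB_le {p q : ℝ} (h0 : 0 < p + q) (h1 : 0 < 1 - (p + q) / 2) (c : Bool) :
    sbmB p q c ^ 2 ≤ (p - q) ^ 2 / (2 * (p + q) * (1 - (p + q) / 2)) /
      ((p + q) / 2 * (1 - (p + q) / 2)) := by
  have hs : (p + q) / 2 < 1 := by linarith
  have e : (p - q) ^ 2 / (2 * (p + q) * (1 - (p + q) / 2)) /
      ((p + q) / 2 * (1 - (p + q) / 2)) = (p - q) ^ 2 / ((p + q) * (1 - (p + q) / 2)) ^ 2 := by
    generalize 1 - (p + q) / 2 = r at *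
    field_simp
  rw [e]
  cases c
  · simp only [sbmB, Bool.false_eq_true, if_false, div_pow]
    rw [show (q - p) ^ 2 = (p - q) ^ 2 by ring]
    exact div_le_div_of_nonneg_left (sq_nonneg _) (by positivity)
      (pow_le_pow_left₀ (by positivity) (mul_le_mul_of_nonneg_right (by linarith) h1.le) 2)
  · simp only [sbmB, if_true, div_pow]
    exact div_le_div_of_nonneg_left (sq_nonneg _) (by positivity)
      (pow_le_pow_left₀ (by positivity) (mul_le_of_le_one_right h0.le (by linarith)) 2)

lemma chan_sbm_normalized {p q N t D : ℝ} (h0 : 0 < p + q) (h1 : 0 < 1 - (p + q) / 2)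
    (hN : 0 < N) (ht : t = N * (p - q) ^ 2 / (2 * (p + q) * (1 - (p + q) / 2))) (ht0 : 0 < t)
    (hD : D = N * (p + q) / 2 * (1 - (p + q) / 2)) (hε : √(t / D) ≤ 1 / 2)
    (hε' : √t⁻¹ * √(t / D) ≤ 1 / 2) :
    Chan (sbmW p q) (sbmB p q) (t / N) √(t / D) ∧
    Chan (sbmW p q) (fun c => √t⁻¹ * sbmB p q c) (1 / N) (√t⁻¹ * √(t / D)) := by
  have hκ : (p - q) ^ 2 / (2 * (p + q) * (1 - (p + q) / 2)) = t / N := by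
    rw [ht, mul_div_assoc, mul_div_cancel_left₀ _ hN.ne']
  have hb : ∀ c, |sbmB p q c| ≤ √(t / D) := fun c => by
    rw [← Real.sqrt_sq_eq_abs]
    refine Real.sqrt_le_sqrt ((sq_sbmB_le h0 h1 c).trans (le_of_eq ?_))
    rw [hκ, hD, div_div]
    congr 1
    ring
  have h := chan_sbm h0 h1 hε hb
  rw [hκ] at h
  refine ⟨h, ?_⟩
  have h2 := h.scale_of_le (Real.sqrt_nonneg t⁻¹) hε'
  rwa [Real.sq_sqrt (inv_nonneg.2 ht0.le), ← mul_div_assoc, inv_mul_cancel₀ ht0.ne'] at h2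

end BlockModelLimit

/-- Asymptotic MMSE and per-vertex mutual information of the two-community SBM at
finite SNR `λ` with diverging degrees. -/
theorem mmse_and_mutual_information_limit (p q : ℕ → ℝ)
    (hp : ∀ n, p n ∈ Set.Icc (0 : ℝ) 1) (hq : ∀ n, q n ∈ Set.Icc (0 : ℝ) 1)
    (lam : ℝ) (hlam : 0 < lam)
    (hsnr : Tendsto
      (fun n : ℕ => (n : ℝ) * (p n - q n) ^ 2 /
        (2 * (p n + q n) * (1 - (p n + q n) / 2)))
      atTop (nhds lam))
    (hdeg : Tendsto
      (fun n : ℕ => (n : ℝ) * (p n + q n) / 2 * (1 - (p n + q n) / 2))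
      atTop atTop)
    (γs : ℝ) (hγ0 : 0 ≤ γs) (hfix : γs = lam * (1 - gmmse γs))
    (hlargest : ∀ γ : ℝ, 0 ≤ γ → γ = lam * (1 - gmmse γ) → γ ≤ γs) :
    Tendsto (fun n : ℕ => MMSEn n (p n) (q n)) atTop (nhds (1 - γs ^ 2 / lam ^ 2)) ∧
    Tendsto (fun n : ℕ => miSBM n (p n) (q n) / n) atTop (nhds (Psi γs lam)) ∧
    (lam ≤ 1 → 1 - γs ^ 2 / lam ^ 2 = 1) ∧
    (1 < lam → 1 - γs ^ 2 / lam ^ 2 < 1) := by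
  have hγ : γs = gfix lam := eq_gfix hlam.le hγ0 hfix hlargest
  subst hγ
  set t : ℕ → ℝ := fun n => ((n + 2 : ℕ) : ℝ) * (p (n + 2) - q (n + 2)) ^ 2 /
    (2 * (p (n + 2) + q (n + 2)) * (1 - (p (n + 2) + q (n + 2)) / 2)) with ht
  set D : ℕ → ℝ := fun n => ((n + 2 : ℕ) : ℝ) * (p (n + 2) + q (n + 2)) / 2 *
    (1 - (p (n + 2) + q (n + 2)) / 2) with hD
  have htl : Tendsto t atTop (nhds lam) := hsnr.comp (tendsto_add_atTop_nat 2)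
  have hDl : Tendsto D atTop atTop := hdeg.comp (tendsto_add_atTop_nat 2)
  have hb0 : Tendsto (fun n => √(t n / D n)) atTop (nhds 0) := by
    have := (Real.continuous_sqrt.tendsto _).comp (htl.div_atTop hDl)
    rwa [Real.sqrt_zero] at this
  have hε0 : Tendsto (fun n => √(t n)⁻¹ * √(t n / D n)) atTop (nhds 0) := by
    have := ((Real.continuous_sqrt.tendsto _).comp (htl.inv₀ hlam.ne')).mul hb0
    rwa [mul_zero] at this
  set w : ℕ → Bool → ℝ := fun n => sbmW (p (n + 2)) (q (n + 2)) with hw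
  set b : ℕ → Bool → ℝ := fun n c => √(t n)⁻¹ * sbmB (p (n + 2)) (q (n + 2)) c with hb
  have hpos : ∀ᶠ n in atTop, 0 < t n ∧ 0 < p (n + 2) + q (n + 2) ∧
      0 < 1 - (p (n + 2) + q (n + 2)) / 2 := by
    filter_upwards [htl.eventually_const_lt hlam, hDl.eventually_gt_atTop 0] with n h1 h2
    refine ⟨h1, ?_, ?_⟩
    · refine lt_of_le_of_ne (add_nonneg (hp _).1 (hq _).1) fun h => ?_
      simp [hD, ← h] at h2
    · refine lt_of_le_of_ne (by have := (hp (n + 2)).2; have := (hq (n + 2)).2; linarith)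
        fun h => ?_
      simp [hD, ← h] at h2
  have hall : ∀ᶠ n : ℕ in atTop,
      Chan (w n) (sbmB (p (n + 2)) (q (n + 2))) (t n / ((n + 2 : ℕ) : ℝ)) √(t n / D n) ∧
      Chan (w n) (b n) (1 / ((n : ℝ) + 2)) (√(t n)⁻¹ * √(t n / D n)) := by
    filter_upwards [hpos, hb0.eventually_le_const (by norm_num : (0 : ℝ) < 1 / 2),
      hε0.eventually_le_const (by norm_num : (0 : ℝ) < 1 / 2)] with n ⟨h1, h2, h3⟩ h4 h5
    have := chan_sbm_normalized h2 h3 (N := ((n + 2 : ℕ) : ℝ)) (by positivity) rfl h1 rfl h4 h5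
    refine ⟨this.1, ?_⟩
    rw [← Nat.cast_ofNat (R := ℝ) (n := 2), ← Nat.cast_add]
    exact this.2
  have hC := hall.mono fun n h => h.2
  have hback : ∀ᶠ n in atTop, (fun c => √(t n) * b n c) = sbmB (p (n + 2)) (q (n + 2)) := by
    filter_upwards [hpos] with n h
    ext c
    rw [hb]
    beta_reduce
    rw [← mul_assoc, ← Real.sqrt_mul h.1.le, mul_inv_cancel₀ h.1.ne', Real.sqrt_one, one_mul]
  refine ⟨?_, ?_, fun h => ?_, fun h => ?_⟩
  · rw [← tendsto_add_atTop_iff_nat 2, ← div_pow]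
    refine ((tendsto_pairOverlap hC hε0 hlam htl).const_sub 1).congr' ?_
    filter_upwards [hpos, hall, hback] with n h1 h2 h3
    rw [h3, MMSEn_eq h1.2.1 h1.2.2 h2.1]
  · rw [← tendsto_add_atTop_iff_nat 2]
    refine (tendsto_info_div hC hε0 hlam htl).congr' ?_
    filter_upwards [hpos, hback] with n h1 h3
    rw [h3, miSBM_eq h1.2.1 h1.2.2]
    push_cast
    rfl
  · rw [gfix_eq_zero hlam.le h]
    simp
  · have := gfix_pos h
    have : 0 < gfix lam ^ 2 / lam ^ 2 := by positivity
    linarith
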